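/- Fix an algebraically closed field K and integers n ≥ 2, m ≥ 1. The ring of matrix semi-invariants R(n,m) = K[Mat_{n,n}^m]^{SL_n × SL_n} is generated by its homogeneous elements of degree at most m·n^3·(n−1). -/

import Mathlib

open MvPolynomial Matrix

/-- Coordinate functions of an `m`-tuple of `n × n` matrices. -/
def matCoords {K : Type} [Field K] {n m : ℕ} (X : Fin m → Matrix (Fin n) (Fin n) K) :
    Fin m × Fin n × Fin n → K :=
  fun p => X p.1 p.2.1 p.2.2

/-- The ring of matrix semi-invariants `R(n,m) = K[Mat_{n,n}^m]^{SL_n × SL_n}`, where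
`(A,B)` acts by `(X_1, …, X_m) ↦ (A X_1 B⁻¹, …, A X_m B⁻¹)`. -/
noncomputable def matrixSemiInvariants (K : Type) [Field K] (n m : ℕ) :
    Subalgebra K (MvPolynomial (Fin m × Fin n × Fin n) K) :=
  ⨅ (A : SpecialLinearGroup (Fin n) K) (B : SpecialLinearGroup (Fin n) K)
    (X : Fin m → Matrix (Fin n) (Fin n) K),
      AlgHom.equalizer
        (aeval (matCoords fun i => A.val * X i * (B⁻¹).val))
        (aeval (matCoords X))

/-- The ring of matrix invariants `S(n,m) = K[Mat_{n,n}^m]^{GL_n}`, where `A` acts by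
simultaneous conjugation. -/
noncomputable def matrixInvariants (K : Type) [Field K] (n m : ℕ) :
    Subalgebra K (MvPolynomial (Fin m × Fin n × Fin n) K) :=
  ⨅ (A : GeneralLinearGroup (Fin n) K) (X : Fin m → Matrix (Fin n) (Fin n) K),
      AlgHom.equalizer
        (aeval (matCoords fun i => A.val * X i * (A⁻¹).val))
        (aeval (matCoords X))

open MvPolynomial Matrix
namespace SI

lemma exists_li_rows {F α β : Type*} [Field F] [Fintype α] [Fintype β] 
    (M : Matrix α β F) (r : ℕ) (hr : r ≤ M.rank) :
      ∃ f : Fin r → α, LinearIndependent F (M.submatrix f id).row := by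
  rw [rank_eq_finrank_span_row] at hr
  obtain ⟨v, hv, -, hli⟩ := Submodule.exists_fun_fin_finrank_span_eq F (Set.range M.row)
  choose f hf using hv
  refine ⟨fun i => f (Fin.castLE hr i), ?_⟩
  have := hli.comp (Fin.castLE hr) (Fin.castLE_injective hr)
  have e : (M.submatrix (fun i => f (Fin.castLE hr i)) id).row = v ∘ Fin.castLE hr := by
    funext i
    rw [Function.comp_apply, ← hf]; rfl
  rw [e]; exact this

lemma exists_minor {F α β : Type*} [Field F] [Fintype α] [Fintype β] 
    (M : Matrix α β F) (r : ℕ) (hr : r ≤ M.rank) :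
    ∃ (f : Fin r → α) (g : Fin r → β), (M.submatrix f g).det ≠ 0 := by
  classical
  obtain ⟨f, hf⟩ := exists_li_rows M r hr
  have h1 : r ≤ ((M.submatrix f id)ᵀ).rank := by
    rw [rank_transpose, hf.rank_matrix]; simp
  obtain ⟨g, hg⟩ := exists_li_rows _ r h1
  refine ⟨f, g, ?_⟩
  have : IsUnit ((M.submatrix f g)ᵀ) := by
    rw [← linearIndependent_rows_iff_isUnit]
    exact hg
  rw [Matrix.isUnit_iff_isUnit_det, det_transpose] at this
  exact this.ne_zero

lemma le_rank_of_minor {F α β : Type*} [Field F] [Fintype α] [Fintype β] 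
    (M : Matrix α β F) (r : ℕ) (f : Fin r → α) (g : Fin r → β)
    (h : (M.submatrix f g).det ≠ 0) : r ≤ M.rank := by
  have := rank_submatrix_le M f g
  rwa [rank_of_det_ne_zero h, Fintype.card_fin] at this

/-- Blow up. -/
def blow {R ι α κ κ' : Type*} [CommSemiring R] [Fintype ι] (x : ι → Matrix α α R)
    (T : ι → Matrix κ κ' R) : Matrix (α × κ) (α × κ') R :=
  Matrix.of fun p q => ∑ i, x i p.1 q.1 * T i p.2 q.2

lemma blow_apply {R ι α κ κ' : Type*} [CommSemiring R] [Fintype ι] (x : ι → Matrix α α R)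
    (T : ι → Matrix κ κ' R) (p q) : blow x T p q = ∑ i, x i p.1 q.1 * T i p.2 q.2 := rfl

lemma blow_map {R R' ι α κ κ' : Type*} [CommSemiring R] [CommSemiring R'] [Fintype ι]
    (φ : R →+* R') (x : ι → Matrix α α R)
    (T : ι → Matrix κ κ' R) : (blow x T).map φ = blow (fun i => (x i).map φ) (fun i => (T i).map φ) := by
  ext p q; simp [blow_apply]

lemma semilin_dvd {L β : Type*} [Field L] [Fintype β] (τ : L →+* L) (deg : L → ℤ)
    (hmul : ∀ a b, a ≠ 0 → b ≠ 0 → deg (a * b) = deg a + deg b)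
    (hτ : ∀ a, a ≠ 0 → deg (τ a) = deg a) (z : L) (hz : z ≠ 0) (hz1 : deg z = 1)
    (W : Submodule L (β → L)) (ψ : (β → L) →+ (β → L)) (hψ : ∀ c w, ψ (c • w) = τ c • ψ w)
    (hW : ∀ w ∈ W, ψ w ∈ W) (d : ℕ) (hd : ∀ w, ψ^[d] w = z • w) : d ∣ Module.finrank L W := by
  classical
  set e := Module.finrank L W with he
  have b := Module.finBasis L W
  rw [← he] at b
  let G : Matrix (Fin e) (Fin e) L := Matrix.of fun i j => b.repr ⟨ψ (b j), hW _ (b j).2⟩ i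
  have hG : ∀ j, ψ (b j) = ∑ i, G i j • (b i : β → L) := by
    intro j
    have := congrArg Subtype.val (b.sum_repr ⟨ψ (b j), hW _ (b j).2⟩)
    rw [AddSubmonoidClass.coe_finsetSum] at this
    exact this.symm
  let P : ℕ → Matrix (Fin e) (Fin e) L := fun k => Nat.rec 1 (fun _ Q => G * Q.map τ) k
  have hP : ∀ k j, ψ^[k] (b j) = ∑ i, P k i j • (b i : β → L) := by
    intro k
    induction k with
    | zero => intro j; simp [P, Matrix.one_apply]
    | succ k ih =>
      intro j
      rw [Function.iterate_succ_apply', ih, map_sum]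
      have : P (k+1) = G * (P k).map τ := rfl
      simp only [this, hψ, hG, Matrix.mul_apply, Matrix.map_apply, Finset.sum_smul, Finset.smul_sum, smul_smul]
      rw [Finset.sum_comm]
      refine Finset.sum_congr rfl fun i _ => Finset.sum_congr rfl fun j _ => ?_
      rw [mul_comm]
  have hli : LinearIndependent L (fun i => (b i : β → L)) := 
    b.linearIndependent.map' W.subtype (Submodule.ker_subtype _)
  have hPd : P d = z • 1 := by
    ext i j
    have h1 := hP d j
    rw [hd] at h1
    have h2 : ∑ i, (P d i j - if i = j then z else 0) • (b i : β → L) = 0 := by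
      simp [sub_smul, ← h1]
    have := Fintype.linearIndependent_iff.1 hli _ h2 i
    simpa [Matrix.one_apply, sub_eq_zero] using this
  have hdet : ∀ k, (P (k+1)).det = G.det * τ ((P k).det) := by
    intro k
    have : P (k+1) = G * (P k).map τ := rfl
    rw [this, det_mul, RingHom.map_det]; rfl
  have one : deg 1 = 0 := by
    have := hmul 1 1 one_ne_zero one_ne_zero
    simp at this; exact this
  have hpow : ∀ k : ℕ, deg (z^k) = k := by
    intro k
    induction k with
    | zero => simpa using one
    | succ k ih => rw [pow_succ, hmul _ _ (pow_ne_zero _ hz) hz, ih, hz1]; simp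
  have hPd2 : (P d).det = z ^ e := by rw [hPd]; simp
  by_cases h0 : G.det = 0
  · rcases Nat.eq_zero_or_pos d with rfl | hd0
    · have h3 : deg ((P 0).det) = e := by rw [hPd2, hpow]
      simp [P, one] at h3
      have h4 : e = 0 := by exact_mod_cast h3.symm
      rw [h4]
    · exfalso
      obtain ⟨k, rfl⟩ := Nat.exists_eq_add_of_lt hd0
      rw [zero_add] at hPd2
      rw [hdet, h0, zero_mul] at hPd2
      exact pow_ne_zero _ hz hPd2.symm
  have hdeg : ∀ k : ℕ, (P k).det ≠ 0 ∧ deg (P k).det = k * deg G.det := by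
    intro k
    induction k with
    | zero => simp [P, one]
    | succ k ih =>
      have h3 : τ ((P k).det) ≠ 0 := by simpa using ih.1
      refine ⟨by rw [hdet]; exact mul_ne_zero h0 h3, ?_⟩
      rw [hdet, hmul _ _ h0 h3, hτ _ ih.1, ih.2]; push_cast; ring
  have h5 := (hdeg d).2
  rw [hPd2, hpow] at h5
  have : (d : ℤ) ∣ (e : ℤ) := ⟨_, h5⟩
  exact_mod_cast this

end SI

open MvPolynomial Matrix
namespace SI
section reg
open scoped Fin.NatCast Fin.CommRing
variable (k ι : Type) [Field k] (c : ℕ)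

abbrev PP := Polynomial (MvPolynomial (ι × Fin (c+1) × Fin (c+1)) k)

def ren (p : ι × Fin (c+1) × Fin (c+1)) : ι × Fin (c+1) × Fin (c+1) := (p.1, p.2.1 - 1, p.2.2 - 1)

lemma ren_inj : Function.Injective (ren ι c) := by
  rintro ⟨i, u, v⟩ ⟨i', u', v'⟩ h
  simpa [ren] using h

lemma ren_iter (j : ℕ) (p) : (ren ι c)^[j] p = (p.1, p.2.1 - (j : Fin (c+1)), p.2.2 - (j : Fin (c+1))) := by
  induction j with
  | zero => simp
  | succ j ih => 
    rw [Function.iterate_succ_apply', ih]; simp [ren, sub_sub]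

noncomputable def tau0 : PP k ι c →+* PP k ι c := Polynomial.mapRingHom (rename (ren ι c)).toRingHom

lemma tau0_inj : Function.Injective (tau0 k ι c) :=
  Polynomial.map_injective _ (rename_injective _ (ren_inj ι c))

lemma natDegree_tau0 (p) : (tau0 k ι c p).natDegree = p.natDegree :=
  Polynomial.natDegree_map_eq_of_injective (rename_injective _ (ren_inj ι c)) p

lemma tau0_iter (j : ℕ) (p : PP k ι c) : (tau0 k ι c)^[j] p = Polynomial.map (rename ((ren ι c)^[j])).toRingHom p := by
  induction j with
  | zero => 
    ext n : 1
    simp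
  | succ j ih =>
    rw [Function.iterate_succ_apply', ih]
    ext n : 1
    simp only [tau0, Polynomial.coe_mapRingHom, Polynomial.coeff_map]
    change rename _ (rename _ _) = rename _ _
    rw [rename_rename, Function.iterate_succ']

lemma tau0_full (p : PP k ι c) : (tau0 k ι c)^[c+1] p = p := by
  have : (ren ι c)^[c+1] = id := by
    funext p; rw [ren_iter]; simp
  rw [tau0_iter, this]
  ext n : 1
  simp

abbrev LL := FractionRing (PP k ι c)

noncomputable def tau : LL k ι c →+* LL k ι c := IsFractionRing.map (tau0_inj k ι c)

lemma tau_alg (p) : tau k ι c (algebraMap _ _ p) = algebraMap _ _ (tau0 k ι c p) := by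
  unfold tau IsFractionRing.map
  exact IsLocalization.map_eq (T := nonZeroDivisors (PP k ι c)) _ _

lemma tau_iter_alg (j : ℕ) (p : PP k ι c) : (tau k ι c)^[j] (algebraMap _ _ p) = algebraMap _ _ ((tau0 k ι c)^[j] p) := by
  induction j with
  | zero => rfl
  | succ j ih => rw [Function.iterate_succ_apply', ih, tau_alg, Function.iterate_succ_apply']

lemma tau_full (a : LL k ι c) : (tau k ι c)^[c+1] a = a := by
  obtain ⟨p, q, hq, rfl⟩ := IsFractionRing.div_surjective (PP k ι c) a
  have := (tau k ι c).coe_pow (c+1)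
  rw [← RingHom.coe_pow, map_div₀, RingHom.coe_pow, tau_iter_alg, tau_iter_alg, tau0_full, tau0_full]

noncomputable def degL (a : LL k ι c) : ℤ :=
  let h := IsFractionRing.div_surjective (PP k ι c) a
  (h.choose.natDegree : ℤ) - (h.choose_spec.choose.natDegree : ℤ)

lemma degL_eq (a : LL k ι c) (ha : a ≠ 0) (p q : PP k ι c) (hq : q ≠ 0) (h : a = algebraMap _ _ p / algebraMap _ _ q) :
    degL k ι c a = (p.natDegree : ℤ) - q.natDegree := by
  set hh := IsFractionRing.div_surjective (PP k ι c) a with hhd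
  set p' := hh.choose with hp'
  set q' := hh.choose_spec.choose with hq'
  have h1 : q' ∈ nonZeroDivisors (PP k ι c) := hh.choose_spec.choose_spec.1
  have h2 : algebraMap (PP k ι c) (LL k ι c) p' / algebraMap _ _ q' = a := hh.choose_spec.choose_spec.2
  have hd : degL k ι c a = (p'.natDegree : ℤ) - q'.natDegree := rfl
  have h1' : q' ≠ 0 := nonZeroDivisors.ne_zero h1
  have i := IsFractionRing.injective (PP k ι c) (LL k ι c)
  have hqL : algebraMap (PP k ι c) (LL k ι c) q ≠ 0 := by
    simpa using hq
  have hqL' : algebraMap (PP k ι c) (LL k ι c) q' ≠ 0 := by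
    simpa using h1'
  have hp0 : p ≠ 0 := by rintro rfl; simp at h; exact ha h
  have hp0' : p' ≠ 0 := by rintro h0; rw [h0] at h2; simp at h2; exact ha h2.symm
  have h3 : p' * q = p * q' := by
    apply i
    rw [map_mul, map_mul]
    rw [← h2, div_eq_div_iff hqL' hqL] at h
    exact h
  have h4 := congrArg Polynomial.natDegree h3
  rw [Polynomial.natDegree_mul hp0' hq, Polynomial.natDegree_mul hp0 h1'] at h4
  rw [hd]; omega

lemma degL_mul (a b : LL k ι c) (ha : a ≠ 0) (hb : b ≠ 0) :
    degL k ι c (a*b) = degL k ι c a + degL k ι c b := by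
  obtain ⟨p, q, hq, h1⟩ := IsFractionRing.div_surjective (PP k ι c) a
  obtain ⟨p', q', hq', h2⟩ := IsFractionRing.div_surjective (PP k ι c) b
  have hq := nonZeroDivisors.ne_zero hq
  have hq' := nonZeroDivisors.ne_zero hq'
  have hp0 : p ≠ 0 := by rintro rfl; simp at h1; exact ha h1.symm
  have hp0' : p' ≠ 0 := by rintro rfl; simp at h2; exact hb h2.symm
  rw [degL_eq k ι c a ha p q hq h1.symm, degL_eq k ι c b hb p' q' hq' h2.symm,
    degL_eq k ι c (a*b) (mul_ne_zero ha hb) (p*p') (q*q') (mul_ne_zero hq hq'), Polynomial.natDegree_mul hp0 hp0',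
    Polynomial.natDegree_mul hq hq']
  · push_cast; ring
  · rw [← h1, ← h2, map_mul, map_mul, div_mul_div_comm]

lemma degL_tau (a : LL k ι c) (ha : a ≠ 0) :
    degL k ι c (tau k ι c a) = degL k ι c a := by
  obtain ⟨p, q, hq, h1⟩ := IsFractionRing.div_surjective (PP k ι c) a
  have hq := nonZeroDivisors.ne_zero hq
  rw [degL_eq k ι c a ha p q hq h1.symm, degL_eq k ι c _ (by simpa using ha) (tau0 k ι c p) (tau0 k ι c q), natDegree_tau0, natDegree_tau0]
  · simpa using (map_ne_zero_iff _ (tau0_inj k ι c)).2 hq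
  · rw [← h1, map_div₀, tau_alg, tau_alg]

noncomputable def zL : LL k ι c := algebraMap _ _ (Polynomial.X : PP k ι c)

lemma zL_ne : zL k ι c ≠ 0 := by simp [zL]
lemma tau_zL : tau k ι c (zL k ι c) = zL k ι c := by
  rw [zL, tau_alg]; simp [tau0]
lemma degL_zL : degL k ι c (zL k ι c) = 1 := by
  rw [degL_eq k ι c _ (zL_ne k ι c) Polynomial.X 1 one_ne_zero (by simp [zL])]; simp

noncomputable def yL (u : Fin (c+1)) : LL k ι c := if u = Fin.last c then zL k ι c else 1
lemma tau_yL (u) : tau k ι c (yL k ι c u) = yL k ι c u := by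
  unfold yL; split_ifs
  · exact tau_zL k ι c
  · simp

/-- generic matrices over 𝓟 -/
noncomputable def TP (i : ι) : Matrix (Fin (c+1)) (Fin (c+1)) (PP k ι c) :=
  Matrix.of fun u v => Polynomial.C (MvPolynomial.X (i, u, v)) * (if v < u then Polynomial.X else 1)

noncomputable def TL (i : ι) : Matrix (Fin (c+1)) (Fin (c+1)) (LL k ι c) := (TP k ι c i).map (algebraMap _ _)

lemma TL_apply (i : ι) (u v) : TL k ι c i u v = algebraMap _ _ (Polynomial.C (MvPolynomial.X (i,u,v)) : PP k ι c) * (if v < u then zL k ι c else 1) := by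
  simp only [TL, TP, Matrix.map_apply, Matrix.of_apply, map_mul, zL]
  split_ifs <;> simp

lemma TL_rel (i : ι) (u v) : TL k ι c i u v * yL k ι c v = yL k ι c u * tau k ι c (TL k ι c i (u+1) (v+1)) := by
  rw [TL_apply, TL_apply, map_mul, tau_alg]
  have h1 : tau0 k ι c (Polynomial.C (MvPolynomial.X (i,u+1,v+1))) = Polynomial.C (MvPolynomial.X (i,u,v)) := by
    simp [tau0, ren]
  have h2 : tau k ι c (if v+1 < u+1 then zL k ι c else 1) = (if v+1 < u+1 then zL k ι c else 1) := by
    split_ifs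
    · exact tau_zL k ι c
    · simp
  rw [h1, h2, mul_assoc, mul_left_comm (yL k ι c u)]
  congr 1
  unfold yL
  induction u using Fin.lastCases with
  | last => 
    induction v using Fin.lastCases with
    | last => simp
    | cast v => simp [Fin.castSucc_lt_last, (Fin.castSucc_lt_last v).ne]
  | cast u => 
    induction v using Fin.lastCases with
    | last => simp [(Fin.castSucc_lt_last u).ne, (Fin.castSucc_lt_last u).le]
    | cast v => simp [(Fin.castSucc_lt_last u).ne, (Fin.castSucc_lt_last v).ne]

noncomputable def psi (α : Type) : (α × Fin (c+1) → LL k ι c) →+ (α × Fin (c+1) → LL k ι c) where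
  toFun w p := yL k ι c p.2 * tau k ι c (w (p.1, p.2 + 1))
  map_zero' := by ext; simp
  map_add' := by intros; ext; simp [mul_add]

lemma psi_iter (α : Type) (j : ℕ) (w : α × Fin (c+1) → LL k ι c) (p) :
    (psi k ι c α)^[j] w p = (∏ t ∈ Finset.range j, yL k ι c (p.2 + (t : Fin (c+1)))) * (tau k ι c)^[j] (w (p.1, p.2 + (j : Fin (c+1)))) := by
  induction j generalizing p with
  | zero => simp
  | succ j ih =>
    rw [Function.iterate_succ_apply', Finset.prod_range_succ', Function.iterate_succ_apply']
    change yL k ι c p.2 * tau k ι c (((psi k ι c α)^[j] w) (p.1, p.2+1)) = _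
    rw [ih, map_mul, map_prod]
    simp only [tau_yL]
    have : ∀ t : ℕ, p.2 + 1 + (t : Fin (c+1)) = p.2 + ((t+1 : ℕ) : Fin (c+1)) := by
      intro t; push_cast; ring
    simp only [this]
    simp; ring

lemma psi_full (α : Type) (w : α × Fin (c+1) → LL k ι c) : (psi k ι c α)^[c+1] w = zL k ι c • w := by
  ext p
  rw [psi_iter, tau_full, Finset.prod_range]
  have : ∏ i : Fin (c+1), yL k ι c (p.2 + ((i:ℕ) : Fin (c+1))) = zL k ι c := by
    simp only [Fin.cast_val_eq_self]
    rw [Fintype.prod_equiv (Equiv.addLeft p.2) (fun i => yL k ι c (p.2 + i)) (fun i => yL k ι c i) (fun i => rfl)]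
    simp [yL]
  rw [this]
  simp

lemma dvd_rank [Fintype ι] {α : Type} [Fintype α] (x : ι → Matrix α α k) :
    (c+1) ∣ (blow (fun i => (x i).map (algebraMap (PP k ι c) (LL k ι c) ∘ (algebraMap k _))) (TL k ι c)).rank := by
  classical
  set N := (blow (fun i => (x i).map (algebraMap (PP k ι c) (LL k ι c) ∘ (algebraMap k _))) (TL k ι c)) with hN
  have hrel : ∀ a b u v, N (a,u) (b,v) * yL k ι c v = yL k ι c u * tau k ι c (N (a,u+1) (b,v+1)) := by
    intro a b u v
    simp only [hN, blow_apply, Finset.sum_mul, Finset.mul_sum, map_sum]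
    refine Finset.sum_congr rfl fun i _ => ?_
    rw [mul_assoc, TL_rel, map_mul]
    have : tau k ι c ((x i).map (algebraMap (PP k ι c) (LL k ι c) ∘ (algebraMap k _)) a b) = ((x i).map (algebraMap (PP k ι c) (LL k ι c) ∘ (algebraMap k _)) a b) := by
      simp only [Matrix.map_apply, Function.comp_apply]
      rw [tau_alg]; congr 1
      simp [tau0, Polynomial.algebraMap_apply, MvPolynomial.algebraMap_eq]
    rw [this]; ring
  have h1 := semilin_dvd (tau k ι c) (degL k ι c) (degL_mul k ι c) (degL_tau k ι c) (zL k ι c) (zL_ne k ι c)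
    (degL_zL k ι c) (LinearMap.ker N.mulVecLin) (psi k ι c α) ?_ ?_ (c+1) (psi_full k ι c α)
  · have h2 := LinearMap.finrank_range_add_finrank_ker N.mulVecLin
    have h3 : N.rank = Module.finrank _ (LinearMap.range N.mulVecLin) := rfl
    rw [← h3] at h2
    simp only [Module.finrank_fintype_fun_eq_card, Fintype.card_prod, Fintype.card_fin] at h2
    exact (Nat.dvd_add_left h1).1 (h2 ▸ Dvd.intro_left _ rfl)
  · intro a w; ext p; simp [psi]; ring
  · intro w hw
    rw [LinearMap.mem_ker, Matrix.mulVecLin_apply] at hw ⊢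
    ext ⟨a, u⟩
    have h4 := congrArg (fun v => yL k ι c u * tau k ι c (v (a,u+1))) hw
    simp only [Matrix.mulVec, dotProduct, Pi.zero_apply, map_zero, mul_zero] at h4 ⊢
    rw [← h4, map_sum, Finset.mul_sum]
    refine Fintype.sum_equiv ((Equiv.refl α).prodCongr (Equiv.addRight 1)) _ _ ?_
    rintro ⟨b, v⟩
    simp only [psi, AddMonoidHom.coe_mk, ZeroHom.coe_mk, Equiv.prodCongr_apply, Prod.map, Equiv.refl_apply, Equiv.coe_addRight, map_mul]
    rw [← mul_assoc, hrel, mul_assoc]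

lemma exists_eval_ne [Infinite k] (p : PP k ι c) (hp : p ≠ 0) :
    ∃ φ : PP k ι c →ₐ[k] k, φ p ≠ 0 := by
  obtain ⟨j, hj⟩ : ∃ j, p.coeff j ≠ 0 := by
    by_contra h; push Not at h; exact hp (Polynomial.ext h)
  obtain ⟨s, hs⟩ : ∃ s, MvPolynomial.eval s (p.coeff j) ≠ 0 := by
    by_contra h; push Not at h
    exact hj (MvPolynomial.funext (by simpa using h))
  have h2 : p.map (MvPolynomial.eval s) ≠ 0 := by
    intro h; apply hs
    rw [← Polynomial.coeff_map, h]; simp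
  obtain ⟨t, ht⟩ : ∃ t, Polynomial.eval t (p.map (MvPolynomial.eval s)) ≠ 0 := by
    by_contra h; push Not at h
    exact h2 (Polynomial.funext (by simpa using h))
  refine ⟨AlgHom.mk (Polynomial.eval₂RingHom (MvPolynomial.eval s) t) ?_, ?_⟩
  · intro r; simp [Polynomial.algebraMap_apply, MvPolynomial.algebraMap_eq]
  · simpa [Polynomial.eval_map] using ht

theorem regularity [Infinite k] [Fintype ι] {α : Type} [Fintype α] (x : ι → Matrix α α k)
   (s : ℕ) (T0 : ι → Matrix (Fin (c+1)) (Fin (c+1)) k) (h : s * (c+1) < (blow x T0).rank) :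
   ∃ T : ι → Matrix (Fin (c+1)) (Fin (c+1)) k, (s+1) * (c+1) ≤ (blow x T).rank := by
  classical
  have hdv := dvd_rank k ι c x
  set NP := blow (fun i => (x i).map (algebraMap k (PP k ι c))) (TP k ι c) with hNP
  have hNL : (blow (fun i => (x i).map (algebraMap (PP k ι c) (LL k ι c) ∘ (algebraMap k _))) (TL k ι c)) = 
    NP.map (algebraMap (PP k ι c) (LL k ι c)) := by
    rw [hNP, blow_map]; rfl
  have spec : ∀ φ : PP k ι c →ₐ[k] k, NP.map φ = blow x (fun i => (TP k ι c i).map φ) := by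
    intro φ
    have := blow_map (φ : PP k ι c →+* k) (fun i => (x i).map (algebraMap k (PP k ι c))) (TP k ι c)
    rw [← hNP] at this
    rw [show (⇑(φ : PP k ι c →+* k)) = ⇑φ from rfl] at this
    rw [this]
    congr 1
    ext i a b
    exact φ.commutes _
  rw [hNL] at hdv
  have big : s * (c+1) < (NP.map (algebraMap (PP k ι c) (LL k ι c))).rank := by
    obtain ⟨r, hr⟩ : ∃ r, r = (blow x T0).rank := ⟨_, rfl⟩
    rw [← hr] at h
    obtain ⟨f, g, hfg⟩ := exists_minor _ _ hr.le
    refine lt_of_lt_of_le h (le_rank_of_minor _ _ f g ?_)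
    let φ : PP k ι c →ₐ[k] k := AlgHom.mk (Polynomial.eval₂RingHom (MvPolynomial.eval fun p => T0 p.1 p.2.1 p.2.2) 1)
      (by intro r; simp [Polynomial.algebraMap_apply, MvPolynomial.algebraMap_eq])
    have h1 : NP.map φ = blow x T0 := by
      rw [spec]; congr 1
      ext i u v
      simp only [TP, φ, Matrix.map_apply, Matrix.of_apply]
      split_ifs <;> simp
    intro h0
    rw [Matrix.submatrix_map] at h0
    have h0 : ((algebraMap (PP k ι c) (LL k ι c)).mapMatrix (NP.submatrix f g)).det = 0 := h0
    rw [← RingHom.map_det, map_eq_zero_iff _ (IsFractionRing.injective (PP k ι c) (LL k ι c))] at h0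
    apply hfg
    rw [← h1, Matrix.submatrix_map]
    change (φ.toRingHom.mapMatrix (NP.submatrix f g)).det = 0
    rw [← RingHom.map_det, h0, map_zero]
  have big2 : (s+1) * (c+1) ≤ (NP.map (algebraMap (PP k ι c) (LL k ι c))).rank := by
    obtain ⟨t, ht⟩ := hdv
    rw [ht] at big ⊢
    have : s < t := by
      by_contra hh; push Not at hh
      have := Nat.mul_le_mul_right (c+1) hh
      nlinarith
    nlinarith
  obtain ⟨f, g, hfg⟩ := exists_minor _ _ big2
  rw [Matrix.submatrix_map] at hfg
  have h0 : ((algebraMap (PP k ι c) (LL k ι c)).mapMatrix (NP.submatrix f g)).det ≠ 0 := hfg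
  rw [← RingHom.map_det, map_ne_zero_iff _ (IsFractionRing.injective (PP k ι c) (LL k ι c))] at h0
  obtain ⟨φ, hφ⟩ := exists_eval_ne k ι c _ h0
  refine ⟨fun i => (TP k ι c i).map φ, ?_⟩
  rw [← spec]
  refine le_rank_of_minor _ _ f g ?_
  rw [Matrix.submatrix_map]
  change (φ.toRingHom.mapMatrix (NP.submatrix f g)).det ≠ 0
  rw [← RingHom.map_det]
  exact hφ

end reg
end SI

open MvPolynomial Matrix
namespace SI

lemma blow_reindex {k ι α κ κ' μ μ' : Type*} [CommSemiring k] [Fintype ι] (x : ι → Matrix α α k)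
    (T : ι → Matrix κ κ' k) (f : μ → κ) (g : μ' → κ') :
    blow x (fun i => (T i).submatrix f g) = (blow x T).submatrix (Prod.map id f) (Prod.map id g) := by
  ext p q; simp [blow_apply]

lemma rank_blow_equiv {k ι α κ μ : Type*} [Field k] [Fintype ι] [Fintype α] [Fintype κ] [Fintype μ] (x : ι → Matrix α α k)
    (T : ι → Matrix κ κ k) (f : μ ≃ κ) :
    (blow x (fun i => (T i).submatrix f f)).rank = (blow x T).rank := by
  rw [blow_reindex]
  exact rank_submatrix _ ((Equiv.refl α).prodCongr f) ((Equiv.refl α).prodCongr f)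

theorem regularity' {k ι α κ : Type} [Field k] [Infinite k] [Fintype ι] [Fintype α] [Fintype κ] [Nonempty κ]
    (x : ι → Matrix α α k)
    (s : ℕ) (T0 : ι → Matrix κ κ k) (h : s * Fintype.card κ < (blow x T0).rank) :
    ∃ T : ι → Matrix κ κ k, (s+1) * Fintype.card κ ≤ (blow x T).rank := by
  obtain ⟨c, hc⟩ : ∃ c, Fintype.card κ = c + 1 := Nat.exists_eq_succ_of_ne_zero Fintype.card_ne_zero
  let e : Fin (c+1) ≃ κ := (Fintype.equivFinOfCardEq hc).symm
  rw [← rank_blow_equiv x T0 e, hc] at h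
  obtain ⟨T, hT⟩ := regularity k ι c x s _ h
  refine ⟨fun i => (T i).submatrix e.symm e.symm, ?_⟩
  rw [rank_blow_equiv, hc]; exact hT

lemma rank_LA {k V W V' W' : Type*} [Field k] [AddCommGroup V] [Module k V] [AddCommGroup W] [Module k W]
    [AddCommGroup V'] [Module k V'] [AddCommGroup W'] [Module k W'] [FiniteDimensional k V] [FiniteDimensional k W]
    [FiniteDimensional k V'] [FiniteDimensional k W'] (f : V →ₗ[k] V') (g : V →ₗ[k] W') (h : W →ₗ[k] W')
    (F : (V × W) →ₗ[k] (V' × W')) (hF : ∀ v w, F (v, w) = (f v, g v + h w)) :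
    Module.finrank k (LinearMap.range f) + Module.finrank k (LinearMap.range h) ≤ Module.finrank k (LinearMap.range F) ∧
    (Module.finrank k (LinearMap.range f) + Module.finrank k (LinearMap.range h) = Module.finrank k (LinearMap.range F) →
      ∀ v, f v = 0 → g v ∈ LinearMap.range h) := by
  set R := LinearMap.range F with hR
  let π : R →ₗ[k] V' := LinearMap.fst k V' W' ∘ₗ R.subtype
  have e1 := LinearMap.finrank_range_add_finrank_ker π
  have e2 : LinearMap.range π = LinearMap.range f := by
    ext y; constructor
    · rintro ⟨⟨r, ⟨⟨v, w⟩, rfl⟩⟩, rfl⟩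
      exact ⟨v, by simp [π, hF]⟩
    · rintro ⟨v, rfl⟩
      exact ⟨⟨F (v, 0), ⟨_, rfl⟩⟩, by simp [π, hF]⟩
  let Q : Submodule k W' := (LinearMap.ker f).map g ⊔ LinearMap.range h
  let q : LinearMap.ker π →ₗ[k] W' := LinearMap.snd k V' W' ∘ₗ R.subtype ∘ₗ (LinearMap.ker π).subtype
  have e3 : LinearMap.range q = Q := by
    apply le_antisymm
    · rintro _ ⟨⟨⟨r, ⟨⟨v, w⟩, rfl⟩⟩, hr⟩, rfl⟩
      have : f v = 0 := by simpa [π, hF] using hr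
      simp only [q, LinearMap.comp_apply, Submodule.subtype_apply, LinearMap.snd_apply, hF]
      exact Submodule.add_mem_sup ⟨v, this, rfl⟩ ⟨w, rfl⟩
    · apply sup_le
      · rintro _ ⟨v, hv, rfl⟩
        have hv : f v = 0 := hv
        exact ⟨⟨⟨F (v, 0), ⟨_, rfl⟩⟩, by simp [π, hF, hv]⟩, by simp [q, hF]⟩
      · rintro _ ⟨w, rfl⟩
        exact ⟨⟨⟨F (0, w), ⟨_, rfl⟩⟩, by simp [π, hF]⟩, by simp [q, hF]⟩
  have e4 : Module.finrank k (LinearMap.ker π) = Module.finrank k Q := by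
    rw [← e3]
    refine (LinearMap.finrank_range_of_inj ?_).symm
    rintro ⟨⟨⟨a, b⟩, hr⟩, hk⟩ ⟨⟨⟨a', b'⟩, hr'⟩, hk'⟩ h0
    have h1 : a = 0 := hk
    have h1' : a' = 0 := hk'
    have h2 : b = b' := h0
    subst h1 h1' h2; rfl
  rw [e2, e4] at e1
  have le : LinearMap.range h ≤ Q := le_sup_right
  have := Submodule.finrank_mono le
  refine ⟨by omega, fun heq v hv => ?_⟩
  have h5 : LinearMap.range h = Q := Submodule.eq_of_le_of_finrank_eq le (by omega)
  rw [h5]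
  exact Submodule.mem_sup_left ⟨v, hv, rfl⟩

section W
variable {k ι α : Type} [Field k] [Fintype ι] [Fintype α]

lemma blow_mulVec_fromBlocks {κ κ' μ μ' : Type} [Fintype κ] [Fintype κ'] (x : ι → Matrix α α k)
   (T : ι → Matrix μ κ k) (B : ι → Matrix μ κ' k) (A : ι → Matrix μ' κ k) (D : ι → Matrix μ' κ' k) (v : α × κ → k) (w : α × κ' → k) (p : α × (μ ⊕ μ')) :
   (blow x (fun i => fromBlocks (T i) (B i) (A i) (D i)) *ᵥ (fun q => Sum.elim (fun c => v (q.1, c)) (fun c => w (q.1, c)) q.2)) p = 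
    Sum.elim (fun c => (blow x T *ᵥ v) (p.1, c) + (blow x B *ᵥ w) (p.1, c)) (fun c => (blow x A *ᵥ v) (p.1,c) + (blow x D *ᵥ w) (p.1,c)) p.2 := by
  obtain ⟨a, c | c⟩ := p <;>
  simp [mulVec, dotProduct, blow_apply, Fintype.sum_prod_type, Fintype.sum_sum_type, Finset.sum_add_distrib]

lemma blk {κ κ' : Type} [Fintype κ] [Fintype κ'] (x : ι → Matrix α α k)
   (T : ι → Matrix κ κ k) (A : ι → Matrix κ' κ k) (D : ι → Matrix κ' κ' k) :
   (blow x T).rank + (blow x D).rank ≤ (blow x (fun i => fromBlocks (T i) 0 (A i) (D i))).rank ∧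
   ((blow x T).rank + (blow x D).rank = (blow x (fun i => fromBlocks (T i) 0 (A i) (D i))).rank → 
     ∀ v, blow x T *ᵥ v = 0 → ∃ w, blow x D *ᵥ w = blow x A *ᵥ v) := by
  let e : (α × (κ ⊕ κ') → k) ≃ₗ[k] (α × κ → k) × (α × κ' → k) := 
    (LinearEquiv.funCongrLeft k k (Equiv.prodSumDistrib α κ κ').symm).trans (LinearEquiv.sumArrowLequivProdArrow _ _ k k)
  let F := e.toLinearMap ∘ₗ (blow x (fun i => fromBlocks (T i) 0 (A i) (D i))).mulVecLin ∘ₗ e.symm.toLinearMap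
  have hF : ∀ v w, F (v, w) = ((blow x T).mulVecLin v, (blow x A).mulVecLin v + (blow x D).mulVecLin w) := by
    intro v w
    have h1 : e.symm (v, w) = fun q => Sum.elim (fun c => v (q.1, c)) (fun c => w (q.1, c)) q.2 := by
      rw [LinearEquiv.symm_apply_eq]
      ext p <;> rfl
    have h2 := fun p => blow_mulVec_fromBlocks x T (fun _ => 0) A D v w p
    have h3 : blow x (fun _ => (0 : Matrix κ κ' k)) = 0 := by ext; simp [blow_apply]
    simp only [F, LinearMap.comp_apply, LinearEquiv.coe_coe, h1, Matrix.mulVecLin_apply]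
    ext p
    · change (blow x _ *ᵥ _) (p.1, Sum.inl p.2) = _
      rw [h2, h3]; simp
    · change (blow x _ *ᵥ _) (p.1, Sum.inr p.2) = _
      rw [h2]; simp
  have hr : Module.finrank k (LinearMap.range F) = (blow x (fun i => fromBlocks (T i) 0 (A i) (D i))).rank := by
    rw [LinearMap.range_comp, LinearEquiv.finrank_map_eq, LinearMap.range_comp_of_range_eq_top _ (LinearEquiv.range _)]
    rfl
  have := rank_LA (blow x T).mulVecLin (blow x A).mulVecLin (blow x D).mulVecLin F hF
  rw [hr] at this
  exact this

end W
end SI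

open MvPolynomial Matrix
namespace SI
section W
variable {k ι α : Type} [Field k] [Fintype ι] [Fintype α]

/-- no shrunk subspace -/
def NotShrunk (x : ι → Matrix α α k) : Prop :=
  ∀ U : Submodule k (α → k), Module.finrank k U ≤ Module.finrank k (⨆ i, U.map (x i).mulVecLin : Submodule k (α → k))

def IsState (x : ι → Matrix α α k) (s : ℕ) (κ : Type) [Fintype κ] (P : Submodule k (α × κ → k)) : Prop :=
  ∃ (κ' : Type) (_ : Fintype κ') (A : ι → Matrix κ' κ k) (D : ι → Matrix κ' κ' k),
    s * Fintype.card κ' ≤ (blow x D).rank ∧ ∀ v, v ∈ P ↔ ∃ w, blow x D *ᵥ w = blow x A *ᵥ v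

lemma state_top (x : ι → Matrix α α k) (s : ℕ) (κ : Type) [Fintype κ] : IsState x s κ ⊤ :=
  ⟨Empty, inferInstance, 0, 0, by simp, fun v => by simp [funext_iff]⟩

lemma state_inf (x : ι → Matrix α α k) (s : ℕ) (κ : Type) [Fintype κ] (P Q : Submodule k (α × κ → k))
    (hP : IsState x s κ P) (hQ : IsState x s κ Q) : IsState x s κ (P ⊓ Q) := by
  obtain ⟨κ1, _, A1, D1, h1, h1'⟩ := hP
  obtain ⟨κ2, _, A2, D2, h2, h2'⟩ := hQ
  refine ⟨κ1 ⊕ κ2, inferInstance, fun i => (fromRows (A1 i) (A2 i)), fun i => fromBlocks (D1 i) 0 0 (D2 i), ?_, ?_⟩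
  · have := (blk x D1 (fun _ => 0) D2).1
    rw [Fintype.card_sum, mul_add]
    omega
  · intro v
    rw [Submodule.mem_inf, h1', h2']
    have hA : ∀ p, (blow x (fun i => (fromRows (A1 i) (A2 i))) *ᵥ v) p = 
      Sum.elim (fun c => (blow x A1 *ᵥ v) (p.1, c)) (fun c => (blow x A2 *ᵥ v) (p.1, c)) p.2 := by
      rintro ⟨a, c | c⟩ <;> simp [mulVec, dotProduct, blow_apply]
    have h3 : ∀ μ μ' : Type, blow x (fun _ => (0 : Matrix μ μ' k)) = 0 := by intros; ext; simp [blow_apply]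
    have hD := blow_mulVec_fromBlocks x D1 (fun _ => 0) (fun _ => 0) D2
    simp only [h3] at hD
    constructor
    · rintro ⟨⟨w1, e1⟩, ⟨w2, e2⟩⟩
      refine ⟨_, funext fun p => (hD w1 w2 p).trans ?_⟩
      rw [hA, e1, e2]; simp
    · rintro ⟨w, hw⟩
      have hw' : w = (fun q => Sum.elim (fun c => w (q.1, Sum.inl c)) (fun c => w (q.1, Sum.inr c)) q.2) := by
        ext ⟨a, c | c⟩ <;> rfl
      rw [hw'] at hw
      have e := fun p => (hD (fun q => w (q.1, Sum.inl q.2)) (fun q => w (q.1, Sum.inr q.2)) p).symm.trans ((congrFun hw p).trans (hA p))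
      refine ⟨⟨(fun q => w (q.1, Sum.inl q.2)), ?_⟩, ⟨(fun q => w (q.1, Sum.inr q.2)), ?_⟩⟩
      · ext p; simpa using e (p.1, Sum.inl p.2)
      · ext p; simpa using e (p.1, Sum.inr p.2)

lemma state_step (x : ι → Matrix α α k) (s : ℕ) (κ : Type) [Fintype κ] (P : Submodule k (α × κ → k))
    (T0 T : ι → Matrix κ κ k) (hT0 : s * Fintype.card κ ≤ (blow x T0).rank)
    (hP : IsState x s κ P) : IsState x s κ ((P.map (blow x T0).mulVecLin).comap (blow x T).mulVecLin) := by
  obtain ⟨κ1, _, A1, D1, h1, h1'⟩ := hP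
  refine ⟨κ ⊕ κ1, inferInstance, fun i => fromRows (T i) 0, fun i => fromBlocks (T0 i) 0 (A1 i) (D1 i), ?_, ?_⟩
  · have := (blk x T0 A1 D1).1
    rw [Fintype.card_sum, mul_add]
    omega
  · intro v
    rw [Submodule.mem_comap, Submodule.mem_map]
    have hA : ∀ p, (blow x (fun i => (fromRows (T i) (0 : Matrix κ1 κ k))) *ᵥ v) p = 
      Sum.elim (fun c => (blow x T *ᵥ v) (p.1, c)) (fun c => 0) p.2 := by
      rintro ⟨a, c | c⟩ <;> simp [mulVec, dotProduct, blow_apply]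
    have h3 : ∀ μ μ' : Type, blow x (fun _ => (0 : Matrix μ μ' k)) = 0 := by intros; ext; simp [blow_apply]
    have hD := blow_mulVec_fromBlocks x T0 (fun _ => 0) A1 D1
    simp only [h3] at hD
    constructor
    · rintro ⟨y, hy, e1⟩
      obtain ⟨w, hw⟩ := (h1' y).1 hy
      refine ⟨_, funext fun p => (hD y (-w) p).trans ?_⟩
      simp only [mulVecLin_apply] at e1
      rw [hA, e1, mulVec_neg, mulVec_neg, hw]; simp
    · rintro ⟨w, hw⟩
      have hw' : w = (fun q => Sum.elim (fun c => w (q.1, Sum.inl c)) (fun c => w (q.1, Sum.inr c)) q.2) := by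
        ext ⟨a, c | c⟩ <;> rfl
      rw [hw'] at hw
      have e := fun p => (hD (fun q => w (q.1, Sum.inl q.2)) (fun q => w (q.1, Sum.inr q.2)) p).symm.trans ((congrFun hw p).trans (hA p))
      refine ⟨(fun q => w (q.1, Sum.inl q.2)), (h1' _).2 ⟨-(fun q => w (q.1, Sum.inr q.2)), ?_⟩, ?_⟩
      · ext p
        rw [mulVec_neg, Pi.neg_apply, neg_eq_iff_add_eq_zero, add_comm]
        simpa using e (p.1, Sum.inr p.2)
      · ext p; simpa using e (p.1, Sum.inl p.2)

lemma state_ker (x : ι → Matrix α α k) (s : ℕ) (κ : Type) [Fintype κ] [Nonempty κ] (P : Submodule k (α × κ → k))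
    (H : ∀ (κ : Type) [Fintype κ] [Nonempty κ] (T : ι → Matrix κ κ k), (blow x T).rank ≤ s * Fintype.card κ)
    (T0 : ι → Matrix κ κ k) (hT0 : s * Fintype.card κ ≤ (blow x T0).rank)
    (hP : IsState x s κ P) : LinearMap.ker (blow x T0).mulVecLin ≤ P := by
  obtain ⟨κ1, _, A1, D1, h1, h1'⟩ := hP
  have := blk x T0 A1 D1
  have h2 := H (κ ⊕ κ1) (fun i => fromBlocks (T0 i) 0 (A1 i) (D1 i))
  rw [Fintype.card_sum, mul_add] at h2
  intro v hv
  exact (h1' v).2 (this.2 (by omega) v hv)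

lemma finrank_slices (κ : Type) [Fintype κ] (U : Submodule k (α → k)) (S : Submodule k (α × κ → k))
    (hS : ∀ v, v ∈ S ↔ ∀ c, (fun a => v (a, c)) ∈ U) : Module.finrank k S = Fintype.card κ * Module.finrank k U := by
  let e : S ≃ₗ[k] (κ → U) :=
    { toFun := fun v c => ⟨fun a => v.1 (a, c), (hS v.1).1 v.2 c⟩
      invFun := fun f => ⟨fun p => (f p.2).1 p.1, (hS _).2 fun c => (f c).2⟩
      map_add' := fun _ _ => rfl
      map_smul' := fun _ _ => rfl
      left_inv := fun _ => rfl
      right_inv := fun _ => rfl }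
  rw [e.finrank_eq, Module.finrank_pi_fintype]
  simp

lemma exists_slices (κ : Type) (U : Submodule k (α → k)) : ∃ S : Submodule k (α × κ → k),
    (∀ v, v ∈ S ↔ ∀ c, (fun a => v (a, c)) ∈ U) :=
  ⟨⨅ c, U.comap (LinearMap.funLeft k k (fun a => (a, c))), fun v => by simp; rfl⟩

theorem exists_blow_nonsing [Infinite k] (x : ι → Matrix α α k) (hx : NotShrunk x) :
    ∃ (c : ℕ) (T : ι → Matrix (Fin (c+1)) (Fin (c+1)) k), Fintype.card α * (c+1) ≤ (blow x T).rank := by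
  classical
  set n := Fintype.card α with hn
  by_contra hcon
  let Pr : ℕ → Prop := fun s => ∃ (c : ℕ) (T : ι → Matrix (Fin (c+1)) (Fin (c+1)) k), s * (c+1) ≤ (blow x T).rank
  have h0 : Pr 0 := ⟨0, 0, by simp⟩
  obtain ⟨s, hs, hs'⟩ : ∃ s, Pr s ∧ ¬ Pr (s+1) := by
    by_contra h; push Not at h
    exact hcon (Nat.rec h0 h n : Pr n)
  have hsn : s < n := by
    by_contra h; push Not at h
    obtain ⟨c, T, hT⟩ := hs
    exact hcon ⟨c, T, le_trans (Nat.mul_le_mul_right _ h) hT⟩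
  have H : ∀ (κ : Type) [Fintype κ] [Nonempty κ] (T : ι → Matrix κ κ k), (blow x T).rank ≤ s * Fintype.card κ := by
    intro κ _ _ T
    by_contra h; push Not at h
    obtain ⟨T, hT⟩ := regularity' x s T h
    obtain ⟨c, hc⟩ : ∃ c, Fintype.card κ = c + 1 := Nat.exists_eq_succ_of_ne_zero Fintype.card_ne_zero
    let e : Fin (c+1) ≃ κ := (Fintype.equivFinOfCardEq hc).symm
    rw [← rank_blow_equiv x T e, hc] at hT
    exact hs' ⟨c, _, hT⟩
  obtain ⟨κ, _, _, T0, hT0'⟩ : ∃ (κ : Type) (_ : Fintype κ) (_ : Nonempty κ) (T0 : ι → Matrix κ κ k), s * Fintype.card κ ≤ (blow x T0).rank := by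
    obtain ⟨c, T0, hT0⟩ := hs
    exact ⟨Fin (c+1), inferInstance, inferInstance, T0, by simpa using hT0⟩
  obtain ⟨P, hP, hmin⟩ : ∃ P, IsState x s κ P ∧ ∀ Q, IsState x s κ Q → Module.finrank k P ≤ Module.finrank k Q := by
    let S : Set ℕ := {j | ∃ P, IsState x s κ P ∧ Module.finrank k P = j}
    have hS : S.Nonempty := ⟨_, ⊤, state_top x s κ, rfl⟩
    obtain ⟨P, h1, h2⟩ := Nat.sInf_mem hS
    exact ⟨P, h1, fun Q hQ => h2 ▸ Nat.sInf_le ⟨Q, hQ, rfl⟩⟩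
  set M := (blow x T0).mulVecLin
  have hker : LinearMap.ker M ≤ P := state_ker x s κ P H T0 hT0' hP
  have hN : ∀ (T : ι → Matrix κ κ k) (v), v ∈ P → blow x T *ᵥ v ∈ P.map M := by
    intro T v hv
    have h1 := state_inf x s κ _ _ hP (state_step x s κ P T0 T hT0' hP)
    have h2 := hmin _ h1
    have h3 := Submodule.eq_of_le_of_finrank_le inf_le_left h2
    rw [← h3] at hv
    exact hv.2
  have hMP : Module.finrank k (P.map M) < Module.finrank k P := by
    have h1 := LinearMap.finrank_range_add_finrank_ker (M.domRestrict P)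
    have h2 : LinearMap.range (M.domRestrict P) = P.map M := by
      rw [LinearMap.range_domRestrict]
    rw [h2] at h1
    have h3 := LinearMap.finrank_range_add_finrank_ker M
    have h4 : Module.finrank k (LinearMap.range M) ≤ s * Fintype.card κ := H κ T0
    simp only [Module.finrank_fintype_fun_eq_card, Fintype.card_prod, ← hn] at h3
    have h5 : s * Fintype.card κ < n * Fintype.card κ := Nat.mul_lt_mul_of_pos_right hsn Fintype.card_pos
    have h6 : 0 < Module.finrank k (LinearMap.ker M) := by omega
    have h7 : Module.finrank k (LinearMap.ker (M.domRestrict P)) = Module.finrank k (LinearMap.ker M) := by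
      rw [LinearMap.ker_domRestrict]
      exact (Submodule.comapSubtypeEquivOfLe hker).finrank_eq
    omega
  let U : Submodule k (α → k) := ⨆ c : κ, P.map (LinearMap.funLeft k k (fun a => (a, c)))
  let xU : Submodule k (α → k) := ⨆ i, U.map (x i).mulVecLin
  obtain ⟨S1, hS1⟩ := exists_slices κ U
  obtain ⟨S2, hS2⟩ := exists_slices κ xU
  have l1 : P ≤ S1 := by
    intro v hv
    rw [hS1]
    intro c
    exact Submodule.mem_iSup_of_mem c ⟨v, hv, rfl⟩
  have put : ∀ (c : κ) (w), w ∈ xU → (fun p : α × κ => if p.2 = c then w p.1 else 0) ∈ P.map M := by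
    intro c w hw
    let em : (α → k) →ₗ[k] (α × κ → k) := 
      { toFun := fun w p => if p.2 = c then w p.1 else 0
        map_add' := by intros; ext; simp; split_ifs <;> simp
        map_smul' := by intros; ext; simp }
    have : xU ≤ (P.map M).comap em := by
      refine iSup_le fun i => ?_
      rw [Submodule.map_le_iff_le_comap]
      refine iSup_le fun c' => ?_
      rw [Submodule.map_le_iff_le_comap]
      intro v hv
      have := hN (fun j => Matrix.of (fun u u' => if j = i ∧ u = c ∧ u' = c' then 1 else 0)) v hv
      simp only [Submodule.mem_comap]
      convert this using 1
      ext ⟨a, u⟩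
      simp only [em, LinearMap.coe_mk, AddHom.coe_mk, mulVecLin_apply, mulVec, dotProduct, LinearMap.funLeft_apply, blow_apply, Fintype.sum_prod_type]
      split_ifs with h
      · subst h
        refine Finset.sum_congr rfl fun b _ => ?_
        simp [ite_and]
      · simp [h]
    exact this hw
  have l2 : S2 ≤ P.map M := by
    intro v hv
    rw [hS2] at hv
    have : v = ∑ c : κ, (fun p : α × κ => if p.2 = c then v (p.1, c) else 0) := by
      ext p; simp
    rw [this]
    exact Submodule.sum_mem _ fun c _ => put c _ (hv c)
  have f1 := Submodule.finrank_mono l1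
  have f2 := Submodule.finrank_mono l2
  rw [finrank_slices κ U S1 hS1] at f1
  rw [finrank_slices κ xU S2 hS2] at f2
  have f3 := Nat.mul_le_mul_left (Fintype.card κ) (hx U)
  change _ ≤ Fintype.card κ * Module.finrank k xU at f3
  omega

end W
end SI

open MvPolynomial Matrix
namespace SI
section W
variable {k ι α : Type} [Field k] [Fintype ι] [Fintype α]

lemma ns_le (x : ι → Matrix α α k) (hx : NotShrunk x) (U W : Submodule k (α → k))
    (h : ∀ i, ∀ u ∈ U, x i *ᵥ u ∈ W) : Module.finrank k U ≤ Module.finrank k W := by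
  refine (hx U).trans (Submodule.finrank_mono (iSup_le fun i => ?_))
  rintro _ ⟨u, hu, rfl⟩
  exact h i u hu

lemma exists_rank_two [Infinite k] (x : ι → Matrix α α k) (hx : NotShrunk x) (hn : 2 ≤ Fintype.card α) :
    ∃ N ∈ Submodule.span k (Set.range x), ∃ a b, N *ᵥ a ≠ 0 ∧ ∀ c : k, N *ᵥ b ≠ c • (N *ᵥ a) := by
  classical
  set X := Submodule.span k (Set.range x)
  have hxX : ∀ i, x i ∈ X := fun i => Submodule.subset_span ⟨i, rfl⟩
  by_contra hcon
  have h1 : ∀ N ∈ X, ∀ a b, N *ᵥ a ≠ 0 → ∃ c : k, N *ᵥ b = c • (N *ᵥ a) := by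
    intro N hN a b h; by_contra h2; push Not at h2
    exact hcon ⟨N, hN, a, b, h, h2⟩
  have htop : Module.finrank k (⊤ : Submodule k (α → k)) = Fintype.card α := by simp
  by_cases hM : ∃ M ∈ X, ∃ u, M *ᵥ u ≠ 0
  swap
  · push Not at hM
    have := ns_le x hx ⊤ ⊥ (fun i u _ => by simp [hM _ (hxX i) u])
    rw [htop] at this; simp at this; omega
  obtain ⟨M, hMX, u, hu⟩ := hM
  have h2 : ∀ N ∈ X, ∀ v, M *ᵥ v = 0 → ∃ c : k, N *ᵥ v = c • (M *ᵥ u) := by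
    intro N hN v hv
    by_contra hc; push Not at hc
    have hNv : N *ᵥ v ≠ 0 := by intro h; exact hc 0 (by simp [h])
    have key : ∀ t : k, t ≠ 0 → ∃ c : k, M *ᵥ u + t • (N *ᵥ u) = c • (N *ᵥ v) := by
      intro t ht
      obtain ⟨c, hc⟩ := h1 (M + t • N) (X.add_mem hMX (X.smul_mem _ hN)) v u (by
        simp [add_mulVec, smul_mulVec, hv, ht, hNv])
      simp [add_mulVec, smul_mulVec, hv] at hc
      exact ⟨c * t, by rw [hc, smul_smul]⟩
    obtain ⟨t, ht⟩ := Infinite.exists_notMem_finset ({0, 1} : Finset k)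
    simp at ht
    obtain ⟨c1, e1⟩ := key 1 one_ne_zero
    obtain ⟨c2, e2⟩ := key t ht.1
    have e3 : (t - 1) • (M *ᵥ u) = (t * c1 - c2) • (N *ᵥ v) := by
      have : (t - 1) • (M *ᵥ u) = t • (M *ᵥ u + (1:k) • (N *ᵥ u)) - (M *ᵥ u + t • (N *ᵥ u)) := by
        module
      rw [this, e1, e2]; module
    have ht1 : t - 1 ≠ 0 := sub_ne_zero.2 ht.2
    have h5 : t * c1 - c2 ≠ 0 := by
      intro h0; rw [h0, zero_smul, smul_eq_zero] at e3
      rcases e3 with h | h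
      · exact ht1 h
      · exact hu h
    apply hc ((t * c1 - c2)⁻¹ * (t - 1))
    rw [mul_smul, e3, smul_smul, inv_mul_cancel₀ h5, one_smul]
  set l := Submodule.span k {M *ᵥ u} with hl
  have hl1 : Module.finrank k l = 1 := finrank_span_singleton hu
  by_cases hk : ∀ N ∈ X, ∀ v, M *ᵥ v = 0 → N *ᵥ v = 0
  · have hk0 := ns_le x hx (LinearMap.ker M.mulVecLin) ⊥ (fun i v hv => by simpa using hk _ (hxX i) v hv)
    have e := LinearMap.finrank_range_add_finrank_ker M.mulVecLin
    have e2 : LinearMap.range M.mulVecLin ≤ l := by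
      rintro _ ⟨b, rfl⟩
      obtain ⟨c, hc⟩ := h1 M hMX u b hu
      rw [mulVecLin_apply, hc]
      exact Submodule.smul_mem _ _ (Submodule.mem_span_singleton_self _)
    have := Submodule.finrank_mono e2
    rw [finrank_bot] at hk0
    rw [Module.finrank_fintype_fun_eq_card] at e
    omega
  · push Not at hk
    obtain ⟨N0, hN0, v0, hv0, hne⟩ := hk
    obtain ⟨c0, hc0⟩ := h2 N0 hN0 v0 hv0
    have hc00 : c0 ≠ 0 := by rintro rfl; simp at hc0; exact hne hc0
    have inl : ∀ N ∈ X, ∀ c : k, c ≠ 0 → N *ᵥ v0 = c • (M *ᵥ u) → ∀ w, N *ᵥ w ∈ l := by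
      intro N hN c hc h w
      obtain ⟨c', h'⟩ := h1 N hN v0 w (by rw [h]; exact smul_ne_zero hc hu)
      rw [h', h]
      exact Submodule.smul_mem _ _ (Submodule.smul_mem _ _ (Submodule.mem_span_singleton_self _))
    have all : ∀ N ∈ X, ∀ w, N *ᵥ w ∈ l := by
      intro N hN w
      obtain ⟨c, hc⟩ := h2 N hN v0 hv0
      by_cases h0 : c = 0
      · have h3 := inl (N0 + N) (X.add_mem hN0 hN) c0 hc00 (by rw [add_mulVec, hc0, hc, h0]; simp) w
        rw [add_mulVec] at h3
        exact (Submodule.add_mem_iff_right _ (inl N0 hN0 c0 hc00 hc0 w)).1 h3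
      · exact inl N hN c h0 hc w
    have := ns_le x hx ⊤ l (fun i u _ => all _ (hxX i) u)
    rw [htop, hl1] at this; omega

lemma exists_grow [Infinite k] (x : ι → Matrix α α k) (hx : NotShrunk x) (hn : 2 ≤ Fintype.card α) (j : ℕ) :
    ∃ a : Fin (j+1) → Matrix α α k, (∀ l, a l ∈ Submodule.span k (Set.range x)) ∧
      min (Fintype.card α) (j+2) ≤ Module.finrank k (⨆ l, LinearMap.range (a l).mulVecLin : Submodule k (α → k)) := by
  induction j with
  | zero =>
    obtain ⟨N, hN, a, b, h1, h2⟩ := exists_rank_two x hx hn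
    refine ⟨fun _ => N, fun _ => hN, (min_le_right _ _).trans ?_⟩
    rw [iSup_const]
    have hli : LinearIndependent k ![N *ᵥ a, N *ᵥ b] := by
      rw [LinearIndependent.pair_iff' h1]
      exact fun c h => h2 c h.symm
    have := finrank_span_eq_card hli
    simp at this
    rw [zero_add, ← this]
    apply Submodule.finrank_mono
    rw [Submodule.span_le]
    rintro _ ⟨i, rfl⟩
    fin_cases i
    · exact ⟨a, rfl⟩
    · exact ⟨b, rfl⟩
  | succ j ih =>
    obtain ⟨a, ha, hr⟩ := ih
    set Y := (⨆ l, LinearMap.range (a l).mulVecLin : Submodule k (α → k)) with hY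
    by_cases hlt : Module.finrank k Y < Fintype.card α
    · obtain ⟨i, w, hw⟩ : ∃ i w, x i *ᵥ w ∉ Y := by
        by_contra h; push Not at h
        have := ns_le x hx ⊤ Y (fun i u _ => h i u)
        simp at this; omega
      refine ⟨Fin.cons (x i) a, ?_, ?_⟩
      · intro l; induction l using Fin.cases with
        | zero => exact Submodule.subset_span ⟨i, rfl⟩
        | succ l => simpa using ha l
      · set Y' := (⨆ l, LinearMap.range ((Fin.cons (x i) a : Fin (j+2) → Matrix α α k) l).mulVecLin : Submodule k (α → k)) with hY'
        have h1 : Y ≤ Y' := iSup_le fun l => by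
          have := le_iSup (fun l => LinearMap.range ((Fin.cons (x i) a : Fin (j+2) → Matrix α α k) l).mulVecLin) l.succ
          simpa using this
        have h2 : x i *ᵥ w ∈ Y' := by
          have := le_iSup (fun l => LinearMap.range ((Fin.cons (x i) a : Fin (j+2) → Matrix α α k) l).mulVecLin) 0
          exact this ⟨w, by simp⟩
        have h3 : Y < Y' := lt_of_le_of_ne h1 (fun h => hw (h ▸ h2))
        have := Submodule.finrank_lt_finrank_of_lt h3
        omega
    · refine ⟨Fin.cons 0 a, ?_, ?_⟩
      · intro l; induction l using Fin.cases with
        | zero => simp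
        | succ l => simpa using ha l
      · set Y' := (⨆ l, LinearMap.range ((Fin.cons 0 a : Fin (j+2) → Matrix α α k) l).mulVecLin : Submodule k (α → k)) with hY'
        have h1 : Y ≤ Y' := iSup_le fun l => by
          have := le_iSup (fun l => LinearMap.range ((Fin.cons 0 a : Fin (j+2) → Matrix α α k) l).mulVecLin) l.succ
          simpa using this
        have := Submodule.finrank_mono h1
        omega

lemma exists_span_rank [Infinite k] (x : ι → Matrix α α k) (hx : NotShrunk x) (hn : 2 ≤ Fintype.card α) (d : ℕ)
    (hd : Fintype.card α ≤ d + 1) : ∃ A : ι → Matrix Unit (Fin d) k, Fintype.card α ≤ (blow x A).rank := by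
  obtain ⟨j, rfl⟩ : ∃ j, d = j + 1 := ⟨d - 1, by omega⟩
  obtain ⟨a, ha, hr⟩ := exists_grow x hx hn j
  rw [min_eq_left (by omega)] at hr
  have : ∀ l, ∃ c : ι → k, ∑ i, c i • x i = a l := fun l => (Submodule.mem_span_range_iff_exists_fun k).1 (ha l)
  choose c hc using this
  refine ⟨fun i => Matrix.of fun _ l => c l i, hr.trans ?_⟩
  set B := blow x (fun i => Matrix.of fun (_ : Unit) l => c l i)
  let π : (α × Unit → k) →ₗ[k] (α → k) := LinearMap.funLeft k k (fun a => (a, ()))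
  have h1 : (⨆ l, LinearMap.range (a l).mulVecLin : Submodule k (α → k)) ≤ (LinearMap.range B.mulVecLin).map π := by
    refine iSup_le fun l => ?_
    rintro _ ⟨v, rfl⟩
    refine ⟨_, ⟨fun p => if p.2 = l then v p.1 else 0, rfl⟩, ?_⟩
    ext b
    simp only [π, B, LinearMap.funLeft_apply, mulVecLin_apply, mulVec, dotProduct, blow_apply, Fintype.sum_prod_type, of_apply, ← hc]
    simp [Matrix.sum_apply, mul_comm]
  exact (Submodule.finrank_mono h1).trans (Submodule.finrank_map_le _ _)

lemma submod {V : Type} [AddCommGroup V] [Module k V] [FiniteDimensional k V] {d : ℕ}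
    (hd : 0 < d) (W : Fin (d+1) → Submodule k V) :
    ∃ i, i ≠ 0 ∧ d * (Module.finrank k (⨆ j, W j : Submodule k V) - Module.finrank k (⨆ j : {j // j ≠ i}, W j.1 : Submodule k V))
      + Module.finrank k (W 0) ≤ Module.finrank k (⨆ j, W j : Submodule k V) := by
  classical
  let X : Fin (d+1) → Submodule k V := fun i => ⨆ j : {j // j ≠ i}, W j.1
  let tot := Module.finrank k (⨆ j, W j : Submodule k V)
  let loss : Fin (d+1) → ℕ := fun i => tot - Module.finrank k (X i)
  have key : ∀ S : Finset (Fin (d+1)), 0 ∉ S → Module.finrank k (W 0) + ∑ i ∈ S, loss i ≤ Module.finrank k (W 0 ⊔ S.sup W : Submodule k V) := by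
    intro S
    induction S using Finset.induction_on with
    | empty => intro _; rw [Finset.sup_empty, sup_bot_eq]; simp
    | insert i S hi ih =>
      intro h0
      rw [Finset.mem_insert, not_or] at h0
      have ih := ih h0.2
      rw [Finset.sum_insert hi, Finset.sup_insert]
      set Y := W 0 ⊔ S.sup W with hY
      have e1 : W 0 ⊔ (W i ⊔ S.sup W) = Y ⊔ W i := by rw [hY, sup_assoc, sup_comm (W i)]
      rw [e1]
      have f1 := Submodule.finrank_sup_add_finrank_inf_eq Y (W i)
      have f2 := Submodule.finrank_sup_add_finrank_inf_eq (X i) (W i)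
      have hYX : Y ≤ X i := by
        refine sup_le ?_ (Finset.sup_le fun j hj => ?_)
        · exact le_iSup (fun j : {j // j ≠ i} => W j.1) ⟨0, h0.1⟩
        · exact le_iSup (fun j : {j // j ≠ i} => W j.1) ⟨j, by rintro rfl; exact hi hj⟩
      have f3 := Submodule.finrank_mono (inf_le_inf_right (W i) hYX)
      have f4 : X i ⊔ W i = ⨆ j, W j := by
        apply le_antisymm
        · exact sup_le (iSup_le fun j => le_iSup W j) (le_iSup W i)
        · refine iSup_le fun j => ?_
          by_cases h : j = i
          · subst h; exact le_sup_right
          · exact le_sup_of_le_left (le_iSup (fun j : {j // j ≠ i} => W j.1) ⟨j, h⟩)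
      rw [f4] at f2
      have f5 := Submodule.finrank_mono (f4 ▸ le_sup_left : X i ≤ ⨆ j, W j)
      have : loss i = Module.finrank k (⨆ j, W j : Submodule k V) - Module.finrank k (X i) := rfl
      omega
  have k1 := key (Finset.univ.erase 0) (by simp)
  have k2 : Module.finrank k (W 0 ⊔ (Finset.univ.erase 0).sup W : Submodule k V) ≤ tot :=
    Submodule.finrank_mono (sup_le (le_iSup W 0) (Finset.sup_le fun j _ => le_iSup W j))
  by_contra hcon
  push Not at hcon
  have k3 : ∑ i ∈ (Finset.univ : Finset (Fin (d+1))).erase 0, (tot - Module.finrank k (W 0) + 1) ≤ ∑ i ∈ (Finset.univ : Finset (Fin (d+1))).erase 0, d * loss i := by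
    refine Finset.sum_le_sum fun i hi => ?_
    have := hcon i (Finset.ne_of_mem_erase hi)
    change tot < d * loss i + _ at this
    omega
  rw [← Finset.mul_sum] at k3
  simp only [Finset.sum_const, smul_eq_mul, Finset.card_erase_of_mem (Finset.mem_univ _), Finset.card_univ, Fintype.card_fin, Nat.add_sub_cancel] at k3
  have := Nat.le_of_mul_le_mul_left k3 hd
  omega


lemma exists_t [Infinite k] {β γ : Type} [Fintype β] [Fintype γ] [DecidableEq β] [DecidableEq γ] (A B : Matrix β β k) (C D : Matrix γ γ k)
    (hB : B.det ≠ 0) (hC : C.det ≠ 0) : ∃ t : k, (B + t • A).det ≠ 0 ∧ (D + t • C).det ≠ 0 := by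
  let p : Polynomial k := det ((Polynomial.X : Polynomial k) • A.map Polynomial.C + B.map Polynomial.C)
  let q : Polynomial k := det ((Polynomial.X : Polynomial k) • C.map Polynomial.C + D.map Polynomial.C)
  have hp : p ≠ 0 := by
    intro h; apply hB; rw [← Polynomial.coeff_det_X_add_C_zero A B]; change p.coeff 0 = 0; rw [h]; simp
  have hq : q ≠ 0 := by
    intro h; apply hC; rw [← Polynomial.coeff_det_X_add_C_card C D]; change q.coeff _ = 0; rw [h]; simp
  obtain ⟨t, ht⟩ : ∃ t, Polynomial.eval t (p * q) ≠ 0 := by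
    by_contra h; push Not at h
    exact mul_ne_zero hp hq (Polynomial.funext (by simpa using h))
  rw [Polynomial.eval_mul] at ht
  have ev : ∀ {β : Type} [Fintype β] [DecidableEq β] (A B : Matrix β β k), Polynomial.eval t (det ((Polynomial.X : Polynomial k) • A.map Polynomial.C + B.map Polynomial.C)) = (B + t • A).det := by
    intro β _ _ A B
    rw [← Polynomial.coe_evalRingHom, RingHom.map_det]
    congr 1
    ext i j; simp; ring
  refine ⟨t, ?_, ?_⟩
  · rw [← ev]; exact left_ne_zero_of_mul ht
  · rw [← ev]; exact right_ne_zero_of_mul ht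

lemma det_ne_zero_of_rank {β : Type} [Fintype β] [DecidableEq β] (M : Matrix β β k) (h : Fintype.card β ≤ M.rank) : M.det ≠ 0 := by
  have h1 : LinearIndependent k M.row := by
    rw [linearIndependent_iff_card_eq_finrank_span, Set.finrank, ← rank_eq_finrank_span_row]
    exact le_antisymm h (rank_le_card_width _)
  rw [linearIndependent_rows_iff_isUnit, isUnit_iff_isUnit_det] at h1
  exact h1.ne_zero

lemma descent [Infinite k] (x : ι → Matrix α α k) (hx : NotShrunk x) (hn : 2 ≤ Fintype.card α) (d : ℕ)
    (hd : Fintype.card α ≤ d + 1) (T : ι → Matrix (Fin (d+1)) (Fin (d+1)) k) (hT : Fintype.card α * (d+1) ≤ (blow x T).rank) :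
    ∃ T : ι → Matrix (Fin d) (Fin d) k, Fintype.card α * d ≤ (blow x T).rank := by
  classical
  set n := Fintype.card α with hnn
  have hd0 : 0 < d := by omega
  obtain ⟨A, hA⟩ := exists_span_rank x hx hn d hd
  obtain ⟨f, g, hfg⟩ := exists_minor _ _ hA
  let Tb : ι → Matrix (Fin (d+1)) (Fin (d+1)) k := fun i => Matrix.of fun u v => if u = 0 then Fin.snoc (α := fun _ => k) (A i ()) 0 v else 0
  have hTd : (blow x T).det ≠ 0 := det_ne_zero_of_rank _ (by simpa using hT)
  let r0 : ∀ S : ι → Matrix (Fin (d+1)) (Fin (d+1)) k, ι → Matrix Unit (Fin d) k := fun S i => (S i).submatrix (fun _ => 0) Fin.castSucc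
  obtain ⟨t, ht1, ht2⟩ := exists_t (blow x Tb) (blow x T) ((blow x A).submatrix f g) ((blow x (r0 T)).submatrix f g) hTd hfg
  let S : ι → Matrix (Fin (d+1)) (Fin (d+1)) k := fun i => T i + t • Tb i
  have hS1 : blow x T + t • blow x Tb = blow x S := by
    ext p q; simp [blow_apply, S, mul_add, Finset.sum_add_distrib, Finset.mul_sum, mul_left_comm]
  have hS2 : (blow x (r0 T)).submatrix f g + t • (blow x A).submatrix f g = (blow x (r0 S)).submatrix f g := by
    ext p q; simp [blow_apply, S, r0, Tb, mul_add, Finset.sum_add_distrib, Finset.mul_sum, mul_left_comm]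
  rw [hS1] at ht1
  rw [hS2] at ht2
  have hr0 : n ≤ (blow x (r0 S)).rank := le_rank_of_minor _ _ f g ht2
  let Z : Matrix (α × Fin (d+1)) (α × Fin d) k := (blow x S).submatrix id (Prod.map id Fin.castSucc)
  have hZ : Z.rank = n * d := by
    have h1 : LinearIndependent k (blow x S).col := by
      rw [linearIndependent_cols_iff_isUnit, isUnit_iff_isUnit_det]; exact ht1.isUnit
    have h2 := h1.comp (Prod.map id Fin.castSucc : α × Fin d → α × Fin (d+1)) (Function.injective_id.prodMap (Fin.castSucc_injective d))
    have h3 : Zᵀ.rank = Fintype.card (α × Fin d) := LinearIndependent.rank_matrix (M := Zᵀ) h2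
    rw [rank_transpose] at h3
    rw [h3]; simp [hnn]
  let W : Fin (d+1) → Submodule k (α × Fin d → k) := fun i => Submodule.span k (Set.range fun a => Z.row (a, i))
  obtain ⟨i, hi0, hi⟩ := submod hd0 W
  have w1 : Module.finrank k (⨆ j, W j : Submodule k (α × Fin d → k)) = n * d := by
    have hs : (⋃ j, Set.range fun a => Z.row (a, j)) = Set.range Z.row := by
      ext v
      simp only [Set.mem_iUnion, Set.mem_range, Prod.exists]
      tauto
    rw [← hZ, rank_eq_finrank_span_row, ← hs, Submodule.span_iUnion]
  have w2 : Module.finrank k (⨆ j : {j // j ≠ i}, W j.1 : Submodule k (α × Fin d → k)) = (Z.submatrix (Prod.map id (Fin.succAbove i)) id).rank := by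
    have hs : (⋃ j : {j // j ≠ i}, Set.range fun a => Z.row (a, j.1)) = Set.range (Z.submatrix (Prod.map id (Fin.succAbove i)) id).row := by
      ext v
      simp only [Set.mem_iUnion, Set.mem_range, Subtype.exists, Prod.exists]
      constructor
      · rintro ⟨j, hj, a, rfl⟩
        obtain ⟨j', rfl⟩ := Fin.exists_succAbove_eq hj
        exact ⟨a, j', rfl⟩
      · rintro ⟨a, j', rfl⟩
        exact ⟨i.succAbove j', Fin.succAbove_ne i j', a, rfl⟩
    rw [rank_eq_finrank_span_row, ← hs, Submodule.span_iUnion]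
  have w3 : n ≤ Module.finrank k (W 0) := by
    refine hr0.trans ?_
    rw [rank_eq_finrank_span_row]
    apply Submodule.finrank_mono
    apply Submodule.span_mono
    rintro _ ⟨⟨a, _⟩, rfl⟩
    exact ⟨a, rfl⟩
  rw [w1, w2] at hi
  have hb : Z.submatrix (Prod.map id (Fin.succAbove i)) id = blow x (fun j => (S j).submatrix (Fin.succAbove i) Fin.castSucc) := by
    rw [blow_reindex]; rfl
  rw [hb] at hi
  have : Nonempty (Fin d) := ⟨⟨0, hd0⟩⟩
  obtain ⟨n', hn'⟩ : ∃ n', n = n' + 1 := ⟨n - 1, by omega⟩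
  have hreg : n' * Fintype.card (Fin d) < (blow x (fun j => (S j).submatrix (Fin.succAbove i) Fin.castSucc)).rank := by
    set ρ := (blow x (fun j => (S j).submatrix (Fin.succAbove i) Fin.castSucc)).rank
    rw [Fintype.card_fin]
    by_contra hcon
    push Not at hcon
    rw [hn'] at hi w3
    have h1 : d ≤ (n'+1) * d - ρ := by
      have : (n' + 1) * d = n' * d + d := by ring
      omega
    have h2 := Nat.mul_le_mul_left d h1
    have h3 : d * d + (n' + 1) ≤ (n'+1) * d := by omega
    obtain ⟨e, rfl⟩ : ∃ e, d = n' + e := ⟨d - n', by omega⟩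
    nlinarith [Nat.zero_le (n' * e), Nat.zero_le (e*e)]
  obtain ⟨T', hT'⟩ := regularity' x n' _ hreg
  exact ⟨T', by simpa [hn'] using hT'⟩

theorem ncrank [Infinite k] (x : ι → Matrix α α k) (hx : NotShrunk x) (hn : 2 ≤ Fintype.card α) [DecidableEq α] :
    ∃ T : ι → Matrix (Fin (Fintype.card α - 1)) (Fin (Fintype.card α - 1)) k, (blow x T).det ≠ 0 := by
  set n := Fintype.card α with hnn
  obtain ⟨c, T, hT⟩ := exists_blow_nonsing x hx
  have mult : ∀ q : ℕ, ∃ (κ : Type) (_ : Fintype κ) (S : ι → Matrix κ κ k), Fintype.card κ = q * (c+1) ∧ n * Fintype.card κ ≤ (blow x S).rank := by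
    intro q
    induction q with
    | zero => exact ⟨Empty, inferInstance, 0, by simp, by simp⟩
    | succ q ih =>
      obtain ⟨κ, _, S, h1, h2⟩ := ih
      refine ⟨κ ⊕ Fin (c+1), inferInstance, fun i => fromBlocks (S i) 0 0 (T i), by simp [h1]; ring, ?_⟩
      have := (blk x S (fun _ => 0) T).1
      rw [Fintype.card_sum, mul_add, Fintype.card_fin]
      exact (add_le_add h2 hT).trans this
  have desc : ∀ e, n - 1 ≤ e → (∃ S : ι → Matrix (Fin e) (Fin e) k, n * e ≤ (blow x S).rank) → ∃ S : ι → Matrix (Fin (n-1)) (Fin (n-1)) k, n * (n-1) ≤ (blow x S).rank := by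
    intro e he
    induction e, he using Nat.le_induction with
    | base => exact id
    | succ e he ih =>
      rintro ⟨S, hS⟩
      exact ih (descent x hx hn e (by omega) S hS)
  obtain ⟨κ, _, S, h1, h2⟩ := mult n
  let e := (Fintype.equivFin κ).symm
  rw [← rank_blow_equiv x S e] at h2
  obtain ⟨T, hT⟩ := desc (Fintype.card κ) (by rw [h1]; nlinarith [Nat.sub_le n 1, Nat.zero_le (n*c)]) ⟨_, h2⟩
  exact ⟨T, det_ne_zero_of_rank _ (by simpa using hT)⟩

end W
end SI

open MvPolynomial Matrix
namespace SI

/-- evaluation of a polynomial at a tuple of matrices over an algebra -/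
noncomputable def ev {K L : Type} [Field K] [CommRing L] [Algebra K L] {n m : ℕ}
    (x : Fin m → Matrix (Fin n) (Fin n) L) :
    MvPolynomial (Fin m × Fin n × Fin n) K →ₐ[K] L :=
  aeval (fun p => x p.1 p.2.1 p.2.2)

/-- generic matrices -/
noncomputable def gX (K : Type) [Field K] (n m : ℕ) :
    Fin m → Matrix (Fin n) (Fin n) (MvPolynomial (Fin m × Fin n × Fin n) K) :=
  fun l => Matrix.of fun i j => X (l, i, j)

section
variable {K : Type} [Field K] {n m : ℕ}

lemma ev_gX (f : MvPolynomial (Fin m × Fin n × Fin n) K) : ev (gX K n m) f = f := by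
  have : (fun p : Fin m × Fin n × Fin n => gX K n m p.1 p.2.1 p.2.2) = X := by
    funext p; simp [gX]
  simp [ev, this]

lemma ev_comp {L L' : Type} [CommRing L] [Algebra K L] [CommRing L'] [Algebra K L']
    (φ : L →ₐ[K] L') (x : Fin m → Matrix (Fin n) (Fin n) L)
    (f : MvPolynomial (Fin m × Fin n × Fin n) K) :
    φ (ev x f) = ev (fun l => (x l).map φ) f := by
  simp only [ev]
  have := comp_aeval (R := K) (fun p : Fin m × Fin n × Fin n => x p.1 p.2.1 p.2.2) φ
  have h2 := DFunLike.congr_fun this f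
  simpa using h2

lemma ev_gX_map {L : Type} [CommRing L] [Algebra K L] (x : Fin m → Matrix (Fin n) (Fin n) L)
    (l : Fin m) : (gX K n m l).map (ev (K := K) x) = x l := by
  ext i j; simp [gX, ev]

lemma mem_iff (f : MvPolynomial (Fin m × Fin n × Fin n) K) :
    f ∈ matrixSemiInvariants K n m ↔ ∀ A B : Matrix (Fin n) (Fin n) K, A.det = 1 → B.det = 1 →
      ∀ x : Fin m → Matrix (Fin n) (Fin n) K, ev (fun l => A * x l * B) f = ev x f := by
  unfold matrixSemiInvariants
  simp only [Algebra.mem_iInf, AlgHom.mem_equalizer]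
  constructor
  · intro h A B hA hB x
    obtain ⟨b, rfl⟩ : ∃ b : Matrix.SpecialLinearGroup (Fin n) K, b.val = B := ⟨⟨B, hB⟩, rfl⟩
    have := h ⟨A, hA⟩ b⁻¹ x
    rw [inv_inv] at this
    exact this
  · intro h A B x
    have := h A.val (B⁻¹).val A.2 (B⁻¹).2 x
    exact this

lemma mem_iff_gX [Infinite K] (f : MvPolynomial (Fin m × Fin n × Fin n) K) :
    f ∈ matrixSemiInvariants K n m ↔ ∀ A B : Matrix (Fin n) (Fin n) K, A.det = 1 → B.det = 1 →
      ev (fun l => A.map C * gX K n m l * B.map C) f = f := by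
  rw [mem_iff]
  have key : ∀ (A B : Matrix (Fin n) (Fin n) K) (x : Fin m → Matrix (Fin n) (Fin n) K),
      ev (K := K) x (ev (fun l => A.map C * gX K n m l * B.map C) f) =
        ev (fun l => A * x l * B) f := by
    intro A B x
    rw [ev_comp]
    congr 2
    funext l
    have hc : ∀ A : Matrix (Fin n) (Fin n) K,
        (A.map (C : K →+* MvPolynomial (Fin m × Fin n × Fin n) K)).map (ev (K := K) x) = A := by
      intro A; ext i j; simp [ev]
    rw [Matrix.map_mul, Matrix.map_mul, hc, hc, ev_gX_map]
  constructor
  · intro h A B hA hB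
    apply MvPolynomial.funext
    intro x
    have h1 := key A B (fun l => Matrix.of fun i j => x (l, i, j))

    have h2 : ∀ g : MvPolynomial (Fin m × Fin n × Fin n) K,
        ev (fun l => Matrix.of fun i j => x (l, i, j)) g = eval x g := fun g => rfl
    rw [← h2, ← h2, h1, h A B hA hB]
  · intro h A B hA hB x
    rw [← key, h A B hA hB]

lemma isHom_ev {L : Type} [Field L] [Algebra K L] {τ : Type}
    (x : Fin m → Matrix (Fin n) (Fin n) (MvPolynomial τ L))
    (hx : ∀ l i j, (x l i j).IsHomogeneous 1) (f : MvPolynomial (Fin m × Fin n × Fin n) K)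
    {D : ℕ} (hf : f.IsHomogeneous D) : (ev x f).IsHomogeneous D := by
  have := hf.eval₂ (f := algebraMap K (MvPolynomial τ L))
    (g := fun p => x p.1 p.2.1 p.2.2) (n := 1)
    (by intro r; rw [IsScalarTower.algebraMap_apply K L]; exact isHomogeneous_C _ _)
    (fun p => hx _ _ _)
  simpa [ev, aeval_def] using this

lemma ev_homComp {L : Type} [Field L] [Algebra K L] {τ : Type}
    (x : Fin m → Matrix (Fin n) (Fin n) (MvPolynomial τ L))
    (hx : ∀ l i j, (x l i j).IsHomogeneous 1) (f : MvPolynomial (Fin m × Fin n × Fin n) K)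
    (D : ℕ) : ev x (homogeneousComponent D f) = homogeneousComponent D (ev x f) := by
  conv_rhs => rw [← sum_homogeneousComponent f]
  rw [map_sum, map_sum]
  have : ∀ i, homogeneousComponent D (ev x (homogeneousComponent i f)) =
      if D = i then ev x (homogeneousComponent i f) else 0 := by
    intro i
    have := homogeneousComponent_of_mem (m := D) (n := i)
      (isHom_ev x hx _ (homogeneousComponent_isHomogeneous i f))
    rw [this]
  simp only [this]
  rw [Finset.sum_ite_eq]
  split_ifs with h
  · rfl
  · rw [homogeneousComponent_eq_zero, map_zero]
    simpa [Nat.lt_succ_iff] using h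

lemma lin_isHom (A B : Matrix (Fin n) (Fin n) K) (l : Fin m) (i j : Fin n) :
    ((A.map C * gX K n m l * B.map C :
      Matrix (Fin n) (Fin n) (MvPolynomial (Fin m × Fin n × Fin n) K)) i j).IsHomogeneous 1 := by
  rw [Matrix.mul_apply]
  refine IsHomogeneous.sum _ _ _ fun a _ => ?_
  rw [Matrix.mul_apply]
  refine IsHomogeneous.mul (m := 1) (n := 0) (IsHomogeneous.sum _ _ _ fun b _ => ?_) (isHomogeneous_C _ _)
  exact IsHomogeneous.mul (m := 0) (n := 1) (isHomogeneous_C _ _) (isHomogeneous_X _ _)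

lemma homComp_mem [Infinite K] {f : MvPolynomial (Fin m × Fin n × Fin n) K}
    (hf : f ∈ matrixSemiInvariants K n m) (D : ℕ) :
    homogeneousComponent D f ∈ matrixSemiInvariants K n m := by
  rw [mem_iff_gX] at hf ⊢
  intro A B hA hB
  rw [ev_homComp _ (lin_isHom A B), hf A B hA hB]

lemma ev_smul {L : Type} [CommRing L] [Algebra K L] {f : MvPolynomial (Fin m × Fin n × Fin n) K}
    {D : ℕ} (hf : f.IsHomogeneous D) (c : L) (x : Fin m → Matrix (Fin n) (Fin n) L) :
    ev (fun l => c • x l) f = c ^ D * ev x f := by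
  unfold ev
  have h2 : ∀ (y : Fin m × Fin n × Fin n → L), aeval y f = ∑ d ∈ f.support,
      algebraMap K L (f.coeff d) * d.prod fun i k => y i ^ k := fun y => by
    rw [aeval_def, eval₂_eq]; rfl
  rw [h2, h2, Finset.mul_sum]
  apply Finset.sum_congr rfl
  intro d hd
  have hdeg : d.degree = D := by
    have := hf (mem_support_iff.mp hd)
    rw [Finsupp.degree_eq_weight_one]; exact this
  simp only [Matrix.smul_apply, smul_eq_mul, mul_pow]
  rw [Finsupp.prod_mul]
  have : (d.prod fun _ k => c ^ k) = c ^ D := by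
    rw [Finsupp.prod, Finset.prod_pow_eq_pow_sum, ← hdeg]; rfl
  rw [this]; ring

lemma law_K [IsAlgClosed K] {f : MvPolynomial (Fin m × Fin n × Fin n) K}
    (hf : f ∈ matrixSemiInvariants K n m) {D : ℕ} (hD : f.IsHomogeneous D)
    (A B : Matrix (Fin n) (Fin n) K) (a b : K) (ha : a ^ n = A.det) (hb : b ^ n = B.det)
    (ha0 : a ≠ 0) (hb0 : b ≠ 0) (x : Fin m → Matrix (Fin n) (Fin n) K) :
    ev (fun l => A * x l * B) f = (a * b) ^ D * ev x f := by
  rw [mem_iff] at hf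
  have h1 := hf (a⁻¹ • A) (b⁻¹ • B) (by
    rw [Matrix.det_smul, Fintype.card_fin, ← ha, ← mul_pow, inv_mul_cancel₀ ha0, one_pow]) (by
    rw [Matrix.det_smul, Fintype.card_fin, ← hb, ← mul_pow, inv_mul_cancel₀ hb0, one_pow]) x
  rw [← h1, ← ev_smul hD]
  congr 2
  funext l
  simp only [Matrix.smul_mul, Matrix.mul_smul, smul_smul]
  rw [show a * b * (b⁻¹ * a⁻¹) = 1 by field_simp, one_smul]

lemma dvd_or_zero [IsAlgClosed K] {f : MvPolynomial (Fin m × Fin n × Fin n) K}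
    (hf : f ∈ matrixSemiInvariants K n m) {D : ℕ} (hD : f.IsHomogeneous D) (hn : 0 < n) :
    n ∣ D ∨ f = 0 := by
  rcases Classical.em (n ∣ D) with h | h
  · exact Or.inl h
  right
  have : Infinite K := inferInstance
  apply MvPolynomial.funext
  intro y
  set x : Fin m → Matrix (Fin n) (Fin n) K := fun l => Matrix.of fun i j => y (l, i, j) with hx
  have hy : eval y f = ev x f := rfl
  rw [hy, map_zero]
  let i0 : Fin n := ⟨0, hn⟩
  let Q : Polynomial K := ev (fun l => Matrix.diagonal
    (Function.update (fun _ => (1 : Polynomial K)) i0 Polynomial.X) * (x l).map Polynomial.C) f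
  have hQ : ∀ s : K, Q.eval s = ev (fun l => Matrix.diagonal
    (Function.update (fun _ => (1 : K)) i0 s) * x l) f := by
    intro s
    have := ev_comp (Polynomial.aeval (R := K) s) (fun l => Matrix.diagonal
      (Function.update (fun _ => (1 : Polynomial K)) i0 Polynomial.X) * (x l).map Polynomial.C) f
    rw [Polynomial.aeval_def, Polynomial.eval₂_eq_eval_map] at this
    simp only [Algebra.algebraMap_self, Polynomial.map_id] at this
    rw [this]
    congr 2
    funext l
    ext i j
    by_cases hi : i = i0
    · simp [Matrix.diagonal_mul, hi, Function.update]; ring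
    · simp [Matrix.diagonal_mul, hi, Function.update]
  have hE : Polynomial.expand K n Q = Polynomial.C (ev x f) * Polynomial.X ^ D := by
    have hz : Polynomial.X * (Polynomial.expand K n Q) =
        Polynomial.X * (Polynomial.C (ev x f) * Polynomial.X ^ D) := by
      apply Polynomial.funext
      intro t
      rcases eq_or_ne t 0 with rfl | ht
      · simp
      simp only [Polynomial.eval_mul, Polynomial.eval_X, Polynomial.expand_eval, hQ,
        Polynomial.eval_C, Polynomial.eval_pow]
      congr 1
      have := law_K hf hD (Matrix.diagonal (Function.update (fun _ => (1 : K)) i0 (t ^ n))) 1 t 1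
        (by rw [Matrix.det_diagonal, Finset.prod_update_of_mem (Finset.mem_univ _)]; simp)
        (by simp) ht one_ne_zero x
      simp only [mul_one] at this
      rw [this, mul_comm]
    exact mul_left_cancel₀ Polynomial.X_ne_zero hz
  have := congrArg (fun p => Polynomial.coeff p D) hE
  simp only [Polynomial.coeff_expand hn, h, if_false, Polynomial.coeff_C_mul,
    Polynomial.coeff_X_pow, if_true, mul_one] at this
  exact this.symm

lemma law [IsAlgClosed K] {f : MvPolynomial (Fin m × Fin n × Fin n) K}
    (hf : f ∈ matrixSemiInvariants K n m) {k : ℕ} (hD : f.IsHomogeneous (n * k)) (hn : 0 < n)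
    {L : Type} [CommRing L] [Algebra K L]
    (A B : Matrix (Fin n) (Fin n) L) (x : Fin m → Matrix (Fin n) (Fin n) L) :
    ev (fun l => A * x l * B) f = (A.det * B.det) ^ k * ev x f := by
  let τ := (Fin n × Fin n) ⊕ (Fin n × Fin n) ⊕ (Fin m × Fin n × Fin n)
  let P := MvPolynomial τ K
  let a : Matrix (Fin n) (Fin n) P := Matrix.of fun i j => X (Sum.inl (i, j))
  let b : Matrix (Fin n) (Fin n) P := Matrix.of fun i j => X (Sum.inr (Sum.inl (i, j)))
  let z : Fin m → Matrix (Fin n) (Fin n) P :=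
    fun l => Matrix.of fun i j => X (Sum.inr (Sum.inr (l, i, j)))
  have hspec : ∀ {L : Type} [CommRing L] [Algebra K L] (A B : Matrix (Fin n) (Fin n) L)
      (x : Fin m → Matrix (Fin n) (Fin n) L), ∃ φ : P →ₐ[K] L,
      a.map φ = A ∧ b.map φ = B ∧ ∀ l, (z l).map φ = x l := by
    intro L _ _ A B x
    refine ⟨aeval (Sum.elim (fun p => A p.1 p.2) (Sum.elim (fun p => B p.1 p.2)
      (fun p => x p.1 p.2.1 p.2.2))), ?_, ?_, ?_⟩
    · ext i j; exact aeval_X _ _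
    · ext i j; exact aeval_X _ _
    · intro l; ext i j; exact aeval_X _ _
  have happ : ∀ {L : Type} [CommRing L] [Algebra K L] (φ : P →ₐ[K] L),
      φ (ev (fun l => a * z l * b) f) = ev (fun l => a.map φ * (z l).map φ * b.map φ) f ∧
      φ a.det = (a.map φ).det ∧ φ b.det = (b.map φ).det ∧
      φ (ev z f) = ev (fun l => (z l).map φ) f := by
    intro L _ _ φ
    refine ⟨?_, ?_, ?_, ev_comp _ _ _⟩
    · rw [ev_comp]; congr 2; funext l
      rw [Matrix.map_mul, Matrix.map_mul]
    · exact AlgHom.map_det φ a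
    · exact AlgHom.map_det φ b
  have hdet : a.det ≠ 0 ∧ b.det ≠ 0 := by
    obtain ⟨φ, h1, h2, -⟩ := hspec (1 : Matrix (Fin n) (Fin n) K) 1 (fun _ => 1)
    obtain ⟨-, h3, h4, -⟩ := happ φ
    rw [h1, Matrix.det_one] at h3
    rw [h2, Matrix.det_one] at h4
    constructor <;> intro h0 <;> simp [h0] at h3 h4
  have hgen : ev (fun l => a * z l * b) f = (a.det * b.det) ^ k * ev z f := by
    have : Infinite K := inferInstance
    apply mul_left_cancel₀ (mul_ne_zero hdet.1 hdet.2)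
    apply MvPolynomial.funext
    intro y
    obtain ⟨h1, h2, h3, h4⟩ := happ (aeval (R := K) y)
    simp only [map_mul, map_pow]
    have e : ∀ g : P, eval y g = aeval (R := K) y g := fun g => rfl
    rw [e, e, e, e, h1, h2, h3, h4]
    set A' := a.map (aeval (R := K) y)
    set B' := b.map (aeval (R := K) y)
    rcases eq_or_ne (A'.det * B'.det) 0 with h0 | h0
    · rw [h0]; simp
    congr 1
    obtain ⟨s, hs⟩ := IsAlgClosed.exists_pow_nat_eq A'.det hn
    obtain ⟨t, ht⟩ := IsAlgClosed.exists_pow_nat_eq B'.det hn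
    have hs0 : s ≠ 0 := by
      rintro rfl; rw [zero_pow hn.ne'] at hs; rw [← hs] at h0; simp at h0
    have ht0 : t ≠ 0 := by
      rintro rfl; rw [zero_pow hn.ne'] at ht; rw [← ht] at h0; simp at h0
    rw [← hs, ← ht, ← mul_pow, ← pow_mul]
    exact law_K hf hD A' B' s t hs ht hs0 ht0 _
  obtain ⟨φ, h1, h2, h3⟩ := hspec A B x
  obtain ⟨g1, g2, g3, g4⟩ := happ φ
  have := congrArg φ hgen
  rw [g1, map_mul, map_pow, map_mul, g2, g3, g4, h1, h2] at this
  simpa only [h3] using this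

end
end SI

open MvPolynomial Matrix
namespace SI

section SLgen
variable {K : Type} [Field K] {n : ℕ}

lemma sneg (i j : Fin n) (c : K) : single i j (-c) = - single i j c := by
  ext p q; simp only [Matrix.single_apply, Matrix.neg_apply]; split_ifs <;> simp

lemma tv_comm {i j k : Fin n} (hij : i ≠ j) (hjk : j ≠ k) (hik : i ≠ k) (c : K) :
    transvection i k c = transvection i j c * transvection j k 1 * transvection i j (-c) *
      transvection j k (-1) := by
  simp only [transvection, mul_add, add_mul, mul_one, one_mul]
  simp only [single_mul_single_same, single_mul_single_of_ne, hij, hjk, hik, hij.symm, hjk.symm,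
    hik.symm, ne_eq, not_false_eq_true, mul_one, mul_neg, sneg, add_zero, zero_mul,
    neg_neg, neg_mul, neg_zero]
  abel

lemma tv_diag {i j : Fin n} (hij : i ≠ j) {a : K} (ha : a ≠ 0) :
    transvection i j a * transvection j i (-a⁻¹) * transvection i j a *
      (transvection i j (-1) * transvection j i 1 * transvection i j (-1)) =
    Matrix.diagonal (fun k => if k = i then a else if k = j then a⁻¹ else 1) := by
  have h1 : ∀ b : K, b ≠ 0 → transvection i j b * transvection j i (-b⁻¹) * transvection i j b =
      1 - single i i 1 - single j j 1 + single i j b - single j i b⁻¹ := by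
    intro b hb
    simp only [transvection, mul_add, add_mul, mul_one, one_mul]
    simp only [single_mul_single_same, single_mul_single_of_ne, hij, hij.symm,
      ne_eq, not_false_eq_true, mul_one, mul_neg, sneg, add_zero, zero_mul,
      neg_neg, neg_mul, neg_zero, mul_inv_cancel₀ hb, inv_mul_cancel₀ hb, one_mul]
    abel
  have h2 := h1 (-1) (by simp)
  rw [inv_neg, inv_one, neg_neg] at h2
  rw [h1 a ha, h2]
  have h3 : Matrix.diagonal (fun k => if k = i then a else if k = j then a⁻¹ else 1) =
      1 - single i i 1 - single j j 1 + single i i a + single j j a⁻¹ := by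
    ext p q
    rcases eq_or_ne p q with rfl | hpq
    · by_cases h : p = i
      · subst h; simp [Matrix.single_apply, hij.symm]
      · by_cases h' : p = j
        · subst h'; simp [hij, h]
        · simp [Matrix.single_apply, h, h', Ne.symm h, Ne.symm h']
    · rw [Matrix.diagonal_apply_ne _ hpq]
      simp only [Matrix.add_apply, Matrix.sub_apply, Matrix.one_apply_ne hpq, Matrix.single_apply]
      have : ∀ r : Fin n, ¬ (r = p ∧ r = q) := by rintro r ⟨rfl, rfl⟩; exact hpq rfl
      simp [this]
  rw [h3]
  simp only [mul_add, add_mul, mul_sub, sub_mul, mul_one, one_mul]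
  simp only [single_mul_single_same, single_mul_single_of_ne, hij, hij.symm,
      ne_eq, not_false_eq_true, mul_one, mul_neg, sneg, add_zero, zero_mul, one_mul,
      neg_neg, neg_mul, neg_zero, sub_zero]
  abel

theorem sl_gen (P : Matrix (Fin n) (Fin n) K → Prop) (hone : P 1)
    (hmul : ∀ A B, P A → P B → P (A * B))
    (hadj : ∀ k k' : Fin n, (k.val + 1 = k'.val ∨ k'.val + 1 = k.val) → ∀ c, P (transvection k k' c))
    (A : Matrix (Fin n) (Fin n) K) (hA : A.det = 1) : P A := by
  have htv : ∀ N : ℕ, ∀ i k : Fin n, i ≠ k → (i.val < k.val + N ∧ k.val < i.val + N) →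
      ∀ c, P (transvection i k c) := by
    intro N
    induction N with
    | zero => intro i k _ h; omega
    | succ N ih =>
      intro i k hik h c
      have hik' : i.val ≠ k.val := fun h => hik (Fin.ext h)
      by_cases had : i.val + 1 = k.val ∨ k.val + 1 = i.val
      · exact hadj _ _ had c
      obtain ⟨j, hj1, hj2, hj3, hj4⟩ : ∃ j : Fin n, j ≠ i ∧ j ≠ k ∧
          (i.val < j.val + N ∧ j.val < i.val + N) ∧ (j.val < k.val + N ∧ k.val < j.val + N) := by
        rcases lt_or_gt_of_ne hik' with h1 | h1
        · refine ⟨⟨i.val + 1, by omega⟩, ?_, ?_, ?_, ?_⟩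
          · intro h; simp [Fin.ext_iff] at h
          · intro h; simp [Fin.ext_iff] at h; omega
          · simp; omega
          · simp; omega
        · refine ⟨⟨k.val + 1, by omega⟩, ?_, ?_, ?_, ?_⟩
          · intro h; simp [Fin.ext_iff] at h; omega
          · intro h; simp [Fin.ext_iff] at h
          · simp; omega
          · simp; omega
      rw [tv_comm hj1.symm hj2 hik]
      exact hmul _ _ (hmul _ _ (hmul _ _ (ih _ _ hj1.symm hj3 _) (ih _ _ hj2 hj4 _))
        (ih _ _ hj1.symm hj3 _)) (ih _ _ hj2 hj4 _)
  have htv' : ∀ i k : Fin n, i ≠ k → ∀ c, P (transvection i k c) := fun i k h c =>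
    htv n i k h ⟨by omega, by omega⟩ c
  have hd2 : ∀ i j : Fin n, i ≠ j → ∀ a : K, a ≠ 0 →
      P (Matrix.diagonal (fun k => if k = i then a else if k = j then a⁻¹ else 1)) := by
    intro i j hij a ha
    rw [← tv_diag hij ha]
    refine hmul _ _ (hmul _ _ (hmul _ _ ?_ ?_) ?_) (hmul _ _ (hmul _ _ ?_ ?_) ?_)
    all_goals first | exact htv' _ _ hij _ | exact htv' _ _ hij.symm _
  have hdiag : ∀ d : Fin n → K, ∏ i, d i = 1 → P (Matrix.diagonal d) := by
    intro d hd
    rcases Nat.eq_zero_or_pos n with rfl | hn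
    · convert hone using 1; ext i; exact i.elim0
    have hd0 : ∀ i, d i ≠ 0 := by
      intro i hi
      rw [Finset.prod_eq_zero (Finset.mem_univ i) hi] at hd
      exact zero_ne_one hd
    let i0 : Fin n := ⟨0, hn⟩
    have key : ∀ s : Finset (Fin n), i0 ∉ s → P (Matrix.diagonal
        (fun i => if i ∈ s then d i else if i = i0 then (∏ j ∈ s, d j)⁻¹ else 1)) := by
      intro s
      induction s using Finset.induction_on with
      | empty =>
        intro _
        convert hone using 1
        rw [← Matrix.diagonal_one]
        congr 1; funext i; simp
      | insert a s ha ih =>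
        intro h
        rw [Finset.mem_insert, not_or] at h
        have := hmul _ _ (ih h.2) (hd2 a i0 (Ne.symm h.1) (d a) (hd0 a))
        rw [Matrix.diagonal_mul_diagonal] at this
        convert this using 2
        funext i
        rcases eq_or_ne i a with rfl | hia
        · simp [ha, Ne.symm h.1]
        · rcases eq_or_ne i i0 with rfl | hi0
          · simp [h.1, h.2, Finset.prod_insert ha, mul_comm]
          · simp [hia, hi0]
    have := key (Finset.univ.erase i0) (by simp)
    convert this using 2
    funext i
    rcases eq_or_ne i i0 with rfl | hi0
    · simp only [Finset.mem_erase, ne_eq, not_true_eq_false, false_and, if_false, if_true]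
      rw [← Finset.mul_prod_erase _ _ (Finset.mem_univ i0)] at hd
      exact eq_inv_of_mul_eq_one_left hd
    · simp [hi0]
  obtain ⟨L, L', D, h⟩ := Matrix.Pivot.exists_list_transvec_mul_diagonal_mul_list_transvec A
  have hL : ∀ L : List (TransvectionStruct (Fin n) K),
      P (L.map TransvectionStruct.toMatrix).prod := by
    intro L
    induction L with
    | nil => simpa using hone
    | cons t L ih =>
      rw [List.map_cons, List.prod_cons]
      exact hmul _ _ (htv' _ _ t.hij _) ih
  rw [h]
  refine hmul _ _ (hmul _ _ (hL L) (hdiag D ?_)) (hL L')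
  have h2 := congrArg Matrix.det h
  rw [hA, Matrix.det_mul, Matrix.det_mul, TransvectionStruct.det_toMatrix_prod,
    TransvectionStruct.det_toMatrix_prod, Matrix.det_diagonal] at h2
  simpa using h2.symm

end SLgen
end SI

open MvPolynomial Matrix
namespace SI

section Frob
variable {σ : Type} [Fintype σ] [DecidableEq σ] {K : Type} [Field K]

/-- the exponent with all entries `p - 1` -/
noncomputable def topE (σ : Type) [Fintype σ] (p : ℕ) : σ →₀ ℕ :=
  Finsupp.equivFunOnFinite.symm (fun _ => p - 1)

@[simp] lemma topE_apply (p : ℕ) (v : σ) : topE σ p v = p - 1 := rfl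

variable (p : ℕ) [hp : Fact p.Prime] [ExpChar K p] [PerfectRing K p]

/-- the Cartier type operator -/
noncomputable def car (s : MvPolynomial σ K) : MvPolynomial σ K :=
  ∑ a ∈ s.support, if ∀ v, a v % p = p - 1 then
    monomial (a.mapRange (fun x => x / p) (Nat.zero_div p)) ((frobeniusEquiv K p).symm (coeff a s))
    else 0

lemma coeff_car (s : MvPolynomial σ K) (b : σ →₀ ℕ) :
    coeff b (car p s) = (frobeniusEquiv K p).symm (coeff (p • b + topE σ p) s) := by
  have hp0 := hp.out.pos
  unfold car
  rw [coeff_sum]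
  have hval : ∀ v, (p • b + topE σ p) v = p * b v + (p - 1) := fun v => by simp
  have h1 : ∀ v, (p • b + topE σ p) v % p = p - 1 := by
    intro v; rw [hval, Nat.mul_add_mod, Nat.mod_eq_of_lt (by omega)]
  have h2 : (p • b + topE σ p).mapRange (fun x => x / p) (Nat.zero_div p) = b := by
    ext v
    rw [Finsupp.mapRange_apply, hval, Nat.mul_add_div hp0, Nat.div_eq_of_lt (by omega), add_zero]
  rw [Finset.sum_eq_single (p • b + topE σ p)]
  · rw [if_pos h1, h2, coeff_monomial, if_pos rfl]
  · intro a _ hne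
    split_ifs with h
    · rw [coeff_monomial, if_neg]
      rintro rfl
      apply hne
      ext v
      rw [hval, Finsupp.mapRange_apply, ← h v]
      exact (Nat.div_add_mod _ _).symm
    · simp
  · intro h
    rw [if_pos h1, notMem_support_iff.mp h]; simp

lemma car_add (s t : MvPolynomial σ K) : car p (s + t) = car p s + car p t := by
  ext b; simp [coeff_car]

lemma car_zero : car p (0 : MvPolynomial σ K) = 0 := by
  ext b; simp [coeff_car]

lemma car_sum {ι : Type} (s : Finset ι) (f : ι → MvPolynomial σ K) :
    car p (∑ i ∈ s, f i) = ∑ i ∈ s, car p (f i) := by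
  induction s using Finset.cons_induction with
  | empty => simp [car_zero]
  | cons a s ha ih => rw [Finset.sum_cons, Finset.sum_cons, car_add, ih]

lemma pow_add_p (s t : MvPolynomial σ K) : (s + t) ^ p = s ^ p + t ^ p := by
  have : ExpChar (MvPolynomial σ K) p := inferInstance
  exact add_pow_expChar _ _ _

lemma car_pow_mul (s u : MvPolynomial σ K) : car p (s ^ p * u) = s * car p u := by
  have hp0 := hp.out.pos
  induction s using MvPolynomial.induction_on' with
  | add f g hf hg => rw [pow_add_p, add_mul, car_add, add_mul, hf, hg]
  | monomial c a =>
    ext b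
    rw [coeff_car, monomial_pow, coeff_monomial_mul', coeff_monomial_mul']
    have hiff : p • c ≤ p • b + topE σ p ↔ c ≤ b := by
      simp only [Finsupp.le_def]
      refine forall_congr' fun v => ?_
      simp only [Finsupp.add_apply, Finsupp.smul_apply, topE_apply, smul_eq_mul]
      constructor
      · intro h
        by_contra hlt
        have : p * (b v + 1) ≤ p * c v := Nat.mul_le_mul_left _ (by omega)
        rw [mul_add, mul_one] at this
        omega
      · intro h
        have : p * c v ≤ p * b v := Nat.mul_le_mul_left _ h
        omega
    by_cases h : c ≤ b
    · rw [if_pos (hiff.mpr h), if_pos h, coeff_car, map_mul]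
      congr 1
      · exact (frobeniusEquiv K p).symm_apply_apply a
      · congr 2
        ext v
        have := h v
        have h3 : p * c v ≤ p * b v := Nat.mul_le_mul_left _ this
        simp only [Finsupp.add_apply, Finsupp.smul_apply, topE_apply, smul_eq_mul,
          Finsupp.tsub_apply, Nat.mul_sub]
        omega
    · rw [if_neg (fun h' => h (hiff.mp h')), if_neg h, map_zero]

/-- A linear substitution for which the coefficient of the top monomial is one commutes
with the operator. -/
lemma car_comm (τ : MvPolynomial σ K →ₐ[K] MvPolynomial σ K)
    (hτ : ∀ v, (τ (X v)).IsHomogeneous 1)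
    (htop : coeff (topE σ p) (τ (monomial (topE σ p) 1)) = 1) (s : MvPolynomial σ K) :
    car p (τ s) = τ (car p s) := by
  have hp0 := hp.out.pos
  have hhom : ∀ a : σ →₀ ℕ, (τ (monomial a 1)).IsHomogeneous a.degree := by
    intro a
    have h1 : monomial a (1 : K) = ∏ v, X v ^ a v := by
      rw [monomial_eq, C_1, one_mul, Finsupp.prod_fintype _ _ (by simp)]
    rw [h1, map_prod]
    have : a.degree = ∑ v, a v := by rw [Finsupp.degree_eq_sum]
    rw [this]
    refine IsHomogeneous.prod _ _ _ fun v _ => ?_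
    rw [map_pow]
    have := (hτ v).pow (a v)
    rwa [one_mul] at this
  have hdeg : ∀ a b : σ →₀ ℕ, coeff b (τ (monomial a 1)) ≠ 0 → b.degree = a.degree := by
    intro a b h
    have := hhom a h
    rw [← this, Finsupp.degree_eq_weight_one]; rfl
  have hsmall : ∀ a : σ →₀ ℕ, (∀ v, a v < p) →
      car p (τ (monomial a 1)) = if a = topE σ p then 1 else 0 := by
    intro a ha
    have hle : a.degree ≤ (topE σ p).degree := by
      rw [Finsupp.degree_eq_sum, Finsupp.degree_eq_sum]
      exact Finset.sum_le_sum fun v _ => by have := ha v; rw [topE_apply]; omega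
    ext b
    rw [coeff_car]
    by_cases hc : coeff (p • b + topE σ p) (τ (monomial a 1)) = 0
    · rw [hc, map_zero]
      split_ifs with h
      · rw [coeff_one, if_neg]
        rintro rfl
        subst h
        rw [smul_zero, zero_add, htop] at hc
        exact one_ne_zero hc
      · simp
    · have h1 := hdeg _ _ hc
      have h2 : (p • b + topE σ p).degree = p * b.degree + (topE σ p).degree := by
        rw [map_add, map_nsmul, smul_eq_mul]
      have h3 : b.degree = 0 := by
        rcases Nat.eq_zero_or_pos b.degree with h | h
        · exact h
        · have := Nat.mul_pos hp0 h; omega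
      have hb : b = 0 := (Finsupp.degree_eq_zero_iff b).mp h3
      subst hb
      have h4 : a = topE σ p := by
        by_contra hne
        have : a.degree < (topE σ p).degree := by
          rw [Finsupp.degree_eq_sum, Finsupp.degree_eq_sum]
          obtain ⟨v, hv⟩ : ∃ v, a v ≠ topE σ p v := by
            by_contra h; push Not at h; exact hne (Finsupp.ext h)
          refine Finset.sum_lt_sum (fun v _ => ?_) ⟨v, Finset.mem_univ v, ?_⟩
          · have := ha v; rw [topE_apply]; omega
          · have := ha v; rw [topE_apply] at hv ⊢; omega
        rw [smul_zero, zero_add] at h1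
        omega
      subst h4
      rw [if_pos rfl, smul_zero, zero_add, htop, map_one, coeff_one, if_pos rfl]
  have hcar : ∀ a : σ →₀ ℕ, (∀ v, a v < p) →
      car p (monomial a (1 : K)) = if a = topE σ p then 1 else 0 := by
    intro a ha
    ext b
    rw [coeff_car, coeff_monomial]
    by_cases hb : a = p • b + topE σ p
    · have : b = 0 := by
        ext v
        have h1 := DFunLike.congr_fun hb v
        simp only [Finsupp.add_apply, Finsupp.smul_apply, topE_apply, smul_eq_mul] at h1
        have h2 := ha v
        rw [Finsupp.zero_apply]
        rcases Nat.eq_zero_or_pos (b v) with h | h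
        · exact h
        · have : p * 1 ≤ p * b v := Nat.mul_le_mul_left _ h
          omega
      subst this
      rw [smul_zero, zero_add] at hb
      rw [if_pos (by rw [hb, smul_zero, zero_add]), if_pos hb, map_one, coeff_one, if_pos rfl]
    · rw [if_neg hb, map_zero]
      split_ifs with h
      · rw [coeff_one, if_neg]
        rintro rfl
        apply hb; rw [h, smul_zero, zero_add]
      · simp
  induction s using MvPolynomial.induction_on' with
  | add f g hf hg => rw [map_add, car_add, car_add, map_add, hf, hg]
  | monomial a c =>
    let q : σ →₀ ℕ := a.mapRange (fun x => x / p) (Nat.zero_div p)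
    let r : σ →₀ ℕ := a.mapRange (fun x => x % p) (Nat.zero_mod p)
    obtain ⟨c', hc'⟩ := (frobeniusEquiv K p).surjective c
    have hc'' : c = c' ^ p := by rw [← hc']; rfl
    have hm : monomial a c = (monomial q c') ^ p * monomial r 1 := by
      rw [monomial_pow, monomial_mul, mul_one, hc'']
      congr 2
      ext v
      simp only [Finsupp.add_apply, Finsupp.smul_apply, smul_eq_mul, q, r, Finsupp.mapRange_apply]
      rw [Nat.div_add_mod]
    have hr : ∀ v, r v < p := fun v => Nat.mod_lt _ hp0
    rw [hm, map_mul, map_pow, car_pow_mul, car_pow_mul, map_mul, hsmall r hr, hcar r hr]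
    congr 1
    split_ifs <;> simp

end Frob
end SI

open MvPolynomial Matrix
namespace SI

section Op
variable {σ : Type} [Fintype σ] [DecidableEq σ] {K : Type} [Field K]

/-- elementary operation on variables -/
def opv {L : Type} [CommRing L] (T : Finset σ) (s : σ → σ) (u : L) (y : σ → L) : σ → L :=
  fun v => if v ∈ T then y v + u * y (s v) else y v

/-- elementary operation with scalar parameter -/
noncomputable def opu (T : Finset σ) (s : σ → σ) (u : K) :
    MvPolynomial σ K →ₐ[K] MvPolynomial σ K :=
  aeval (opv T s (C u) X)

/-- elementary operation with polynomial parameter -/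
noncomputable def opt (K : Type) [Field K] (T : Finset σ) (s : σ → σ) :
    MvPolynomial σ K →ₐ[K] Polynomial (MvPolynomial σ K) :=
  aeval (opv T s Polynomial.X (fun v => Polynomial.C (X v)))

lemma opt_eval (T : Finset σ) (s : σ → σ) (u : K) (f : MvPolynomial σ K) :
    Polynomial.eval (C u) (opt K T s f) = opu T s u f := by
  induction f using MvPolynomial.induction_on with
  | C a =>
    simp only [opt, opu, algHom_C]
    rw [IsScalarTower.algebraMap_apply K (MvPolynomial σ K) (Polynomial (MvPolynomial σ K))]
    simp
  | add f g hf hg => simp [hf, hg]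
  | mul_X f v hf =>
    rw [map_mul, map_mul, Polynomial.eval_mul, hf]
    congr 1
    simp only [opt, opu, aeval_X, opv]
    split_ifs
    · simp; ring
    · simp

lemma mul_add_pow_of {L : Type} [CommRing L] {y a b : L} (h : y * b = 0) (e : ℕ) :
    y * (a + b) ^ e = y * a ^ e := by
  induction e with
  | zero => simp
  | succ e ih =>
    rw [pow_succ, ← mul_assoc, ih, pow_succ]
    linear_combination a ^ e * h

lemma mul_prod_add_of {L : Type} [CommRing L] {y : L} (T : Finset σ) (a b : σ → L)
    (h : ∀ v ∈ T, y * b v = 0) (e : ℕ) :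
    y * ∏ v ∈ T, (a v + b v) ^ e = y * ∏ v ∈ T, a v ^ e := by
  induction T using Finset.induction_on with
  | empty => simp
  | insert v T hv ih =>
    rw [Finset.prod_insert hv, Finset.prod_insert hv]
    have h1 := ih (fun w hw => h w (Finset.mem_insert_of_mem hw))
    have h2 := mul_add_pow_of (a := a v) (h v (Finset.mem_insert_self _ _)) e
    calc y * ((a v + b v) ^ e * ∏ v ∈ T, (a v + b v) ^ e)
        = (a v + b v) ^ e * (y * ∏ v ∈ T, (a v + b v) ^ e) := by ring
      _ = (y * (a v + b v) ^ e) * ∏ v ∈ T, a v ^ e := by rw [h1]; ring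
      _ = _ := by rw [h2]; ring

variable (p : ℕ) [hp : Fact p.Prime]

lemma op_top (T : Finset σ) (s : σ → σ) (hs : ∀ v ∈ T, s v ∉ T) (u : K) :
    coeff (topE σ p) (opu T s u (monomial (topE σ p) 1)) = 1 := by
  have hp0 := hp.out.pos
  let J : Ideal (MvPolynomial σ K) := Ideal.span (Set.range fun w : σ => (X w : MvPolynomial σ K) ^ p)
  have hJ : ∀ g ∈ J, coeff (topE σ p) g = 0 := by
    intro g hg
    refine Submodule.span_induction (p := fun g _ => ∀ h, coeff (topE σ p) (h * g) = 0)
      ?_ ?_ ?_ ?_ hg 1 |> fun h => by simpa using h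
    · rintro _ ⟨w, rfl⟩ h
      simp only [X_pow_eq_monomial]
      rw [coeff_mul_monomial', if_neg]
      intro hle
      have := hle w
      simp at this
      omega
    · intro h; simp
    · intro x y _ _ hx hy h; rw [mul_add, coeff_add, hx, hy, add_zero]
    · intro a x _ hx h; rw [smul_eq_mul, ← mul_assoc]; exact hx _
  have h1 : monomial (topE σ p) (1 : K) = ∏ v, X v ^ (p - 1) := by
    rw [monomial_eq, C_1, one_mul, Finsupp.prod_fintype _ _ (by simp)]
    rfl
  have hmem : opu T s u (monomial (topE σ p) 1) - monomial (topE σ p) 1 ∈ J := by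
    rw [← Ideal.Quotient.eq, h1, map_prod]
    have hsplit : ∀ f : σ → MvPolynomial σ K, ∏ v, f v = (∏ v ∈ Tᶜ, f v) * ∏ v ∈ T, f v :=
      fun f => (Finset.prod_compl_mul_prod T f).symm
    rw [hsplit, hsplit]
    have e1 : ∏ v ∈ Tᶜ, opu T s u (X v ^ (p - 1)) = ∏ v ∈ Tᶜ, X v ^ (p - 1) := by
      refine Finset.prod_congr rfl fun v hv => ?_
      rw [Finset.mem_compl] at hv
      simp [opu, opv, hv]
    have e2 : ∏ v ∈ T, opu T s u (X v ^ (p - 1)) =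
        ∏ v ∈ T, (X v + C u * X (s v)) ^ (p - 1) := by
      refine Finset.prod_congr rfl fun v hv => ?_
      simp [opu, opv, hv]
    rw [e1, e2]
    simp only [map_mul, map_prod, map_pow, map_add]
    apply mul_prod_add_of
    intro v hv
    have hsv : s v ∈ Tᶜ := by rw [Finset.mem_compl]; exact hs v hv
    simp only [← map_pow, ← map_prod, ← map_mul]
    rw [Ideal.Quotient.eq_zero_iff_mem, ← Finset.mul_prod_erase _ _ hsv]
    have : X (s v) ^ (p - 1) * (∏ x ∈ Tᶜ.erase (s v), (X x : MvPolynomial σ K) ^ (p - 1)) *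
        (C u * X (s v)) = (C u * ∏ x ∈ Tᶜ.erase (s v), (X x : MvPolynomial σ K) ^ (p - 1)) *
          X (s v) ^ p := by
      conv_rhs => rw [show p = (p - 1) + 1 by omega, pow_succ]
      simp only [Nat.add_sub_cancel]
      ring
    rw [this]
    exact Ideal.mul_mem_left _ _ (Ideal.subset_span ⟨s v, rfl⟩)
  have h2 := hJ _ hmem
  rw [coeff_sub, coeff_monomial, if_pos rfl] at h2
  exact sub_eq_zero.mp h2

variable [ExpChar K p] [PerfectRing K p]

lemma car_op_comm (T : Finset σ) (s : σ → σ) (hs : ∀ v ∈ T, s v ∉ T) (u : K)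
    (f : MvPolynomial σ K) : car p (opu T s u f) = opu T s u (car p f) := by
  apply car_comm
  · intro v
    simp only [opu, aeval_X, opv]
    split_ifs
    · exact (isHomogeneous_X _ _).add
        (IsHomogeneous.mul (m := 0) (n := 1) (isHomogeneous_C _ _) (isHomogeneous_X _ _))
    · exact isHomogeneous_X _ _
  · exact op_top p T s hs u

lemma car_inv [Infinite K] (T : Finset σ) (s : σ → σ) (hs : ∀ v ∈ T, s v ∉ T)
    (H r : MvPolynomial σ K) (hH : (opt K T s H).natDegree ≤ 1) (hr : ∀ u : K, opu T s u r = r)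
    (u : K) : opu T s u (car p (H ^ (p - 1) * r)) = car p (H ^ (p - 1) * r) := by
  have hp0 := hp.out.pos
  set q := car p (H ^ (p - 1) * r) with hq
  set G := opt K T s (H ^ (p - 1)) with hG
  have hGd : G.natDegree < p := by
    have : G.natDegree ≤ (p - 1) * 1 := by
      rw [hG, map_pow]
      exact Polynomial.natDegree_pow_le_of_le _ hH
    omega
  have key : ∀ w : K, Polynomial.eval (C w) (Polynomial.expand _ p (opt K T s q)) =
      Polynomial.eval (C w) (∑ i ∈ Finset.range p,
        Polynomial.C (car p (G.coeff i * r)) * Polynomial.X ^ i) := by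
    intro w
    rw [Polynomial.expand_eval, ← C_pow, opt_eval, hq, ← car_op_comm p T s hs, map_mul, hr,
      ← opt_eval, ← hG, Polynomial.eval_eq_sum_range' hGd, Finset.sum_mul, car_sum,
      Polynomial.eval_finset_sum]
    refine Finset.sum_congr rfl fun i _ => ?_
    rw [Polynomial.eval_mul, Polynomial.eval_C, Polynomial.eval_pow, Polynomial.eval_X]
    have : G.coeff i * C (w ^ p) ^ i * r = (C w ^ i) ^ p * (G.coeff i * r) := by
      rw [C_pow]; ring
    rw [this, car_pow_mul, mul_comm]
  have hpoly : Polynomial.expand _ p (opt K T s q) = ∑ i ∈ Finset.range p,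
        Polynomial.C (car p (G.coeff i * r)) * Polynomial.X ^ i := by
    apply Polynomial.eq_of_infinite_eval_eq
    refine Set.Infinite.mono (s := Set.range (C : K → MvPolynomial σ K)) ?_ ?_
    · rintro _ ⟨w, rfl⟩; exact key w
    · exact Set.infinite_range_of_injective (C_injective _ _)
  have hc : opt K T s q = Polynomial.C ((opt K T s q).coeff 0) := by
    ext1 j
    rw [Polynomial.coeff_C]
    split_ifs with hj
    · rw [hj]
    · have h1 := congrArg (fun P => Polynomial.coeff P (j * p)) hpoly
      simp only [Polynomial.coeff_expand_mul hp0] at h1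
      rw [h1, Polynomial.finset_sum_coeff]
      refine Finset.sum_eq_zero fun i hi => ?_
      rw [Polynomial.coeff_C_mul, Polynomial.coeff_X_pow, if_neg, mul_zero]
      rw [Finset.mem_range] at hi
      have : 1 * p ≤ j * p := Nat.mul_le_mul_right _ (by omega)
      omega
  have h0 : opu T s (0 : K) q = q := by
    have : opv T s (C (0 : K)) (X : σ → MvPolynomial σ K) = X := by
      funext v; simp [opv]
    rw [opu, this]; simp
  rw [← opt_eval, hc, Polynomial.eval_C]
  rw [← opt_eval, hc, Polynomial.eval_C] at h0
  exact h0

end Op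
end SI

open MvPolynomial Matrix
namespace SI

section Low
variable {σ : Type} [Fintype σ] [DecidableEq σ] {K : Type} [Field K]

/-- total weight of an exponent -/
def wt (w : σ → ℤ) (a : σ →₀ ℕ) : ℤ := ∑ v, (a v : ℤ) * w v

lemma wt_add (w : σ → ℤ) (a b : σ →₀ ℕ) : wt w (a + b) = wt w a + wt w b := by
  simp only [wt, ← Finset.sum_add_distrib]
  refine Finset.sum_congr rfl fun v _ => ?_
  rw [Finsupp.add_apply]; push_cast; ring

lemma wt_sum (w : σ → ℤ) {N : ℕ} (y : Fin N → σ) :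
    wt w (∑ i, Finsupp.single (y i) 1) = ∑ i, w (y i) := by
  have h : ∀ s : Finset (Fin N), wt w (∑ i ∈ s, Finsupp.single (y i) 1) = ∑ i ∈ s, w (y i) := by
    intro s
    induction s using Finset.cons_induction with
    | empty => simp [wt]
    | cons a s ha ih =>
      rw [Finset.sum_cons, Finset.sum_cons, wt_add, ih]
      congr 1
      simp [wt, Finsupp.single_apply]
  exact h _

/-- `a` is the unique lowest weight exponent of `f`. -/
def IsLow (w : σ → ℤ) (f : MvPolynomial σ K) (a : σ →₀ ℕ) : Prop :=
  coeff a f ≠ 0 ∧ ∀ b, coeff b f ≠ 0 → b ≠ a → wt w a < wt w b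

lemma IsLow.mul {w : σ → ℤ} {f g : MvPolynomial σ K} {a b : σ →₀ ℕ}
    (hf : IsLow w f a) (hg : IsLow w g b) : IsLow w (f * g) (a + b) := by
  have hle : ∀ c d, coeff c f ≠ 0 → coeff d g ≠ 0 → (c = a ∧ d = b) ∨
      wt w (a + b) < wt w (c + d) := by
    intro c d hc hd
    rw [wt_add, wt_add]
    by_cases h1 : c = a
    · by_cases h2 : d = b
      · exact Or.inl ⟨h1, h2⟩
      · right; subst h1; have := hg.2 d hd h2; omega
    · right
      have h3 := hf.2 c hc h1
      by_cases h2 : d = b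
      · subst h2; omega
      · have := hg.2 d hd h2; omega
  constructor
  · rw [coeff_mul, Finset.sum_eq_single (a, b)]
    · exact mul_ne_zero hf.1 hg.1
    · rintro ⟨c, d⟩ hcd hne
      rw [Finset.HasAntidiagonal.mem_antidiagonal] at hcd
      simp only at hcd ⊢
      by_contra h
      rcases hle c d (left_ne_zero_of_mul h) (right_ne_zero_of_mul h) with ⟨rfl, rfl⟩ | h'
      · exact hne rfl
      · rw [hcd] at h'; exact lt_irrefl _ h'
    · intro h
      exfalso; apply h
      rw [Finset.HasAntidiagonal.mem_antidiagonal]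
  · intro e he hne
    rw [coeff_mul] at he
    obtain ⟨⟨c, d⟩, hcd, h⟩ := Finset.exists_ne_zero_of_sum_ne_zero he
    rw [Finset.HasAntidiagonal.mem_antidiagonal] at hcd
    simp only at hcd h
    rcases hle c d (left_ne_zero_of_mul h) (right_ne_zero_of_mul h) with ⟨rfl, rfl⟩ | h'
    · exact absurd hcd.symm hne
    · rwa [hcd] at h'

lemma IsLow.one {w : σ → ℤ} : IsLow w (1 : MvPolynomial σ K) 0 := by
  constructor
  · simp
  · intro b hb hne
    rw [coeff_one, if_neg (Ne.symm hne)] at hb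
    exact absurd rfl hb

lemma IsLow.prod {w : σ → ℤ} {ι : Type} (s : Finset ι) (f : ι → MvPolynomial σ K)
    (a : ι → σ →₀ ℕ) (h : ∀ i ∈ s, IsLow w (f i) (a i)) :
    IsLow w (∏ i ∈ s, f i) (∑ i ∈ s, a i) := by
  induction s using Finset.cons_induction with
  | empty => simpa using IsLow.one
  | cons i s hi ih =>
    rw [Finset.prod_cons, Finset.sum_cons]
    exact (h i (Finset.mem_cons_self i s)).mul
      (ih fun j hj => h j (Finset.mem_cons_of_mem hj))

lemma IsLow.pow {w : σ → ℤ} {f : MvPolynomial σ K} {a : σ →₀ ℕ} (h : IsLow w f a) (e : ℕ) :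
    IsLow w (f ^ e) (e • a) := by
  have := IsLow.prod (Finset.range e) (fun _ => f) (fun _ => a) (fun _ _ => h)
  simpa using this

/-- indicator of a level set -/
noncomputable def levelE (δ : σ → ℤ) (D : ℤ) : σ →₀ ℕ :=
  Finsupp.equivFunOnFinite.symm (fun v => if δ v = D then 1 else 0)

lemma levelE_apply (δ : σ → ℤ) (D : ℤ) (v : σ) : levelE δ D v = if δ v = D then 1 else 0 := rfl

lemma level_sum (δ : σ → ℤ) (D : ℤ) {N : ℕ} (y : Fin N → σ) (hinj : Function.Injective y)
    (hD : ∀ i, δ (y i) = D) (hsurj : ∀ v, δ v = D → ∃ i, y i = v) :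
    ∑ i, Finsupp.single (y i) 1 = levelE δ D := by
  ext v
  rw [levelE_apply, Finsupp.finset_sum_apply]
  simp only [Finsupp.single_apply]
  split_ifs with h
  · obtain ⟨i, rfl⟩ := hsurj v h
    simp [hinj.eq_iff]
  · refine Finset.sum_eq_zero fun i _ => if_neg ?_
    rintro rfl; exact h (hD i)

lemma low_of_sum (δ : σ → ℤ) {E : Type} [Fintype E] [DecidableEq E] (c : E → K) {N : ℕ}
    (y : E → Fin N → σ) (D : ℤ) (hsum : ∀ e, c e ≠ 0 → ∑ i, δ (y e i) = N * D) (e0 : E)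
    (hc0 : c e0 ≠ 0) (h0 : ∀ i, δ (y e0 i) = D)
    (huniq : ∀ e, c e ≠ 0 → (∀ i, δ (y e i) = D) → e = e0)
    (hinj : Function.Injective (y e0)) (hsurj : ∀ v, δ v = D → ∃ i, y e0 i = v) :
    IsLow (fun x => δ x ^ 2) (∑ e, C (c e) * ∏ i, X (y e i) : MvPolynomial σ K)
      (levelE δ D) := by
  rw [← level_sum δ D (y e0) hinj h0 hsurj]
  have hmon : ∀ e, (C (c e) * ∏ i, X (y e i) : MvPolynomial σ K) =
      monomial (∑ i, Finsupp.single (y e i) 1) (c e) := by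
    intro e
    have : ∀ s : Finset (Fin N), (∏ i ∈ s, X (y e i) : MvPolynomial σ K) =
      monomial (∑ i ∈ s, Finsupp.single (y e i) 1) 1 := by
      intro s
      induction s using Finset.cons_induction with
      | empty => simp
      | cons a s ha ih =>
        rw [Finset.prod_cons, Finset.sum_cons, ih, X, monomial_mul, mul_one]
    rw [this, C_mul_monomial, mul_one]
  simp only [hmon]
  have hw0 : wt (fun x => δ x ^ 2) (∑ i, Finsupp.single (y e0 i) 1) = N * D ^ 2 := by
    rw [wt_sum]; simp [h0]
  have hw : ∀ e, c e ≠ 0 → e ≠ e0 → N * D ^ 2 <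
      wt (fun x => δ x ^ 2) (∑ i, Finsupp.single (y e i) 1) := by
    intro e hce hne
    rw [wt_sum]
    obtain ⟨i0, hi0⟩ : ∃ i, δ (y e i) ≠ D := by
      by_contra h; push Not at h; exact hne (huniq e hce h)
    have h1 : 0 < ∑ i, (δ (y e i) - D) ^ 2 := by
      refine Finset.sum_pos' (fun i _ => sq_nonneg _) ⟨i0, Finset.mem_univ _, ?_⟩
      have : δ (y e i0) - D ≠ 0 := sub_ne_zero.mpr hi0
      positivity
    have h2 : ∑ i, (δ (y e i) - D) ^ 2 = ∑ i, δ (y e i) ^ 2 - 2 * D * ∑ i, δ (y e i) + N * D ^ 2 := by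
      rw [Finset.mul_sum, ← Finset.sum_sub_distrib]
      have : (N : ℤ) * D ^ 2 = ∑ i : Fin N, D ^ 2 := by simp
      rw [this, ← Finset.sum_add_distrib]
      refine Finset.sum_congr rfl fun i _ => by ring
    rw [hsum e hce] at h2
    nlinarith
  constructor
  · rw [coeff_sum, Finset.sum_eq_single e0]
    · rw [coeff_monomial, if_pos rfl]; exact hc0
    · intro e _ hne
      rw [coeff_monomial]
      split_ifs with h
      · by_contra hce
        have := hw e hce hne
        rw [h, hw0] at this
        exact lt_irrefl _ this
      · rfl
    · intro h; exact absurd (Finset.mem_univ _) h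
  · intro b hb hne
    rw [coeff_sum] at hb
    obtain ⟨e, _, he⟩ := Finset.exists_ne_zero_of_sum_ne_zero hb
    rw [coeff_monomial] at he
    split_ifs at he with h
    · subst h
      rw [hw0]
      refine hw e he ?_
      rintro rfl; exact hne rfl
    · exact absurd rfl he

end Low
end SI

open MvPolynomial Matrix
namespace SI

section Fac
variable {K : Type} [Field K]

section
variable {σ : Type} [Fintype σ] [DecidableEq σ]

lemma opt_det (T : Finset σ) (s : σ → σ) {N : ℕ} (y : Fin N → Fin N → σ) :
    opt K T s (Matrix.det (Matrix.of fun i j => X (y i j))) =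
      Matrix.det (Matrix.of fun i j => opt K T s (X (y i j))) := by
  rw [AlgHom.map_det]; rfl

lemma opt_det_zero (T : Finset σ) (s : σ → σ) {N : ℕ} (y : Fin N → Fin N → σ)
    (h : ∀ i j, y i j ∉ T) :
    (opt K T s (Matrix.det (Matrix.of fun i j => X (y i j)))).natDegree ≤ 0 := by
  rw [opt_det]
  have : (Matrix.of fun i j => opt K T s (X (y i j))) =
      (Matrix.of fun i j => (X (y i j) : MvPolynomial σ K)).map Polynomial.C := by
    ext i j : 2; simp [opt, opv, h]
  have h2 := RingHom.map_det (Polynomial.C : MvPolynomial σ K →+* _)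
    (Matrix.of fun i j => (X (y i j) : MvPolynomial σ K))
  rw [this, ← RingHom.mapMatrix_apply, ← h2, Polynomial.natDegree_C]

lemma opt_det_row (T : Finset σ) (s : σ → σ) {N : ℕ} (y : Fin N → Fin N → σ) (a : Fin N)
    (h : ∀ i j, y i j ∈ T ↔ i = a) : ∃ G : MvPolynomial σ K,
    (opt K T s (Matrix.det (Matrix.of fun i j => X (y i j)))) =
      Polynomial.C (Matrix.det (Matrix.of fun i j => X (y i j))) + Polynomial.X * Polynomial.C G ∧
    ((∃ b, b ≠ a ∧ ∀ j, s (y a j) = y b j) → G = 0) := by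
  let M : Matrix (Fin N) (Fin N) (MvPolynomial σ K) := Matrix.of fun i j => X (y i j)
  let r : Fin N → MvPolynomial σ K := fun j => X (s (y a j))
  refine ⟨(M.updateRow a r).det, ?_, ?_⟩
  · rw [opt_det]
    have : (Matrix.of fun i j => opt K T s (X (y i j))) =
        (M.map (Polynomial.C : MvPolynomial σ K →+* Polynomial (MvPolynomial σ K))).updateRow a
          ((M.map (Polynomial.C : MvPolynomial σ K →+* Polynomial (MvPolynomial σ K))) a +
          (Polynomial.X : Polynomial (MvPolynomial σ K)) • (fun j => Polynomial.C (r j))) := by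
      ext1 i j
      by_cases hi : i = a
      · subst hi
        have := (h i j).mpr rfl
        simp [opt, opv, M, r, this]
      · have := mt (h i j).mp hi
        simp [opt, opv, M, this, Matrix.updateRow_ne hi]
    rw [this, Matrix.det_updateRow_add, Matrix.det_updateRow_smul, Matrix.updateRow_eq_self]
    have h2 : ∀ M' : Matrix (Fin N) (Fin N) (MvPolynomial σ K), _ := RingHom.map_det (Polynomial.C : MvPolynomial σ K →+* _)
    rw [← RingHom.mapMatrix_apply, ← h2]
    congr 2
    rw [h2, RingHom.mapMatrix_apply]
    congr 1
    ext i j : 2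
    by_cases hi : i = a
    · subst hi; simp
    · simp [Matrix.updateRow_ne hi]
  · rintro ⟨b, hb, hbj⟩
    refine Matrix.det_zero_of_row_eq hb ?_
    rw [Matrix.updateRow_ne hb, Matrix.updateRow_self]
    funext j
    simp [M, r, hbj]

lemma opt_det_le (T : Finset σ) (s : σ → σ) {N : ℕ} (y : Fin N → Fin N → σ) (a : Fin N)
    (h : ∀ i j, y i j ∈ T ↔ i = a) :
    (opt K T s (Matrix.det (Matrix.of fun i j => X (y i j)))).natDegree ≤ 1 := by
  obtain ⟨G, hG, -⟩ := opt_det_row (K := K) T s y a h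
  rw [hG]
  refine (Polynomial.natDegree_add_le _ _).trans ?_
  rw [Polynomial.natDegree_C]
  refine max_le (by omega) (Polynomial.natDegree_mul_le.trans ?_)
  rw [Polynomial.natDegree_C]
  exact (Nat.add_le_add_right Polynomial.natDegree_X_le 0)

lemma opt_det_le' (T : Finset σ) (s : σ → σ) {N : ℕ} (y : Fin N → Fin N → σ) (a b : Fin N)
    (hb : b ≠ a)  (h : ∀ i j, y i j ∈ T ↔ i = a) (hs : ∀ j, s (y a j) = y b j) :
    (opt K T s (Matrix.det (Matrix.of fun i j => X (y i j)))).natDegree ≤ 0 := by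
  obtain ⟨G, hG, hG2⟩ := opt_det_row (K := K) T s y a h
  rw [hG, hG2 ⟨b, hb, hs⟩]
  simp

end

variable {n m : ℕ}

/-- the weight function -/
def dlt (v : Fin m × Fin n × Fin n) : ℤ := (v.2.2.val : ℤ) - v.2.1.val - n * v.1.val

/-- row operation target -/
def rT (m : ℕ) (k : Fin n) : Finset (Fin m × Fin n × Fin n) := Finset.univ.filter fun v => v.2.1 = k
/-- row operation source -/
def rS (k' : Fin n) (v : Fin m × Fin n × Fin n) : Fin m × Fin n × Fin n := (v.1, k', v.2.2)
/-- column operation target -/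
def cT (m : ℕ) (k : Fin n) : Finset (Fin m × Fin n × Fin n) := Finset.univ.filter fun v => v.2.2 = k
/-- column operation source -/
def cS (k' : Fin n) (v : Fin m × Fin n × Fin n) : Fin m × Fin n × Fin n := (v.1, v.2.1, k')

lemma minor_case (l : Fin m) (r c N : ℕ) (hr : N + r ≤ n) (hc : N + c ≤ n)
    (hsurj : ∀ v : Fin m × Fin n × Fin n, dlt v = (c : ℤ) - r - n * l.val →
      v.1 = l ∧ ∃ i < N, v.2.1.val = i + r ∧ v.2.2.val = i + c) :
    ∃ F : MvPolynomial (Fin m × Fin n × Fin n) K, (∃ d, F.IsHomogeneous d) ∧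
      IsLow (fun v => dlt v ^ 2) F (levelE dlt ((c : ℤ) - r - n * l.val)) ∧
      (∀ k k' : Fin n, k ≠ k' → (opt K (rT m k) (rS k') F).natDegree ≤
        if (r ≤ k.val ∧ k.val < N + r) ∧ ¬ (r ≤ k'.val ∧ k'.val < N + r) then 1 else 0) ∧
      (∀ k k' : Fin n, k ≠ k' → (opt K (cT m k) (cS k') F).natDegree ≤
        if (c ≤ k.val ∧ k.val < N + c) ∧ ¬ (c ≤ k'.val ∧ k'.val < N + c) then 1 else 0) := by
  let y : Fin N → Fin N → Fin m × Fin n × Fin n :=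
    fun i j => (l, ⟨i.val + r, by omega⟩, ⟨j.val + c, by omega⟩)
  refine ⟨Matrix.det (Matrix.of fun i j => X (y i j)), ⟨Fintype.card (Fin N), ?_⟩, ?_, ?_, ?_⟩
  · rw [Matrix.det_apply']
    refine IsHomogeneous.sum _ _ _ fun π _ => ?_
    have h1 : (((Equiv.Perm.sign π : ℤ) : MvPolynomial (Fin m × Fin n × Fin n) K)).IsHomogeneous 0 := by
      rw [← map_intCast (C : K →+* MvPolynomial (Fin m × Fin n × Fin n) K)]
      exact isHomogeneous_C _ _
    have h2 := h1.mul (IsHomogeneous.prod (Finset.univ : Finset (Fin N))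
      (fun i => (X (y (π i) i) : MvPolynomial (Fin m × Fin n × Fin n) K)) (fun _ => 1)
      (fun i _ => isHomogeneous_X _ _))
    simpa using h2
  · rw [Matrix.det_apply']
    have := low_of_sum (K := K) dlt (E := Equiv.Perm (Fin N)) (fun π => ((Equiv.Perm.sign π : ℤ) : K))
      (fun π i => y (π i) i) ((c : ℤ) - r - n * l.val) ?_ 1 (by simp) ?_ ?_ ?_ ?_
    · convert this using 3 with π
      simp
      rfl
    · intro π _
      have h1 : ∀ i : Fin N, dlt (y (π i) i) = ((i.val : ℤ) - ((π i).val : ℤ)) + ((c : ℤ) - r - n * l.val) := by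
        intro i; simp only [dlt, y]; push_cast; ring
      simp only [h1]
      rw [Finset.sum_add_distrib, Finset.sum_sub_distrib,
        Equiv.sum_comp π (fun i : Fin N => (i.val : ℤ))]
      simp
      ring
    · intro i; simp only [dlt, y, Equiv.Perm.one_apply]; push_cast; ring
    · intro π _ h
      ext i
      have := h i
      simp only [dlt, y] at this
      push_cast at this
      simp only [Equiv.Perm.one_apply]
      omega
    · intro i j hij
      simp only [y, Prod.mk.injEq, Fin.mk.injEq] at hij
      exact Fin.ext (by omega)
    · intro v hv
      obtain ⟨h1, i, hi, h2, h3⟩ := hsurj v hv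
      refine ⟨⟨i, hi⟩, ?_⟩
      ext
      · simp [y, h1]
      · simp [y, h2]
      · simp [y, h3]
  · intro k k' hkk
    have hT : ∀ i j, y i j ∈ rT m k ↔ i.val + r = k.val := by
      intro i j; simp [rT, y, Fin.ext_iff]
    by_cases hk : r ≤ k.val ∧ k.val < N + r
    · have hT' : ∀ i j, y i j ∈ rT m k ↔ i = ⟨k.val - r, by omega⟩ := by
        intro i j; rw [hT, Fin.ext_iff]; simp only; omega
      by_cases hk' : r ≤ k'.val ∧ k'.val < N + r
      · rw [if_neg (by tauto)]
        refine opt_det_le' _ _ y _ ⟨k'.val - r, by omega⟩ ?_ hT' ?_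
        · intro h
          rw [Fin.mk.injEq] at h
          exact hkk (Fin.ext (by omega))
        · intro j
          simp only [rS, y]
          ext <;> simp; omega
      · rw [if_pos ⟨hk, hk'⟩]
        exact opt_det_le _ _ y _ hT'
    · rw [if_neg (by tauto)]
      apply opt_det_zero
      intro i j
      rw [hT]; omega
  · intro k k' hkk
    rw [← Matrix.det_transpose]
    change (opt K (cT m k) (cS k') (Matrix.det (Matrix.of fun i j => X (y j i)))).natDegree ≤ _
    have hT : ∀ i j, y j i ∈ cT m k ↔ i.val + c = k.val := by
      intro i j; simp [cT, y, Fin.ext_iff]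
    by_cases hk : c ≤ k.val ∧ k.val < N + c
    · have hT' : ∀ i j, y j i ∈ cT m k ↔ i = ⟨k.val - c, by omega⟩ := by
        intro i j; rw [hT, Fin.ext_iff]; simp only; omega
      by_cases hk' : c ≤ k'.val ∧ k'.val < N + c
      · rw [if_neg (by tauto)]
        refine opt_det_le' _ _ (fun i j => y j i) _ ⟨k'.val - c, by omega⟩ ?_ hT' ?_
        · intro h
          rw [Fin.mk.injEq] at h
          exact hkk (Fin.ext (by omega))
        · intro j
          simp only [cS, y]
          ext <;> simp; omega
      · rw [if_pos ⟨hk, hk'⟩]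
        exact opt_det_le _ _ (fun i j => y j i) _ hT'
    · rw [if_neg (by tauto)]
      apply opt_det_zero
      intro i j
      rw [hT]; omega

end Fac
end SI

open MvPolynomial Matrix
namespace SI

section Pen
variable {R R' : Type} [CommRing R] [CommRing R'] {n : ℕ}

/-- coefficient of a pencil determinant -/
noncomputable def pen (k : ℕ) (A B : Matrix (Fin n) (Fin n) R) : R :=
  ((A.map (Polynomial.C : R →+* Polynomial R) +
    (Polynomial.X : Polynomial R) • B.map (Polynomial.C : R →+* Polynomial R)).det).coeff k

lemma pen_map (φ : R →+* R') (k : ℕ) (A B : Matrix (Fin n) (Fin n) R) :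
    φ (pen k A B) = pen k (A.map φ) (B.map φ) := by
  unfold pen
  rw [← Polynomial.coeff_map, ← Polynomial.coe_mapRingHom, RingHom.map_det]
  congr 2
  ext1 i j
  simp

lemma pen_mul_left (k : ℕ) (P A B : Matrix (Fin n) (Fin n) R) (hP : P.det = 1) :
    pen k (P * A) (P * B) = pen k A B := by
  unfold pen
  have : (P * A).map (Polynomial.C : R →+* Polynomial R) +
      (Polynomial.X : Polynomial R) • (P * B).map (Polynomial.C : R →+* Polynomial R) =
      P.map (Polynomial.C : R →+* Polynomial R) * (A.map (Polynomial.C : R →+* Polynomial R) +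
        (Polynomial.X : Polynomial R) • B.map (Polynomial.C : R →+* Polynomial R)) := by
    rw [Matrix.map_mul, Matrix.map_mul, Matrix.mul_add, Matrix.mul_smul]
  rw [this, Matrix.det_mul, ← RingHom.mapMatrix_apply, ← RingHom.map_det, hP, map_one, one_mul]

lemma pen_mul_right (k : ℕ) (P A B : Matrix (Fin n) (Fin n) R) (hP : P.det = 1) :
    pen k (A * P) (B * P) = pen k A B := by
  unfold pen
  have : (A * P).map (Polynomial.C : R →+* Polynomial R) +
      (Polynomial.X : Polynomial R) • (B * P).map (Polynomial.C : R →+* Polynomial R) =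
      (A.map (Polynomial.C : R →+* Polynomial R) +
        (Polynomial.X : Polynomial R) • B.map (Polynomial.C : R →+* Polynomial R)) *
        P.map (Polynomial.C : R →+* Polynomial R) := by
    rw [Matrix.map_mul, Matrix.map_mul, Matrix.add_mul, Matrix.smul_mul]
  rw [this, Matrix.det_mul, ← RingHom.mapMatrix_apply (M := P), ← RingHom.map_det, hP, map_one, mul_one]

lemma pen_expand (k : ℕ) (A B : Matrix (Fin n) (Fin n) R) :
    pen k A B = ∑ e : Equiv.Perm (Fin n) × Finset (Fin n),
      (if e.2.card = k then ((Equiv.Perm.sign e.1 : ℤ) : R) else 0) *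
        ∏ i, (if i ∈ e.2 then B (e.1 i) i else A (e.1 i) i) := by
  unfold pen
  rw [Matrix.det_apply', Fintype.sum_prod_type, Polynomial.finset_sum_coeff]
  refine Finset.sum_congr rfl fun π _ => ?_
  simp only [Matrix.add_apply, Matrix.smul_apply, Matrix.map_apply, smul_eq_mul]
  have : ∏ i, (Polynomial.C (A (π i) i) + Polynomial.X * Polynomial.C (B (π i) i)) =
      ∑ T : Finset (Fin n), Polynomial.C (∏ i, (if i ∈ T then B (π i) i else A (π i) i)) *
        Polynomial.X ^ T.card := by
    simp_rw [add_comm (Polynomial.C (A _ _))]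
    rw [Finset.prod_add, Finset.powerset_univ]
    refine Finset.sum_congr rfl fun T _ => ?_
    rw [Finset.prod_mul_distrib, Finset.prod_const, Finset.prod_ite, map_mul, map_prod, map_prod]
    have e1 : Finset.univ.filter (fun i => i ∈ T) = T := by ext; simp
    have e2 : Finset.univ.filter (fun i => i ∉ T) = Finset.univ \ T := by ext; simp
    rw [e1, e2]; ring
  rw [this, ← Polynomial.C_eq_intCast, Polynomial.coeff_C_mul, Polynomial.finset_sum_coeff,
    Finset.mul_sum]
  refine Finset.sum_congr rfl fun T _ => ?_
  rw [Polynomial.coeff_C_mul, Polynomial.coeff_X_pow]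
  by_cases h : T.card = k
  · simp [h]
  · simp [h, Ne.symm h]

end Pen

section PC
variable {K : Type} [Field K] {n m : ℕ}

lemma opt_row_map (k k' : Fin n) (hk : k ≠ k') (l : Fin m) :
    (gX K n m l).map (opt K (rT m k) (rS k')) =
      transvection k k' Polynomial.X * (gX K n m l).map Polynomial.C := by
  ext1 i j
  by_cases h : i = k
  · subst h
    rw [Matrix.transvection_mul_apply_same]
    simp [opt, opv, gX, rT, rS]
  · rw [Matrix.transvection_mul_apply_of_ne _ _ _ _ h]
    simp [opt, opv, gX, rT, rS, h]

lemma opt_col_map (k k' : Fin n) (hk : k ≠ k') (l : Fin m) :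
    (gX K n m l).map (opt K (cT m k) (cS k')) =
      (gX K n m l).map Polynomial.C * transvection k' k Polynomial.X := by
  ext1 i j
  by_cases h : j = k
  · subst h
    rw [Matrix.mul_transvection_apply_same]
    simp [opt, opv, gX, cT, cS]
  · rw [Matrix.mul_transvection_apply_of_ne _ _ _ _ h]
    simp [opt, opv, gX, cT, cS, h]

lemma opt_row_pen (k1 k2 : Fin n) (hkk : k1 ≠ k2) (k : ℕ) (l0 l1 : Fin m) :
    opt K (rT m k1) (rS k2) (pen k (gX K n m l0) (gX K n m l1)) =
      Polynomial.C (pen k (gX K n m l0) (gX K n m l1)) := by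
  refine (pen_map (opt K (rT m k1) (rS k2)).toRingHom k (gX K n m l0) (gX K n m l1)).trans ?_
  refine Eq.trans ?_ (pen_map Polynomial.C k (gX K n m l0) (gX K n m l1)).symm
  refine Eq.trans ?_ (pen_mul_left k (transvection k1 k2 Polynomial.X) _ _
    (det_transvection_of_ne _ _ hkk _))
  exact congrArg₂ (pen k) (opt_row_map k1 k2 hkk l0) (opt_row_map k1 k2 hkk l1)

lemma opt_col_pen (k1 k2 : Fin n) (hkk : k1 ≠ k2) (k : ℕ) (l0 l1 : Fin m) :
    opt K (cT m k1) (cS k2) (pen k (gX K n m l0) (gX K n m l1)) =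
      Polynomial.C (pen k (gX K n m l0) (gX K n m l1)) := by
  refine (pen_map (opt K (cT m k1) (cS k2)).toRingHom k (gX K n m l0) (gX K n m l1)).trans ?_
  refine Eq.trans ?_ (pen_map Polynomial.C k (gX K n m l0) (gX K n m l1)).symm
  refine Eq.trans ?_ (pen_mul_right k (transvection k2 k1 Polynomial.X) _ _
    (det_transvection_of_ne _ _ hkk.symm _))
  exact congrArg₂ (pen k) (opt_col_map k1 k2 hkk l0) (opt_col_map k1 k2 hkk l1)

lemma pencil_case (l : ℕ) (hl : l + 1 < m) (k : ℕ) (hk : k < n) :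
    ∃ F : MvPolynomial (Fin m × Fin n × Fin n) K, (∃ d, F.IsHomogeneous d) ∧
      IsLow (fun v => dlt v ^ 2) F (levelE dlt (-(n * l + k : ℤ))) ∧
      (∀ k k' : Fin n, k ≠ k' → (opt K (rT m k) (rS k') F).natDegree ≤ 0) ∧
      (∀ k k' : Fin n, k ≠ k' → (opt K (cT m k) (cS k') F).natDegree ≤ 0) := by
  let l0 : Fin m := ⟨l, by omega⟩
  let l1 : Fin m := ⟨l+1, by omega⟩
  let y : Equiv.Perm (Fin n) × Finset (Fin n) → Fin n → Fin m × Fin n × Fin n :=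
    fun e i => (if i ∈ e.2 then l1 else l0, e.1 i, i)
  let c : Equiv.Perm (Fin n) × Finset (Fin n) → K :=
    fun e => if e.2.card = k then ((Equiv.Perm.sign e.1 : ℤ) : K) else 0
  have hF : pen k (gX K n m l0) (gX K n m l1) = ∑ e, C (c e) * ∏ i, X (y e i) := by
    rw [pen_expand]
    refine Finset.sum_congr rfl fun e _ => ?_
    congr 1
    · simp only [c]; split_ifs <;> simp
    · refine Finset.prod_congr rfl fun i _ => ?_
      simp only [y, gX]; split_ifs <;> rfl
  have hd : ∀ e i, dlt (y e i) = (i.val : ℤ) - (e.1 i).val - n * (l + if i ∈ e.2 then 1 else 0) := by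
    intro e i
    simp only [dlt, y]
    split_ifs <;> simp [l0, l1]
  have hsumall : ∀ e, ∑ i, dlt (y e i) = - (n * (n * l + e.2.card) : ℤ) := by
    intro e
    simp only [hd]
    rw [Finset.sum_sub_distrib, Finset.sum_sub_distrib,
        Equiv.sum_comp e.1 (fun i : Fin n => (i.val : ℤ)), ← Finset.mul_sum,
        Finset.sum_add_distrib, Finset.sum_boole]
    have e1 : Finset.univ.filter (fun i => i ∈ e.2) = e.2 := by ext; simp
    rw [e1]
    simp
  haveI : NeZero n := ⟨by omega⟩
  let e0 : Equiv.Perm (Fin n) × Finset (Fin n) :=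
    (Equiv.addRight ⟨k, hk⟩, Finset.univ.filter fun i => n ≤ i.val + k)
  have h0 : ∀ i, dlt (y e0 i) = -(n * l + k : ℤ) := by
    intro i
    rw [hd]
    have e1 : (e0.1 i).val = (i.val + k) % n := by simp [e0, Fin.val_add]
    rw [e1]
    have e2 : i ∈ e0.2 ↔ n ≤ i.val + k := by simp [e0]
    simp only [e2]
    split_ifs with h
    · rw [Nat.mod_eq_sub_mod h, Nat.mod_eq_of_lt (by omega)]
      push_cast [h]; ring
    · rw [Nat.mod_eq_of_lt (by omega)]
      push_cast; ring
  have hcard : e0.2.card = k := by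
    have h1 := hsumall e0
    simp only [h0] at h1
    simp at h1
    have : (n : ℤ) * (e0.2.card - k) = 0 := by linear_combination h1
    have hn0 : (n : ℤ) ≠ 0 := by omega
    have := (mul_eq_zero.mp this).resolve_left hn0
    omega
  refine ⟨pen k (gX K n m l0) (gX K n m l1), ⟨n, ?_⟩, ?_, ?_, ?_⟩
  · rw [hF]
    refine IsHomogeneous.sum _ _ _ fun e _ => ?_
    have h2 := (isHomogeneous_C (Fin m × Fin n × Fin n) (c e)).mul
      (IsHomogeneous.prod (Finset.univ : Finset (Fin n))
      (fun i => (X (y e i) : MvPolynomial (Fin m × Fin n × Fin n) K)) (fun _ => 1)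
      (fun i _ => isHomogeneous_X _ _))
    simpa using h2
  · rw [hF]
    refine low_of_sum dlt c y _ ?_ e0 ?_ h0 ?_ ?_ ?_
    · intro e he
      rw [hsumall]
      have : e.2.card = k := by by_contra h; exact he (by simp [c, h])
      rw [this]; ring
    · simp only [c, hcard, if_true]
      rcases Int.units_eq_one_or (Equiv.Perm.sign e0.1) with h | h <;> rw [h] <;> simp
    · intro e _ h
      have key : ∀ i, e.1 i = e0.1 i ∧ (i ∈ e.2 ↔ i ∈ e0.2) := by
        intro i
        have h1 := h i
        have h2 := h0 i
        rw [hd] at h1 h2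
        have b1 := (e.1 i).isLt
        have b2 := (e0.1 i).isLt
        by_cases c1 : i ∈ e.2 <;> by_cases c2 : i ∈ e0.2 <;>
          simp only [c1, c2, if_true, if_false, mul_add, mul_one, mul_zero] at h1 h2 ⊢ <;>
          (constructor <;> [(apply Fin.ext; omega); (first | trivial | omega)])
      exact Prod.ext (Equiv.ext fun i => (key i).1) (Finset.ext fun i => (key i).2)
    · intro i j hij
      simp only [y, Prod.mk.injEq] at hij
      exact hij.2.2
    · rintro ⟨a, b, j⟩ hv
      refine ⟨j, ?_⟩
      have h2 := h0 j
      rw [hd] at h2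
      simp only [dlt] at hv
      have b1 := (e0.1 j).isLt
      have b2 := b.isLt
      have b3 := j.isLt
      have hnp : (0 : ℤ) < n := by omega
      have b4 : (-n : ℤ) < n * ((a.val : ℤ) - l - if j ∈ e0.2 then 1 else 0) := by
        rw [mul_sub, mul_sub]; rw [mul_add] at h2; omega
      have b5 : n * ((a.val : ℤ) - l - if j ∈ e0.2 then 1 else 0) < (n : ℤ) := by
        rw [mul_sub, mul_sub]; rw [mul_add] at h2; omega
      have b6 : ((a.val : ℤ) - l - if j ∈ e0.2 then 1 else 0) = 0 := by
        set z := ((a.val : ℤ) - l - if j ∈ e0.2 then 1 else 0)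
        have : z < 1 := by nlinarith
        have : -1 < z := by nlinarith
        omega
      have b7 : (a.val : ℤ) = l + if j ∈ e0.2 then 1 else 0 := by omega
      have b8 : e0.1 j = b := by
        apply Fin.ext
        rw [b7] at hv
        omega
      simp only [y, b8, Prod.mk.injEq, and_true]
      apply Fin.ext
      by_cases c2 : j ∈ e0.2 <;> simp only [c2, if_true, if_false] at b7 ⊢ <;> simp [l0, l1] <;> omega
  · intro k1 k2 hkk
    rw [opt_row_pen _ _ hkk, Polynomial.natDegree_C]
  · intro k1 k2 hkk
    rw [opt_col_pen _ _ hkk, Polynomial.natDegree_C]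
end PC
end SI

open MvPolynomial Matrix
namespace SI
section FF
variable {K : Type} [Field K] {n m : ℕ}

lemma factor (hm : 1 ≤ m) (D : ℤ) (hD1 : -(n * (m - 1) + (n - 1) : ℤ) ≤ D) (hD2 : D ≤ n - 1) :
    ∃ F : MvPolynomial (Fin m × Fin n × Fin n) K, (∃ d, F.IsHomogeneous d) ∧
      IsLow (fun v => dlt v ^ 2) F (levelE dlt D) ∧
      (∀ k k' : Fin n, (k.val + 1 = k'.val ∨ k'.val + 1 = k.val) →
        (opt K (rT m k) (rS k') F).natDegree ≤
          if D = (if k.val + 1 = k'.val then (n - k.val - 1 : ℤ) else -(n * (m - 1) + k.val : ℤ))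
            then 1 else 0) ∧
      (∀ k k' : Fin n, (k.val + 1 = k'.val ∨ k'.val + 1 = k.val) →
        (opt K (cT m k) (cS k') F).natDegree ≤
          if D = (if k'.val + 1 = k.val then (k.val : ℤ)
            else -(n * (m - 1) + (n - k.val - 1) : ℤ)) then 1 else 0) := by
  have hn : 0 ≤ (n : ℤ) := by omega
  rcases lt_or_ge 0 D with h1 | h1
  · lift D to ℕ using h1.le
    obtain ⟨F, hF, hlow, hr, hc⟩ := minor_case (K := K) (n := n) (⟨0, by omega⟩ : Fin m) 0 D (n - D)
      (by omega) (by omega) (by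
        rintro ⟨a, b, j⟩ hv
        simp only [dlt] at hv
        simp at hv
        have : a.val = 0 := by
          by_contra h
          have : (n : ℤ) * 1 ≤ n * a.val := mul_le_mul_of_nonneg_left (by omega) hn
          omega
        have h3 : (a.val : ℤ) = 0 := by omega
        rw [h3] at hv
        refine ⟨Fin.ext (by simpa using this), b.val, ?_⟩
        simp only
        omega)
    refine ⟨F, hF, by simpa using hlow, ?_, ?_⟩
    · intro k k' hkk
      refine (hr k k' (by rintro rfl; omega)).trans ?_
      have := k'.isLt
      split_ifs <;> omega
    · intro k k' hkk
      refine (hc k k' (by rintro rfl; omega)).trans ?_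
      have := k'.isLt
      split_ifs <;> omega
  rcases le_or_gt D (-(n * (m - 1) : ℤ)) with h2 | h2
  · obtain ⟨e, he⟩ : ∃ e : ℕ, D = -(n * (m-1) : ℤ) - e := ⟨(-(n * (m-1) : ℤ) - D).toNat, by omega⟩
    obtain ⟨F, hF, hlow, hr, hc⟩ := minor_case (K := K) (n := n) (⟨m - 1, by omega⟩ : Fin m) e 0 (n - e)
      (by omega) (by omega) (by
        rintro ⟨a, b, j⟩ hv
        simp only [dlt] at hv
        have hm' : ((m - 1 : ℕ) : ℤ) = (m : ℤ) - 1 := by omega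
        rw [hm'] at hv
        have := a.isLt
        have := b.isLt
        have := j.isLt
        have h4 : a.val = m - 1 := by
          by_contra h
          have : (n : ℤ) * (a.val + 1) ≤ n * (m - 1) := mul_le_mul_of_nonneg_left (by omega) hn
          rw [mul_add] at this
          omega
        have h3 : (a.val : ℤ) = m - 1 := by omega
        rw [h3] at hv
        refine ⟨Fin.ext h4, j.val, ?_⟩
        simp only
        omega)
    have hm' : ((m - 1 : ℕ) : ℤ) = (m : ℤ) - 1 := by omega
    refine ⟨F, hF, ?_, ?_, ?_⟩
    · convert hlow using 2
      rw [he]; simp only [hm']; push_cast; ring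
    · intro k k' hkk
      refine (hr k k' (by rintro rfl; omega)).trans ?_
      have := k'.isLt
      have hnm : 0 ≤ (n * (m - 1) : ℤ) := mul_nonneg hn (by omega)
      split_ifs <;> omega
    · intro k k' hkk
      refine (hc k k' (by rintro rfl; omega)).trans ?_
      have := k'.isLt
      have hnm : 0 ≤ (n * (m - 1) : ℤ) := mul_nonneg hn (by omega)
      split_ifs <;> omega
  · obtain ⟨E, rfl⟩ : ∃ E : ℕ, D = -(E : ℤ) := ⟨(-D).toNat, by omega⟩
    have hn0 : 0 < n := by
      rcases Nat.eq_zero_or_pos n with h | h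
      · subst h; simp at h2 hD2; omega
      · exact h
    have hdm := Nat.div_add_mod E n
    have hEm : E / n + 1 < m := by
      have : E < n * (m - 1) := by
        have hm' : ((m - 1 : ℕ) : ℤ) = (m : ℤ) - 1 := by omega
        zify; rw [hm']; omega
      have := (Nat.div_lt_iff_lt_mul hn0).mpr (by rwa [mul_comm] at this)
      omega
    obtain ⟨F, hF, hlow, hr, hc⟩ := pencil_case (K := K) (n := n) (E / n) hEm (E % n) (Nat.mod_lt _ hn0)
    refine ⟨F, hF, ?_, ?_, ?_⟩
    · convert hlow using 2
      rw [neg_inj]; exact_mod_cast hdm.symm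
    · intro k k' hkk
      exact (hr k k' (by rintro rfl; omega)).trans (Nat.zero_le _)
    · intro k k' hkk
      exact (hc k k' (by rintro rfl; omega)).trans (Nat.zero_le _)

lemma prod_deg (s : Finset ℤ) (T : Finset (Fin m × Fin n × Fin n))
    (S : Fin m × Fin n × Fin n → Fin m × Fin n × Fin n)
    (F : ℤ → MvPolynomial (Fin m × Fin n × Fin n) K) (D0 : ℤ)
    (h : ∀ D ∈ s, (opt K T S (F D)).natDegree ≤ if D = D0 then 1 else 0) :
    (opt K T S (∏ D ∈ s, F D)).natDegree ≤ 1 := by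
  rw [map_prod]
  refine (Polynomial.natDegree_prod_le _ _).trans ?_
  refine (Finset.sum_le_sum h).trans ?_
  rw [Finset.sum_ite_eq']
  split_ifs <;> omega

lemma exists_H (n : ℕ) (hm : 1 ≤ m) :
    ∃ H : MvPolynomial (Fin m × Fin n × Fin n) K, (∃ d, H.IsHomogeneous d) ∧
      IsLow (fun v => dlt v ^ 2) H (Finsupp.equivFunOnFinite.symm fun _ => 1) ∧
      (∀ k k' : Fin n, (k.val + 1 = k'.val ∨ k'.val + 1 = k.val) →
        (opt K (rT m k) (rS k') H).natDegree ≤ 1) ∧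
      (∀ k k' : Fin n, (k.val + 1 = k'.val ∨ k'.val + 1 = k.val) →
        (opt K (cT m k) (cS k') H).natDegree ≤ 1) := by
  let I : Finset ℤ := Finset.Icc (-(n * (m - 1) + (n - 1) : ℤ)) (n - 1)
  have hex : ∀ D : ℤ, ∃ F : MvPolynomial (Fin m × Fin n × Fin n) K, D ∈ I → (∃ d, F.IsHomogeneous d) ∧
      IsLow (fun v => dlt v ^ 2) F (levelE dlt D) ∧
      (∀ k k' : Fin n, (k.val + 1 = k'.val ∨ k'.val + 1 = k.val) →
        (opt K (rT m k) (rS k') F).natDegree ≤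
          if D = (if k.val + 1 = k'.val then (n - k.val - 1 : ℤ) else -(n * (m - 1) + k.val : ℤ))
            then 1 else 0) ∧
      (∀ k k' : Fin n, (k.val + 1 = k'.val ∨ k'.val + 1 = k.val) →
        (opt K (cT m k) (cS k') F).natDegree ≤
          if D = (if k'.val + 1 = k.val then (k.val : ℤ)
            else -(n * (m - 1) + (n - k.val - 1) : ℤ)) then 1 else 0) := by
    intro D
    by_cases hD : D ∈ I
    · have hD' := Finset.mem_Icc.mp hD
      obtain ⟨F, hF⟩ := factor (K := K) hm D hD'.1 hD'.2
      exact ⟨F, fun _ => hF⟩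
    · exact ⟨0, fun h => absurd h hD⟩
  choose F hF using hex
  refine ⟨∏ D ∈ I, F D, ?_, ?_, ?_, ?_⟩
  · have : ∀ D, ∃ d, D ∈ I → (F D).IsHomogeneous d := by
      intro D
      by_cases hD : D ∈ I
      · obtain ⟨d, hd⟩ := (hF D hD).1
        exact ⟨d, fun _ => hd⟩
      · exact ⟨0, fun h => absurd h hD⟩
    choose d hd using this
    exact ⟨_, IsHomogeneous.prod I F d hd⟩
  · have := IsLow.prod I F (levelE dlt) (fun D hD => (hF D hD).2.1)
    convert this using 1
    ext v
    rw [Finsupp.finset_sum_apply]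
    simp only [levelE_apply, Finsupp.equivFunOnFinite_symm_apply_apply]
    rw [Finset.sum_ite_eq, if_pos]
    rw [Finset.mem_Icc]
    obtain ⟨a, b, j⟩ := v
    simp only [dlt]
    have := a.isLt
    have := b.isLt
    have := j.isLt
    have h1 : (n : ℤ) * a.val ≤ n * (m - 1) := mul_le_mul_of_nonneg_left (by omega) (by omega)
    have h2 : 0 ≤ (n : ℤ) * a.val := by positivity
    constructor <;> omega
  · intro k k' hkk
    exact prod_deg I _ _ F _ fun D hD => (hF D hD).2.2.1 k k' hkk
  · intro k k' hkk
    exact prod_deg I _ _ F _ fun D hD => (hF D hD).2.2.2 k k' hkk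

end FF
end SI

open MvPolynomial Matrix
namespace SI
section FP
variable {K : Type} [Field K] {n m : ℕ}

lemma opu_row (k k' : Fin n) (u : K) (f : MvPolynomial (Fin m × Fin n × Fin n) K) :
    opu (rT m k) (rS k') u f = ev (fun l => (transvection k k' u).map C * gX K n m l) f := by
  unfold opu ev
  congr 2
  funext v
  obtain ⟨l, i, j⟩ := v
  have : (transvection k k' u).map (C : K →+* MvPolynomial (Fin m × Fin n × Fin n) K) =
      transvection k k' (C u) := by
    ext1 a b
    simp [transvection, Matrix.single_apply, Matrix.one_apply]
    split_ifs <;> simp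
  simp only [this]
  by_cases h : i = k
  · subst h
    rw [Matrix.transvection_mul_apply_same]
    simp [opv, gX, rT, rS]
  · rw [Matrix.transvection_mul_apply_of_ne _ _ _ _ h]
    simp [opv, gX, rT, rS, h]

lemma opu_col (k k' : Fin n) (u : K) (f : MvPolynomial (Fin m × Fin n × Fin n) K) :
    opu (cT m k) (cS k') u f = ev (fun l => gX K n m l * (transvection k' k u).map C) f := by
  unfold opu ev
  congr 2
  funext v
  obtain ⟨l, i, j⟩ := v
  have : (transvection k' k u).map (C : K →+* MvPolynomial (Fin m × Fin n × Fin n) K) =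
      transvection k' k (C u) := by
    ext1 a b
    simp [transvection, Matrix.single_apply, Matrix.one_apply]
    split_ifs <;> simp
  simp only [this]
  by_cases h : j = k
  · subst h
    rw [Matrix.mul_transvection_apply_same]
    simp [opv, gX, cT, cS]
  · rw [Matrix.mul_transvection_apply_of_ne _ _ _ _ h]
    simp [opv, gX, cT, cS, h]

lemma map_C_ev (φ : MvPolynomial (Fin m × Fin n × Fin n) K →ₐ[K] MvPolynomial (Fin m × Fin n × Fin n) K)
    (A : Matrix (Fin n) (Fin n) K) : (A.map C).map φ = A.map C := by
  ext1 i j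
  simp only [Matrix.map_apply]
  exact φ.commutes _

lemma inv_of_ops [Infinite K] (f : MvPolynomial (Fin m × Fin n × Fin n) K)
    (hr : ∀ k k' : Fin n, (k.val + 1 = k'.val ∨ k'.val + 1 = k.val) → ∀ u : K,
      opu (rT m k) (rS k') u f = f)
    (hc : ∀ k k' : Fin n, (k.val + 1 = k'.val ∨ k'.val + 1 = k.val) → ∀ u : K,
      opu (cT m k) (cS k') u f = f) : f ∈ matrixSemiInvariants K n m := by
  rw [mem_iff_gX]
  have hL : ∀ A : Matrix (Fin n) (Fin n) K, A.det = 1 →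
      ev (fun l => A.map C * gX K n m l) f = f := by
    refine sl_gen (fun A => ev (fun l => A.map C * gX K n m l) f = f) ?_ ?_ ?_
    · have : (1 : Matrix (Fin n) (Fin n) K).map (C : K →+* MvPolynomial (Fin m × Fin n × Fin n) K) = 1 :=
        Matrix.map_one _ (map_zero _) (map_one _)
      simp only [this, one_mul, ev_gX]
    · intro A B hA hB
      have := ev_comp (ev (fun l => B.map C * gX K n m l)) (fun l => A.map C * gX K n m l) f
      rw [hA, hB] at this
      refine Eq.trans ?_ this.symm
      congr 2
      funext l
      rw [← AlgHom.coe_toRingHom, Matrix.map_mul, Matrix.map_mul, AlgHom.coe_toRingHom, ev_gX_map,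
        map_C_ev, mul_assoc]
    · intro k k' h c
      rw [← opu_row]; exact hr k k' h c
  have hR : ∀ A : Matrix (Fin n) (Fin n) K, A.det = 1 →
      ev (fun l => gX K n m l * A.map C) f = f := by
    refine sl_gen (fun A => ev (fun l => gX K n m l * A.map C) f = f) ?_ ?_ ?_
    · have : (1 : Matrix (Fin n) (Fin n) K).map (C : K →+* MvPolynomial (Fin m × Fin n × Fin n) K) = 1 :=
        Matrix.map_one _ (map_zero _) (map_one _)
      simp only [this, mul_one, ev_gX]
    · intro A B hA hB
      have := ev_comp (ev (fun l => gX K n m l * A.map C)) (fun l => gX K n m l * B.map C) f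
      rw [hB, hA] at this
      refine Eq.trans ?_ this.symm
      congr 2
      funext l
      rw [← AlgHom.coe_toRingHom, Matrix.map_mul, Matrix.map_mul, AlgHom.coe_toRingHom, ev_gX_map,
        map_C_ev, mul_assoc]
    · intro k k' h c
      rw [← opu_col]; exact hc k' k h.symm c
  intro A B hA hB
  have := ev_comp (ev (fun l => gX K n m l * B.map C)) (fun l => A.map C * gX K n m l) f
  rw [hL A hA, hR B hB] at this
  refine Eq.trans ?_ this.symm
  congr 2
  funext l
  rw [← AlgHom.coe_toRingHom, Matrix.map_mul, AlgHom.coe_toRingHom, ev_gX_map,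
    map_C_ev, mul_assoc]

lemma ops_of_inv [Infinite K] (f : MvPolynomial (Fin m × Fin n × Fin n) K)
    (hf : f ∈ matrixSemiInvariants K n m) (k k' : Fin n)
    (hk : k.val + 1 = k'.val ∨ k'.val + 1 = k.val) (u : K) :
      opu (rT m k) (rS k') u f = f ∧ opu (cT m k) (cS k') u f = f := by
  rw [mem_iff_gX] at hf
  have hne : k ≠ k' := by rintro rfl; omega
  have h1 : (1 : Matrix (Fin n) (Fin n) K).map (C : K →+* MvPolynomial (Fin m × Fin n × Fin n) K) = 1 :=
        Matrix.map_one _ (map_zero _) (map_one _)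
  constructor
  · rw [opu_row]
    have := hf (transvection k k' u) 1 (det_transvection_of_ne _ _ hne _) (by simp)
    simpa only [h1, mul_one] using this
  · rw [opu_col]
    have := hf 1 (transvection k' k u) (by simp) (det_transvection_of_ne _ _ hne.symm _)
    simpa only [h1, one_mul] using this

lemma car_mem (p : ℕ) [Fact p.Prime] [ExpChar K p] [PerfectRing K p] [Infinite K] 
    (H r : MvPolynomial (Fin m × Fin n × Fin n) K)
    (hHr : ∀ k k' : Fin n, (k.val + 1 = k'.val ∨ k'.val + 1 = k.val) →
        (opt K (rT m k) (rS k') H).natDegree ≤ 1)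
    (hHc : ∀ k k' : Fin n, (k.val + 1 = k'.val ∨ k'.val + 1 = k.val) →
        (opt K (cT m k) (cS k') H).natDegree ≤ 1)
    (hr : r ∈ matrixSemiInvariants K n m) : car p (H ^ (p - 1) * r) ∈ matrixSemiInvariants K n m := by
  refine inv_of_ops _ ?_ ?_
  · intro k k' h u
    refine car_inv p _ _ ?_ H r (hHr k k' h) (fun u => (ops_of_inv r hr k k' h u).1) u
    intro v hv
    simp only [rT, rS, Finset.mem_filter, Finset.mem_univ, true_and]
    rintro rfl; omega
  · intro k k' h u
    refine car_inv p _ _ ?_ H r (hHc k k' h) (fun u => (ops_of_inv r hr k k' h u).2) u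
    intro v hv
    simp only [cT, cS, Finset.mem_filter, Finset.mem_univ, true_and]
    rintro rfl; omega

lemma car_H (p : ℕ) [hp : Fact p.Prime] [ExpChar K p] [PerfectRing K p]
    (H : MvPolynomial (Fin m × Fin n × Fin n) K) (hd : ∃ d, H.IsHomogeneous d)
    (hlow : IsLow (fun v => dlt v ^ 2) H (Finsupp.equivFunOnFinite.symm fun _ => 1)) :
    ∃ c : K, c ≠ 0 ∧ car p (H ^ (p - 1)) = C c := by
  obtain ⟨d, hd⟩ := hd
  have hp1 := hp.out.one_lt
  have hl := hlow.pow (p - 1)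
  have e1 : (p - 1) • (Finsupp.equivFunOnFinite.symm fun _ => 1) = topE (Fin m × Fin n × Fin n) p := by
    ext v; simp
  rw [e1] at hl
  have hh := hd.pow (p - 1)
  refine ⟨coeff 0 (car p (H ^ (p - 1))), ?_, ?_⟩
  · rw [coeff_car]
    simpa using hl.1
  · ext b
    rw [coeff_C]
    split_ifs with h
    · rw [h]
    · rw [coeff_car]
      by_contra hne
      have h1 : coeff (p • b + topE _ p) (H ^ (p - 1)) ≠ 0 := by
        intro h0; exact hne (by rw [h0]; simp)
      have d1 := hh h1
      have d2 := hh hl.1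
      have : Finsupp.weight (1 : (Fin m × Fin n × Fin n) → ℕ) (p • b) = 0 := by
        rw [map_add] at d1; omega
      rw [map_nsmul, smul_eq_mul] at this
      have hb := (Nat.mul_eq_zero.mp this).resolve_left (by omega)
      apply h
      symm
      have : b.degree = 0 := by rw [Finsupp.degree_eq_weight_one]; exact hb
      exact (Finsupp.degree_eq_zero_iff b).mp this

/-- F-purity -/
theorem fpure (p : ℕ) [hp : Fact p.Prime] [CharP K p] [IsAlgClosed K] (hm : 1 ≤ m)
    {ι : Type} (s : Finset ι) (g : MvPolynomial (Fin m × Fin n × Fin n) K)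
    (f r : ι → MvPolynomial (Fin m × Fin n × Fin n) K)
    (hr : ∀ i ∈ s, r i ∈ matrixSemiInvariants K n m)
    (h : g ^ p = ∑ i ∈ s, f i ^ p * r i) :
    ∃ r' : ι → MvPolynomial (Fin m × Fin n × Fin n) K,
      (∀ i, r' i ∈ matrixSemiInvariants K n m) ∧ g = ∑ i ∈ s, f i * r' i := by
  classical
  haveI : ExpChar K p := ExpChar.prime hp.out
  haveI : Infinite K := IsAlgClosed.instInfinite
  obtain ⟨H, hd, hlow, hHr, hHc⟩ := exists_H (K := K) n hm
  obtain ⟨c, hc0, hc⟩ := car_H p H hd hlow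
  refine ⟨fun i => if i ∈ s then C c⁻¹ * car p (H ^ (p - 1) * r i) else 0, ?_, ?_⟩
  · intro i
    beta_reduce
    split_ifs with hi
    · exact Subalgebra.mul_mem _ (Subalgebra.algebraMap_mem _ c⁻¹) (car_mem p H _ hHr hHc (hr i hi))
    · exact Subalgebra.zero_mem _
  · have h1 : car p (g ^ p * H ^ (p - 1)) = g * C c := by rw [car_pow_mul, hc]
    rw [h, Finset.sum_mul, car_sum] at h1
    have h2 : g = C c⁻¹ * (g * C c) := by
      rw [mul_comm g, ← mul_assoc, ← C_mul, inv_mul_cancel₀ hc0, C_1, one_mul]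
    rw [h2, ← h1, Finset.mul_sum]
    refine Finset.sum_congr rfl fun i hi => ?_
    beta_reduce
    rw [if_pos hi, mul_assoc, car_pow_mul, mul_comm (r i)]
    ring

theorem fpure_pow (p : ℕ) [hp : Fact p.Prime] [CharP K p] [IsAlgClosed K] (hm : 1 ≤ m)
    {ι : Type} (s : Finset ι) (g : MvPolynomial (Fin m × Fin n × Fin n) K)
    (f : ι → MvPolynomial (Fin m × Fin n × Fin n) K) (e : ℕ) :
    ∀ (r : ι → MvPolynomial (Fin m × Fin n × Fin n) K),
    (∀ i, r i ∈ matrixSemiInvariants K n m) →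
    g ^ p ^ e = ∑ i ∈ s, f i ^ p ^ e * r i →
    ∃ r' : ι → MvPolynomial (Fin m × Fin n × Fin n) K,
      (∀ i, r' i ∈ matrixSemiInvariants K n m) ∧ g = ∑ i ∈ s, f i * r' i := by
  induction e with
  | zero => intro r hr h; exact ⟨r, hr, by simpa using h⟩
  | succ e ih =>
    intro r hr h
    obtain ⟨r', hr', h'⟩ := fpure p hm s (g ^ p ^ e) (fun i => f i ^ p ^ e) r (fun i _ => hr i)
      (by simpa only [pow_succ, pow_mul] using h)
    exact ih r' hr' h'

end FP
end SI

open MvPolynomial Matrix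
namespace SI
section DV

lemma val_of_not_int {A L : Type} [CommRing A] [Field L] [Algebra A L] (g : L)
    (h : ¬ IsIntegral A g) :
    ∃ O : ValuationSubring L, (∀ a : A, algebraMap A L a ∈ O) ∧ g ∉ O := by
  by_contra hcon
  push Not at hcon
  apply h
  have h1 : g ∈ ⨅ V : {V : ValuationSubring L // Set.range (algebraMap A L) ⊆ V.toSubring}, V.1.toSubring := by
    rw [Subring.mem_iInf]
    rintro ⟨V, hV⟩
    exact hcon V fun a => hV ⟨a, rfl⟩
  rw [iInf_valuationSubring_superset] at h1
  have h2 : IsIntegral (Subring.closure (Set.range (algebraMap A L))) g := h1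
  have h3 : Subring.closure (Set.range (algebraMap A L)) = (algebraMap A L).range := by
    rw [← RingHom.coe_range, Subring.closure_eq]
  rw [h3] at h2
  obtain ⟨q, hq, he⟩ := h2
  have hl : q ∈ Polynomial.lifts (algebraMap A L).rangeRestrict := by
    rw [Polynomial.lifts_iff_coeff_lifts]
    intro k
    obtain ⟨a, ha⟩ := (q.coeff k).2
    exact ⟨a, Subtype.ext ha⟩
  obtain ⟨q', hq', -, hm⟩ := Polynomial.lifts_and_degree_eq_and_monic hl hq
  refine ⟨q', hm, ?_⟩
  rw [← hq', Polynomial.eval₂_map] at he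
  exact he

lemma val_int {A L : Type} [CommRing A] [Field L] [Algebra A L] (O : ValuationSubring L)
    (hA : ∀ a : A, algebraMap A L a ∈ O) (x : L) (hx : IsIntegral A x) : x ∈ O := by
  let f : A →+* O := (algebraMap A L).codRestrict O.toSubring hA
  have : IsIntegral O x := by
    obtain ⟨q, hq, he⟩ := hx
    refine ⟨q.map f, hq.map f, ?_⟩
    rw [Polynomial.eval₂_map]; exact he
  obtain ⟨y, hy⟩ := IsIntegrallyClosed.isIntegral_iff.mp this
  rw [← hy]; exact y.2

lemma dv2 {P L : Type} [CommRing P] [IsDomain P] [UniqueFactorizationMonoid P] [Field L]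
    [Algebra P L] [Algebra (FractionRing P) L] [IsScalarTower P (FractionRing P) L]
    [FiniteDimensional (FractionRing P) L] (g : L) (hg : ¬ IsIntegral P g) (hgi : IsIntegral P g⁻¹) :
    ∃ (O : ValuationSubring L) (ν : L → ℤ), (∀ a : P, algebraMap P L a ∈ O) ∧ g ∉ O ∧
      ∀ x y : L, x ≠ 0 → y ≠ 0 → (O.valuation x ≤ O.valuation y ↔ ν y ≤ ν x) := by
  classical
  set F := FractionRing P with hF
  have hinj : Function.Injective (algebraMap P L) := by
    rw [IsScalarTower.algebraMap_eq P F L]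
    exact (algebraMap F L).injective.comp (IsFractionRing.injective P F)
  have hg0 : g ≠ 0 := by rintro rfl; exact hg isIntegral_zero
  haveI : FaithfulSMul P L := (faithfulSMul_iff_algebraMap_injective P L).mpr hinj
  have hmin : minpoly F g⁻¹ = (minpoly P g⁻¹).map (algebraMap P F) :=
    minpoly.isIntegrallyClosed_eq_field_fractions F L hgi
  set c0 := (minpoly P g⁻¹).coeff 0 with hc0
  have hc0ne : c0 ≠ 0 := by
    have := minpoly.coeff_zero_ne_zero (A := F) (x := g⁻¹) (hgi.tower_top) (inv_ne_zero hg0)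
    rw [hmin, Polynomial.coeff_map] at this
    intro h; apply this; rw [← hc0, h, map_zero]
  have hc0u : ¬ IsUnit c0 := by
    intro hu
    apply hg
    obtain ⟨w, hw⟩ := hu.exists_right_inv
    have h1 := minpoly.aeval P g⁻¹
    rw [← Polynomial.divX_mul_X_add (minpoly P g⁻¹)] at h1
    simp only [map_add, map_mul, Polynomial.aeval_X, Polynomial.aeval_C] at h1
    rw [← hc0] at h1
    set z := Polynomial.aeval g⁻¹ (minpoly P g⁻¹).divX with hz
    have h2 : g = - z * algebraMap P L w := by
      have h3 : algebraMap P L c0 * algebraMap P L w = 1 := by rw [← map_mul, hw, map_one]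
      have h4 : z = - algebraMap P L c0 * g := by
        field_simp at h1
        linear_combination h1
      rw [h4]; linear_combination (- g) * h3
    rw [h2]
    have hzi : IsIntegral P z := by
      have : z ∈ Algebra.adjoin P {g⁻¹} := by
        rw [hz]; exact Polynomial.aeval_mem_adjoin_singleton _ _
      exact (Algebra.IsIntegral.adjoin (by simpa using hgi) : Algebra.IsIntegral P (Algebra.adjoin P {g⁻¹})).isIntegral ⟨z, this⟩ |>.map (Subalgebra.val _)
    exact hzi.neg.mul isIntegral_algebraMap
  obtain ⟨π, hπ, hπc⟩ := WfDvdMonoid.exists_irreducible_factor hc0u hc0ne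
  have hπp : Prime π := hπ.prime
  have key : ∀ b : P, IsIntegral P (algebraMap P L b * g) → π ∣ b := by
    intro b hb
    let E := IntermediateField.adjoin F {g⁻¹}
    let γ : E := IntermediateField.AdjoinSimple.gen F g⁻¹
    have hγ : algebraMap E L γ = g⁻¹ := IntermediateField.AdjoinSimple.algebraMap_gen F g⁻¹
    have hγ0 : γ ≠ 0 := by
      intro h; rw [h, map_zero] at hγ; exact inv_ne_zero hg0 hγ.symm
    have hint : IsIntegral F g⁻¹ := hgi.tower_top
    have hn : Algebra.norm F γ = (-1) ^ (minpoly F g⁻¹).natDegree * algebraMap P F c0 := by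
      have := Algebra.PowerBasis.norm_gen_eq_coeff_zero_minpoly (IntermediateField.adjoin.powerBasis hint)
      rw [IntermediateField.adjoin.powerBasis_gen] at this
      rw [this, IntermediateField.minpoly_gen, IntermediateField.adjoin.powerBasis_dim, hmin,
        Polynomial.coeff_map]
    have hb2 : IsIntegral P (algebraMap F E (algebraMap P F b) * γ⁻¹) := by
      haveI : IsScalarTower P E L := by
        refine IsScalarTower.of_algebraMap_eq fun a => ?_
        rw [IsScalarTower.algebraMap_apply P F L, IsScalarTower.algebraMap_apply P F E]; rfl
      rw [← isIntegral_algebraMap_iff (algebraMap E L).injective]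
      rw [map_mul, map_inv₀, hγ, inv_inv, ← IsScalarTower.algebraMap_apply F E L,
        ← IsScalarTower.algebraMap_apply P F L]
      exact hb
    have hni := Algebra.isIntegral_norm F hb2
    obtain ⟨z, hz⟩ := IsIntegrallyClosed.isIntegral_iff.mp hni
    have h1 : algebraMap P F z * Algebra.norm F γ = (algebraMap P F b) ^ Module.finrank F E := by
      rw [hz, ← map_mul, mul_assoc, inv_mul_cancel₀ hγ0, mul_one, Algebra.norm_algebraMap]
    rw [hn] at h1
    have h2 : z * ((-1) ^ (minpoly F g⁻¹).natDegree * c0) = b ^ Module.finrank F E := by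
      apply IsFractionRing.injective P F
      simpa using h1
    refine hπp.dvd_of_dvd_pow (n := Module.finrank F E) ?_
    rw [← h2]
    exact Dvd.dvd.mul_left (Dvd.dvd.mul_left hπc _) _
  haveI hprime : (Ideal.span {π}).IsPrime := (Ideal.span_singleton_prime hπp.ne_zero).mpr hπp
  let M := (Ideal.span {π}).primeCompl
  have hM : ∀ b, b ∈ M ↔ ¬ π ∣ b := fun b => by
    change b ∉ Ideal.span {π} ↔ _
    rw [Ideal.mem_span_singleton]
  let Lp := Localization.AtPrime (Ideal.span {π})
  let f : Lp →+* L := IsLocalization.lift (M := M) (g := algebraMap P L) (by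
    rintro ⟨b, hb⟩
    rw [hM] at hb
    refine IsUnit.mk0 _ fun h => hb ?_
    rw [← map_zero (algebraMap P L)] at h
    have h' : b = 0 := hinj h
    rw [h']; exact dvd_zero _)
  letI : Algebra Lp L := f.toAlgebra
  haveI : IsScalarTower P Lp L := IsScalarTower.of_algebraMap_eq fun a =>
    (IsLocalization.lift_eq _ a).symm
  have hgL : ¬ IsIntegral Lp g := by
    intro h
    obtain ⟨⟨b, hb⟩, hbi⟩ := IsIntegral.exists_multiple_integral_of_isLocalization M g h
    rw [Submonoid.smul_def, Algebra.smul_def] at hbi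
    exact (hM b).mp hb (key b hbi)
  obtain ⟨O, hO, hgO⟩ := val_of_not_int g hgL
  have hOP : ∀ a : P, algebraMap P L a ∈ O := fun a => by
    rw [IsScalarTower.algebraMap_apply P Lp L]; exact hO _
  set v := O.valuation with hv
  have hv1 : ∀ b : P, ¬ π ∣ b → v (algebraMap P L b) = 1 := by
    intro b hb
    apply le_antisymm ((O.valuation_le_one_iff _).mpr (hOP b))
    have h1 : algebraMap Lp L (IsLocalization.mk' Lp 1 ⟨b, (hM b).mpr hb⟩) * algebraMap P L b = 1 := by
      rw [IsScalarTower.algebraMap_apply P Lp L, ← map_mul]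
      simp
    have h2 := congrArg v h1
    rw [map_mul, map_one] at h2
    rw [← h2]
    exact mul_le_of_le_one_left' ((O.valuation_le_one_iff _).mpr (hO _))
  have hfac : ∀ b : P, b ≠ 0 → ∃ k : ℕ, v (algebraMap P L b) = v (algebraMap P L π) ^ k := by
    intro b hb
    obtain ⟨k, a, hna, rfl⟩ := WfDvdMonoid.max_power_factor hb hπ
    refine ⟨k, ?_⟩
    rw [map_mul, map_mul, hv1 a hna, mul_one, map_pow, map_pow]
  set ϖ := v (algebraMap P L π) with hϖ
  have hϖ0 : ϖ ≠ 0 := by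
    rw [hϖ, Valuation.ne_zero_iff]
    intro h
    rw [← map_zero (algebraMap P L)] at h
    exact hπp.ne_zero (hinj h)
  have hFz : ∀ a : F, a ≠ 0 → ∃ k : ℤ, v (algebraMap F L a) = ϖ ^ k := by
    intro a ha
    obtain ⟨x, y, hy, rfl⟩ := IsFractionRing.div_surjective (A := P) a
    have hy0 : y ≠ 0 := nonZeroDivisors.ne_zero hy
    have hx0 : x ≠ 0 := by rintro rfl; simp at ha
    obtain ⟨i, hi⟩ := hfac x hx0
    obtain ⟨j, hj⟩ := hfac y hy0
    refine ⟨(i : ℤ) - j, ?_⟩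
    rw [map_div₀, map_div₀, ← IsScalarTower.algebraMap_apply, ← IsScalarTower.algebraMap_apply, hi, hj,
      zpow_sub₀ hϖ0, zpow_natCast, zpow_natCast]
  have hϖ1 : ϖ < 1 := by
    refine lt_of_le_of_ne ((O.valuation_le_one_iff _).mpr (hOP π)) fun h => hgO ?_
    refine val_int (A := F) O ?_ g (Algebra.IsIntegral.isIntegral g)
    intro a
    by_cases ha : a = 0
    · rw [ha, map_zero]; exact O.zero_mem
    · obtain ⟨k, hk⟩ := hFz a ha
      rw [← O.valuation_le_one_iff]
      change v _ ≤ 1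
      rw [hk, h, _root_.one_zpow]
  let s := (Module.finrank F L).factorial
  have hs0 : s ≠ 0 := Nat.factorial_ne_zero _
  have hpow : ∀ x : L, ∃ k : ℤ, x ≠ 0 → v x ^ s = ϖ ^ k := by
    intro x
    by_cases hx : x = 0
    · exact ⟨0, fun h => absurd hx h⟩
    suffices ∃ k : ℤ, v x ^ s = ϖ ^ k by
      obtain ⟨k, hk⟩ := this; exact ⟨k, fun _ => hk⟩
    have hdep : ¬ LinearIndependent F (fun i : Fin (Module.finrank F L + 1) => x ^ (i : ℕ)) := by
      intro h
      have := h.fintype_card_le_finrank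
      simp at this
    rw [Fintype.not_linearIndependent_iff] at hdep
    obtain ⟨c, hc, i0, hi0⟩ := hdep
    have : ∃ i j : Fin (Module.finrank F L + 1), i < j ∧ c i ≠ 0 ∧ c j ≠ 0 ∧
        v (c i • x ^ (i : ℕ)) = v (c j • x ^ (j : ℕ)) := by
      by_contra hne
      push Not at hne
      have hne' : ∀ i j, i ≠ j → c i ≠ 0 → c j ≠ 0 → v (c i • x ^ (i : ℕ)) ≠ v (c j • x ^ (j : ℕ)) := by
        intro i j hij hi hj
        rcases lt_or_gt_of_ne hij with h | h
        · exact hne i j h hi hj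
        · exact (hne j i h hj hi).symm
      obtain ⟨j, hj, hjmax⟩ := Finset.exists_max_image (Finset.univ.filter fun i => c i ≠ 0)
        (fun i => v (c i • x ^ (i : ℕ))) ⟨i0, by simp [hi0]⟩
      simp only [Finset.mem_filter, Finset.mem_univ, true_and] at hj hjmax
      rw [← Finset.add_sum_erase _ _ (Finset.mem_univ j)] at hc
      have h0 : v (c j • x ^ (j : ℕ)) ≠ 0 := by
        rw [Valuation.ne_zero_iff]
        exact smul_ne_zero hj (pow_ne_zero _ hx)
      have h1 : v (∑ i ∈ Finset.univ.erase j, c i • x ^ (i : ℕ)) < v (c j • x ^ (j : ℕ)) := by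
        refine Valuation.map_sum_lt _ h0 fun i hi => ?_
        by_cases hci : c i = 0
        · rw [hci, zero_smul, map_zero]; exact zero_lt_iff.mpr h0
        · exact lt_of_le_of_ne (hjmax i hci) (hne' i j (Finset.ne_of_mem_erase hi) hci hj)
      have h2 := eq_neg_of_add_eq_zero_left hc
      rw [h2, Valuation.map_neg] at h1
      exact lt_irrefl _ h1
    obtain ⟨i, j, hij, hi, hj, he⟩ := this
    rw [Algebra.smul_def, Algebra.smul_def, map_mul, map_mul] at he
    obtain ⟨a, ha⟩ := hFz _ hi
    obtain ⟨b, hb⟩ := hFz _ hj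
    rw [ha, hb, map_pow, map_pow] at he
    have hvx : v x ≠ 0 := (Valuation.ne_zero_iff _).mpr hx
    obtain ⟨t, ht⟩ : (j.val - i.val) ∣ s := Nat.dvd_factorial (by omega) (by omega)
    have h3 : v x ^ (j.val - i.val) = ϖ ^ (a - b) := by
      rw [zpow_sub₀ hϖ0, eq_div_iff (zpow_ne_zero _ hϖ0)]
      have h4 : v x ^ j.val = v x ^ (j.val - i.val) * v x ^ i.val := by
        rw [← pow_add]; congr 1; omega
      rw [h4] at he
      have h5 := pow_ne_zero i.val hvx
      apply mul_right_cancel₀ h5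
      rw [he]
      ac_rfl
    refine ⟨(a - b) * t, ?_⟩
    rw [ht, pow_mul, h3, _root_.zpow_mul, zpow_natCast]
  choose ν hν using hpow
  refine ⟨O, ν, hOP, hgO, ?_⟩
  intro x y hx hy
  rw [← pow_le_pow_iff_left₀ zero_le' zero_le' hs0]
  change v x ^ s ≤ v y ^ s ↔ _
  rw [hν x hx, hν y hy]
  exact zpow_le_zpow_iff_right_of_lt_one₀ (zero_lt_iff.mpr hϖ0) hϖ1

end DV
end SI

open MvPolynomial Matrix
namespace SI
section DV

theorem dv {K L : Type} [Field K] [Field L] [Algebra K L] (G : Finset L)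
    (hG : IntermediateField.adjoin K (G : Set L) = ⊤) (A0 : Finset L) (g : L)
    (hg : ¬ IsIntegral (Algebra.adjoin K (A0 : Set L)) g) :
    ∃ (O : ValuationSubring L) (ν : L → ℤ), (∀ a : K, algebraMap K L a ∈ O) ∧ (∀ a ∈ A0, a ∈ O) ∧
      g ∉ O ∧ ∀ x y : L, x ≠ 0 → y ≠ 0 → (O.valuation x ≤ O.valuation y ↔ ν y ≤ ν x) := by
  classical
  obtain ⟨O1, hO1, hgO1⟩ := val_of_not_int g hg
  have hgi1 : g⁻¹ ∈ O1 := (O1.mem_or_inv_mem g).resolve_left hgO1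
  let T : Finset L := insert g⁻¹ (A0 ∪ G.image fun z => if z ∈ O1 then z else z⁻¹)
  let C' := Algebra.adjoin K (T : Set L)
  have hK1 : ∀ a : K, algebraMap K L a ∈ O1 := fun a => hO1 (algebraMap K _ a)
  have hA1 : ∀ a ∈ A0, a ∈ O1 := fun a ha => hO1 ⟨a, Algebra.subset_adjoin ha⟩
  have hC1 : ∀ c ∈ C', c ∈ O1 := by
    intro c hc
    induction hc using Algebra.adjoin_induction with
    | mem x hx =>
      simp only [T, Finset.coe_insert, Finset.coe_union, Finset.coe_image, Set.mem_insert_iff,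
        Set.mem_union, Set.mem_image, Finset.mem_coe] at hx
      rcases hx with rfl | hx | ⟨z, hz, rfl⟩
      · exact hgi1
      · exact hA1 x hx
      · split_ifs with h
        · exact h
        · exact (O1.mem_or_inv_mem z).resolve_left h
    | algebraMap r => exact hK1 r
    | add x y _ _ hx hy => exact O1.add_mem _ _ hx hy
    | mul x y _ _ hx hy => exact O1.mul_mem _ _ hx hy
  have hgC : ¬ IsIntegral C' g := fun h => hgO1 (val_int (A := C') O1 (fun a => hC1 a.1 a.2) g h)
  haveI : Algebra.FiniteType K C' := (Subalgebra.fg_iff_finiteType _).mp ⟨T, rfl⟩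
  obtain ⟨s, φ, hφ, hφi⟩ := exists_integral_inj_algHom_of_fg K C'
  let P := MvPolynomial (Fin s) K
  let ψ : P →+* L := (C'.val.comp φ).toRingHom
  have hψ : Function.Injective ψ := Subtype.val_injective.comp hφ
  letI : Algebra P L := ψ.toAlgebra
  have hPK : ∀ a : K, algebraMap P L (C a) = algebraMap K L a := fun a => (C'.val.comp φ).commutes a
  haveI : FaithfulSMul P L := (faithfulSMul_iff_algebraMap_injective P L).mpr hψ
  letI : Algebra (FractionRing P) L := FractionRing.liftAlgebra P L
  haveI : IsScalarTower P (FractionRing P) L := FractionRing.isScalarTower_liftAlgebra P L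
  have hint : ∀ c ∈ C', IsIntegral P c := by
    intro c hc
    obtain ⟨q, hq, he⟩ := hφi ⟨c, hc⟩
    refine ⟨q, hq, ?_⟩
    have := congrArg C'.val he
    rw [map_zero] at this
    rw [← this]
    exact (Polynomial.hom_eval₂ q φ.toRingHom C'.val.toRingHom ⟨c, hc⟩).symm
  have hTC : ∀ t ∈ T, t ∈ C' := fun t ht => Algebra.subset_adjoin ht
  have hGint : ∀ z ∈ G, IsIntegral (FractionRing P) z := by
    intro z hz
    have h1 : (if z ∈ O1 then z else z⁻¹) ∈ C' := hTC _ (by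
      simp only [T, Finset.mem_insert, Finset.mem_union, Finset.mem_image]
      exact Or.inr (Or.inr ⟨z, hz, rfl⟩))
    have h2 : IsIntegral (FractionRing P) (if z ∈ O1 then z else z⁻¹) := (hint _ h1).tower_top
    split_ifs at h2
    · exact h2
    · simpa using h2.inv
  have htop : IntermediateField.adjoin (FractionRing P) (G : Set L) = ⊤ := by
    rw [eq_top_iff]
    rintro x -
    have hx : x ∈ IntermediateField.adjoin K (G : Set L) := by rw [hG]; trivial
    induction hx using IntermediateField.adjoin_induction with
    | mem x hx => exact IntermediateField.subset_adjoin _ _ hx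
    | algebraMap a =>
      rw [← hPK, IsScalarTower.algebraMap_apply P (FractionRing P) L]
      exact IntermediateField.algebraMap_mem _ _
    | add x y _ _ hx hy => exact add_mem hx hy
    | inv x _ hx => exact inv_mem hx
    | mul x y _ _ hx hy => exact mul_mem hx hy
  haveI : FiniteDimensional (FractionRing P) L := by
    haveI : FiniteDimensional (FractionRing P) (IntermediateField.adjoin (FractionRing P) (G : Set L)) :=
      IntermediateField.finiteDimensional_adjoin hGint
    rw [htop] at this
    exact LinearEquiv.finiteDimensional (IntermediateField.topEquiv (F := FractionRing P) (E := L)).toLinearEquiv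
  have hgP : ¬ IsIntegral P g := by
    intro h
    apply hgC
    obtain ⟨q, hq, he⟩ := h
    refine ⟨q.map φ.toRingHom, hq.map _, ?_⟩
    rw [Polynomial.eval₂_map]; exact he
  obtain ⟨O, ν, hPO, hgO, hν⟩ := dv2 (P := P) g hgP (hint _ (hTC _ (Finset.mem_insert_self _ _)))
  refine ⟨O, ν, fun a => by rw [← hPK]; exact hPO _, fun a ha => ?_, hgO, hν⟩
  exact val_int O hPO a (hint a (hTC a (by simp [T, ha])))

end DV
end SI

open MvPolynomial Matrix
namespace SI
section V
variable {α ι : Type} [Fintype α] [DecidableEq α]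

lemma adapted {k : Type} [Field k] (U : Submodule k (α → k)) :
    ∃ (b : Module.Basis α k (α → k)) (J : Finset α), J.card = Module.finrank k U ∧
      ∀ w, w ∈ U ↔ ∀ i ∉ J, b.equivFun w i = 0 := by
  obtain ⟨W, hW⟩ := U.exists_isCompl
  let b0 := ((Module.finBasis k U).prod (Module.finBasis k W)).map (U.prodEquivOfIsCompl W hW)
  let e : Fin (Module.finrank k U) ⊕ Fin (Module.finrank k W) ≃ α := by
    refine Fintype.equivOfCardEq ?_
    rw [← Module.finrank_eq_card_basis b0, Module.finrank_fintype_fun_eq_card]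
  refine ⟨b0.reindex e, (Finset.univ : Finset (Fin (Module.finrank k U))).map
    ⟨fun i => e (Sum.inl i), fun i j h => by simpa using h⟩, by simp, fun w => ?_⟩
  have key : w ∈ U ↔ ∀ i, b0.repr w (Sum.inr i) = 0 := by
    have h1 : ∀ i, b0.repr w (Sum.inr i) = (Module.finBasis k W).repr ((U.prodEquivOfIsCompl W hW).symm w).2 i := by
      intro i; simp [b0]
    simp only [h1]
    rw [← Submodule.prodEquivOfIsCompl_symm_apply_snd_eq_zero U W hW]
    constructor
    · intro h i; rw [h]; simp
    · intro h
      apply (Module.finBasis k W).repr.injective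
      ext i; rw [h i]; simp
  rw [key]
  constructor
  · intro h i hi
    obtain ⟨s, rfl⟩ := e.surjective i
    rcases s with s | s
    · exact absurd (Finset.mem_map.mpr ⟨s, Finset.mem_univ _, rfl⟩) hi
    · simpa using h s
  · intro h i
    have := h (e (Sum.inr i)) (fun hh => by
      obtain ⟨a, -, ha⟩ := Finset.mem_map.mp hh
      exact absurd (e.injective ha) (by simp))
    simpa using this

lemma lift_unit {L : Type} [Field L] (O : ValuationSubring L)
    (P : Matrix α α (IsLocalRing.ResidueField O)) (hP : P.det ≠ 0) :
    ∃ A : Matrix α α O, A.map (IsLocalRing.residue O) = P ∧ O.valuation (A.det : L) = 1 := by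
  choose s hs using IsLocalRing.residue_surjective (R := O)
  refine ⟨P.map s, by ext i j; simp [hs], ?_⟩
  have h : IsLocalRing.residue O (P.map s).det ≠ 0 := by
    rw [RingHom.map_det]
    convert hP
    ext i j; simp [hs]
  have hu : IsUnit (P.map s).det := by
    rwa [IsLocalRing.residue_ne_zero_iff_isUnit] at h
  exact (O.valuation_eq_one_iff _).mp hu

lemma shrink_step {L : Type} [Field L] (O : ValuationSubring L) (c0 : L) (hc0 : c0 ≠ 0)
    (hc1 : O.valuation c0 < 1) [Fintype ι] (x : ι → Matrix α α O)
    (h : ¬ NotShrunk (fun l => (x l).map (IsLocalRing.residue O))) :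
    ∃ (A B : Matrix α α L) (y : ι → Matrix α α O), 
      (∀ l, (y l).map O.subtype = A * (x l).map O.subtype * B) ∧
      1 < O.valuation (A.det * B.det) := by
  classical
  unfold NotShrunk at h
  push Not at h
  obtain ⟨U, hU⟩ := h
  obtain ⟨bU, J, hJ, hUJ⟩ := adapted U
  obtain ⟨bW, I, hI, hWI⟩ := adapted (⨆ i, U.map ((x i).map (IsLocalRing.residue O)).mulVecLin)
  rw [← hJ, ← hI] at hU
  obtain ⟨P, hP, hPd⟩ := lift_unit O (LinearMap.toMatrix' (bW.equivFun : (α → _) →ₗ[_] (α → _)))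
    (by rw [LinearMap.det_toMatrix']; exact (LinearEquiv.isUnit_det' bW.equivFun).ne_zero)
  obtain ⟨Q, hQ, hQd⟩ := lift_unit O (LinearMap.toMatrix' (bU.equivFun.symm : (α → _) →ₗ[_] (α → _)))
    (by rw [LinearMap.det_toMatrix']; exact (LinearEquiv.isUnit_det' bU.equivFun.symm).ne_zero)
  obtain ⟨M, hM⟩ : ∃ M : ι → Matrix α α O, ∀ l, M l = P * x l * Q := ⟨_, fun l => rfl⟩
  have hblk : ∀ l, ∀ i ∉ I, ∀ j ∈ J, O.valuation (M l i j : L) < 1 := by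
    intro l i hi j hj
    rw [← O.valuation_lt_one_iff, ← IsLocalRing.residue_eq_zero_iff]
    have h1 : (IsLocalRing.residue O) (M l i j) =
        ((M l).map (IsLocalRing.residue O)) i j := rfl
    rw [h1, hM, Matrix.map_mul, Matrix.map_mul, hP, hQ]
    have hb : bU j ∈ U := (hUJ _).mpr fun i' hi' => by
      rw [Module.Basis.equivFun_self, if_neg]; rintro rfl; exact hi' hj
    have h2 : ((x l).map (IsLocalRing.residue O)) *ᵥ (bU j) ∈ (⨆ i, U.map ((x i).map (IsLocalRing.residue O)).mulVecLin) :=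
      Submodule.mem_iSup_of_mem l ⟨_, hb, rfl⟩
    have h3 := (hWI _).mp h2 i hi
    rw [← h3]
    have h4 : (LinearMap.toMatrix' (bU.equivFun.symm : (α → _) →ₗ[_] (α → _))).col j = bU j := by
      ext i'
      rw [Matrix.col_apply, LinearMap.toMatrix'_apply]
      rw [LinearEquiv.coe_coe, Module.Basis.equivFun_symm_apply, Finset.sum_eq_single j] <;> simp +contextual [Pi.single_apply]
    rw [← h4, ← LinearEquiv.coe_coe bW.equivFun, ← LinearMap.toMatrix'_mulVec, Matrix.mulVec_mulVec]
    rfl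
  obtain ⟨c, hc, hcm⟩ := Finset.exists_max_image
    (insert c0 ((Finset.univ : Finset (ι × α × α)).image fun p : ι × α × α =>
      if p.2.1 ∉ I ∧ p.2.2 ∈ J then (M p.1 p.2.1 p.2.2 : L) else c0)) O.valuation ⟨c0, by simp⟩
  have hclt : O.valuation c < 1 := by
    simp only [Finset.mem_insert, Finset.mem_image, Finset.mem_univ, true_and] at hc
    rcases hc with rfl | ⟨p, rfl⟩
    · exact hc1
    · split_ifs with hp
      · exact hblk _ _ hp.1 _ hp.2
      · exact hc1
  have hcne : c ≠ 0 := by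
    rintro rfl
    have := hcm c0 (by simp)
    simp only [map_zero, le_zero_iff, map_eq_zero] at this
    exact hc0 this
  have hcb : ∀ l, ∀ i ∉ I, ∀ j ∈ J, O.valuation (M l i j : L) ≤ O.valuation c := by
    intro l i hi j hj
    apply hcm
    simp only [Finset.mem_insert, Finset.mem_image, Finset.mem_univ, true_and]
    exact Or.inr ⟨(l, i, j), by simp [hi, hj]⟩
  let DI : Matrix α α L := Matrix.diagonal fun i => if i ∈ I then c else 1
  let EJ : Matrix α α L := Matrix.diagonal fun j => if j ∈ J then c⁻¹ else 1
  have hmem : ∀ l i j, (if i ∈ I then c else 1) * (M l i j : L) * (if j ∈ J then c⁻¹ else 1) ∈ O := by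
    intro l i j
    have h0 : O.valuation (M l i j : L) ≤ 1 := O.valuation_le_one _
    rw [← O.valuation_le_one_iff]
    by_cases hi : i ∈ I <;> by_cases hj : j ∈ J
    · simp only [hi, hj, if_true]
      rw [mul_right_comm, mul_inv_cancel₀ hcne, one_mul]; exact h0
    · simp only [hi, hj, if_true, if_false, mul_one, map_mul]
      exact mul_le_one' hclt.le h0
    · simp only [hi, hj, if_true, if_false, one_mul, map_mul, map_inv₀]
      have := hcb l i hi j hj
      have hv : O.valuation c ≠ 0 := by simpa using hcne
      rw [← div_eq_mul_inv]
      exact div_le_one_of_le₀ this zero_le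
    · simpa only [hi, hj, if_false, one_mul, mul_one] using h0
  refine ⟨DI * P.map O.subtype, Q.map O.subtype * EJ, fun l => Matrix.of fun i j => ⟨_, hmem l i j⟩, ?_, ?_⟩
  · intro l
    have : DI * P.map O.subtype * (x l).map O.subtype * (Q.map O.subtype * EJ) =
        DI * ((M l).map O.subtype) * EJ := by
      simp only [hM, Matrix.map_mul, Matrix.mul_assoc]
    rw [this]
    ext i j
    simp only [DI, EJ, Matrix.mul_diagonal, Matrix.diagonal_mul, Matrix.map_apply]
    rfl
  · have hPL : O.valuation (P.map O.subtype).det = 1 := by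
      rw [← hPd]; congr 1; exact (RingHom.map_det O.subtype P).symm
    have hQL : O.valuation (Q.map O.subtype).det = 1 := by
      rw [← hQd]; congr 1; exact (RingHom.map_det O.subtype Q).symm
    have hv : O.valuation c ≠ 0 := by simpa using hcne
    simp only [Matrix.det_mul, map_mul, hPL, hQL, mul_one, one_mul, DI, EJ, Matrix.det_diagonal,
      Finset.prod_ite_mem, Finset.univ_inter, Finset.prod_const, map_pow, map_inv₀]
    rw [inv_pow, ← div_eq_mul_inv, one_lt_div₀ (pow_pos (zero_lt_iff.mpr hv) _)]
    exact pow_lt_pow_right_of_lt_one₀ (zero_lt_iff.mpr hv) hclt hU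

end V
end SI

open MvPolynomial Matrix
namespace SI
section
variable {K : Type} [Field K] {n m : ℕ}

/-- the determinantal semi-invariant attached to a tuple of scalar matrices -/
noncomputable def fT (n : ℕ) {m : ℕ} {κ : Type} [Fintype κ] [DecidableEq κ] (T : Fin m → Matrix κ κ K) :
    MvPolynomial (Fin m × Fin n × Fin n) K :=
  (blow (gX K n m) (fun l => (T l).map C)).det

lemma ev_fT {κ : Type} [Fintype κ] [DecidableEq κ] (T : Fin m → Matrix κ κ K) {L : Type} [CommRing L] [Algebra K L]
    (x : Fin m → Matrix (Fin n) (Fin n) L) :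
    ev x (fT n T) = (blow x (fun l => (T l).map (algebraMap K L))).det := by
  rw [fT, AlgHom.map_det]
  congr 1
  ext p q
  simp [blow_apply, gX, ev]

lemma det_blow_mul {L : Type} [CommRing L] {κ : Type} [Fintype κ] [DecidableEq κ] (A B : Matrix (Fin n) (Fin n) L)
    (x : Fin m → Matrix (Fin n) (Fin n) L) (T : Fin m → Matrix κ κ L) :
    (blow (fun l => A * x l * B) T).det = (A.det * B.det) ^ Fintype.card κ * (blow x T).det := by
  have h : ∀ y : Fin m → Matrix (Fin n) (Fin n) L, blow y T = ∑ l, Matrix.kronecker (y l) (T l) := by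
    intro y; ext p q; simp [blow_apply, Matrix.sum_apply, Matrix.kronecker]
  have : blow (fun l => A * x l * B) T =
      Matrix.kronecker A (1 : Matrix κ κ L) * blow x T * Matrix.kronecker B (1 : Matrix κ κ L) := by
    rw [h, h, Finset.mul_sum, Finset.sum_mul]
    refine Finset.sum_congr rfl fun l _ => ?_
    simp only [Matrix.kronecker]
    rw [← Matrix.mul_kronecker_mul, ← Matrix.mul_kronecker_mul, one_mul, mul_one]
  rw [this, det_mul, det_mul]
  simp only [Matrix.kronecker]
  rw [det_kronecker, det_kronecker]
  simp only [det_one, one_pow, mul_one]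
  ring

lemma fT_mem {κ : Type} [Fintype κ] [DecidableEq κ] (T : Fin m → Matrix κ κ K) :
    fT n T ∈ matrixSemiInvariants K n m := by
  rw [mem_iff]
  intro A B hA hB x
  rw [ev_fT, ev_fT, det_blow_mul, hA, hB]
  simp

lemma fT_hom (T : Fin m → Matrix (Fin (n-1)) (Fin (n-1)) K) : (fT n T).IsHomogeneous (n * (n-1)) := by
  rw [fT, det_apply]
  refine IsHomogeneous.sum _ _ _ fun σ _ => ?_
  have h1 : (∏ i : Fin n × Fin (n-1), blow (gX K n m) (fun l => (T l).map C) (σ i) i).IsHomogeneous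
      (∑ i : Fin n × Fin (n-1), 1) := by
    refine IsHomogeneous.prod _ _ _ fun i _ => ?_
    rw [blow_apply]
    refine IsHomogeneous.sum _ _ _ fun l _ => ?_
    have h1 := (isHomogeneous_X K ((l, (σ i).1, i.1) : Fin m × Fin n × Fin n)).mul (isHomogeneous_C (Fin m × Fin n × Fin n) (T l (σ i).2 i.2))
    simpa [gX] using h1
  simp only [Finset.sum_const, Finset.card_univ, Fintype.card_prod, Fintype.card_fin, smul_eq_mul, mul_one] at h1
  rw [Units.smul_def, ← Int.cast_smul_eq_zsmul K, ← C_mul']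
  have h2 := (isHomogeneous_C (Fin m × Fin n × Fin n) (((Equiv.Perm.sign σ : ℤˣ) : ℤ) : K)).mul h1
  rwa [zero_add] at h2

lemma ev_memO {L : Type} [Field L] [Algebra K L] (O : ValuationSubring L) (hK : ∀ a : K, algebraMap K L a ∈ O)
    (z : Fin m → Matrix (Fin n) (Fin n) L) (hz : ∀ l i j, z l i j ∈ O) (f : MvPolynomial (Fin m × Fin n × Fin n) K) :
    ev z f ∈ O := by
  induction f using MvPolynomial.induction_on with
  | C a => simpa [ev] using hK a
  | add p q hp hq => rw [map_add]; exact O.add_mem _ _ hp hq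
  | mul_X p i hp => rw [map_mul]; exact O.mul_mem _ _ hp (by simpa [ev] using hz _ _ _)

lemma exists_T {k : Type} [Field k] [Infinite K] (ρ : K →+* k) (hn : 2 ≤ n) (y : Fin m → Matrix (Fin n) (Fin n) k)
    (hy : NotShrunk y) : ∃ T : Fin m → Matrix (Fin (n-1)) (Fin (n-1)) K, (blow y (fun l => (T l).map ρ)).det ≠ 0 := by
  haveI : Infinite k := Infinite.of_injective ρ ρ.injective
  have h0 := ncrank y hy (by simpa using hn)
  rw [Fintype.card_fin] at h0
  obtain ⟨T, hT⟩ := h0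
  let σ := Fin m × Fin (n-1) × Fin (n-1)
  let P : MvPolynomial σ k := (blow (fun l => (y l).map C) (fun l => Matrix.of fun i j => X (l, i, j))).det
  have hP : ∀ t : σ → k, eval t P = (blow y (fun l => Matrix.of fun i j => t (l, i, j))).det := by
    intro t
    rw [RingHom.map_det]
    congr 1
    ext p q
    simp [blow_apply]
  by_contra hcon
  push Not at hcon
  have : P = 0 := by
    refine funext_set (fun _ => Set.range ρ) (fun _ => Set.infinite_range_of_injective ρ.injective) fun t ht => ?_
    choose t' ht' using fun i => ht i trivial
    rw [hP, map_zero, ← hcon fun l => Matrix.of fun i j => t' (l, i, j)]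
    congr 2
    funext l; ext i j; simp [ht']
  apply hT
  have h1 := hP fun p => T p.1 p.2.1 p.2.2
  rw [this, map_zero] at h1
  exact h1.symm

lemma frac_gen (σ : Type) [Fintype σ] [DecidableEq (FractionRing (MvPolynomial σ K))] :
    IntermediateField.adjoin K (((Finset.univ : Finset σ).image fun p =>
      algebraMap (MvPolynomial σ K) (FractionRing (MvPolynomial σ K)) (X p) : Finset _) : Set (FractionRing (MvPolynomial σ K))) = ⊤ := by
  rw [eq_top_iff]
  rintro z -
  have h : ∀ a : MvPolynomial σ K, algebraMap (MvPolynomial σ K) (FractionRing (MvPolynomial σ K)) a ∈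
      IntermediateField.adjoin K (((Finset.univ : Finset σ).image fun p =>
      algebraMap (MvPolynomial σ K) (FractionRing (MvPolynomial σ K)) (X p) : Finset _) : Set (FractionRing (MvPolynomial σ K))) := by
    intro a
    induction a using MvPolynomial.induction_on with
    | C a =>
      have : algebraMap (MvPolynomial σ K) (FractionRing (MvPolynomial σ K)) (C a) = algebraMap K _ a :=
        (IsScalarTower.algebraMap_apply K (MvPolynomial σ K) _ a).symm
      rw [this]; exact IntermediateField.algebraMap_mem _ _
    | add p q hp hq => rw [map_add]; exact add_mem hp hq
    | mul_X p i hp => rw [map_mul]; exact mul_mem hp (IntermediateField.subset_adjoin _ _ (by simp))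
  obtain ⟨a, b, -, rfl⟩ := IsFractionRing.div_surjective (A := MvPolynomial σ K) z
  exact div_mem (h a) (h b)

lemma int_transfer {S : Type} [CommRing S] [Algebra K S] {L : Type} [Field L] [Algebra K L] [Algebra S L] [IsScalarTower K S L]
    (hinj : Function.Injective (algebraMap S L)) (s : Set S) (g : S)
    (h : IsIntegral (Algebra.adjoin K (algebraMap S L '' s)) (algebraMap S L g)) :
    IsIntegral (Algebra.adjoin K s) g := by
  rw [← isIntegral_algebraMap_iff (B := L) hinj]
  have h1 : Algebra.adjoin K (algebraMap S L '' s) = (Algebra.adjoin K s).map (IsScalarTower.toAlgHom K S L) := by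
    rw [AlgHom.map_adjoin]; rfl
  rw [h1] at h
  let e := (Algebra.adjoin K s).equivMapOfInjective (IsScalarTower.toAlgHom K S L) hinj
  refine IsIntegral.map_of_comp_eq (e.symm : _ →+* _) (RingHom.id L) ?_ h
  ext z
  obtain ⟨w, rfl⟩ := e.surjective z
  simp
  rfl

end
end SI

open MvPolynomial Matrix
namespace SI
section
variable {K : Type} [Field K] {n m : ℕ}

theorem integ_val [IsAlgClosed K] (hn : 2 ≤ n) (l0 : Fin m) {L : Type} [Field L] [Algebra K L]
    (O : ValuationSubring L) (ν : L → ℤ) (hK : ∀ a : K, algebraMap K L a ∈ O)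
    (hν : ∀ x y : L, x ≠ 0 → y ≠ 0 → (O.valuation x ≤ O.valuation y ↔ ν y ≤ ν x))
    (x : Fin m → Matrix (Fin n) (Fin n) L) (hx : (x l0).det ≠ 0)
    (hT : ∀ T : Fin m → Matrix (Fin (n-1)) (Fin (n-1)) K, ev x (fT n T) ∈ O)
    (g : MvPolynomial (Fin m × Fin n × Fin n) K)
    (hg : g ∈ matrixSemiInvariants K n m) (k : ℕ) (hgD : g.IsHomogeneous (n * k)) : ev x g ∈ O := by
  classical
  by_contra hgO
  have hg0 : ev x g ≠ 0 := fun h => hgO (h ▸ O.zero_mem)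
  have hgv : 1 < O.valuation (ev x g) := by rw [← not_le, O.valuation_le_one_iff]; exact hgO
  let c0 := (ev x g)⁻¹
  have hc0 : c0 ≠ 0 := inv_ne_zero hg0
  have hc1 : O.valuation c0 < 1 := by
    rw [map_inv₀]; exact inv_lt_one_of_one_lt₀ hgv
  let P : ℤ → Prop := fun z => ∃ (A B : Matrix (Fin n) (Fin n) L) (y : Fin m → Matrix (Fin n) (Fin n) O),
    (∀ l, (y l).map O.subtype = A * x l * B) ∧ A.det * B.det ≠ 0 ∧ z = ν (A.det * B.det)
  have hbdd : ∃ b, ∀ z, P z → b ≤ z := by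
    refine ⟨ν (x l0).det⁻¹, ?_⟩
    rintro z ⟨A, B, y, hy, hd, rfl⟩
    rw [← hν _ _ hd (inv_ne_zero hx), map_inv₀]
    have h1 : A.det * B.det * (x l0).det = O.subtype (y l0).det := by
      have := congrArg Matrix.det (hy l0)
      rw [det_mul, det_mul] at this
      rw [RingHom.map_det]
      refine Eq.trans ?_ this.symm
      ring
    have h2 : O.valuation (A.det * B.det) * O.valuation (x l0).det ≤ 1 := by
      rw [← map_mul, h1]; exact O.valuation_le_one _
    have hp : 0 < O.valuation (x l0).det := zero_lt_iff.mpr (by simpa only [ne_eq, map_eq_zero] using hx)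
    rw [← one_mul (O.valuation (x l0).det)⁻¹, le_mul_inv_iff₀ hp]
    exact h2
  have hex : ∃ z, P z := by
    obtain ⟨c, hc, hcm⟩ := Finset.exists_max_image
      (insert 1 ((Finset.univ : Finset (Fin m × Fin n × Fin n)).image fun p : Fin m × Fin n × Fin n =>
        x p.1 p.2.1 p.2.2)) O.valuation ⟨1, by simp⟩
    have hc1 : 1 ≤ O.valuation c := by simpa using hcm 1 (by simp)
    have hcne : c ≠ 0 := by rintro rfl; simp at hc1
    have hmem : ∀ l i j, c⁻¹ * x l i j ∈ O := by
      intro l i j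
      have := hcm (x l i j) (by
        simp only [Finset.mem_insert, Finset.mem_image, Finset.mem_univ, true_and]
        exact Or.inr ⟨(l, i, j), rfl⟩)
      rw [← O.valuation_le_one_iff, map_mul, map_inv₀, mul_comm, ← div_eq_mul_inv]
      exact div_le_one_of_le₀ this zero_le
    refine ⟨_, c⁻¹ • 1, 1, fun l => Matrix.of fun i j => ⟨_, hmem l i j⟩, fun l => ?_, ?_, rfl⟩
    · ext i j; simp
    · simp [hcne]
  obtain ⟨z, ⟨A, B, y, hy, hd, rfl⟩, hmin⟩ := Int.exists_least_of_bdd hbdd hex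
  have hns : NotShrunk (fun l => (y l).map (IsLocalRing.residue O)) := by
    by_contra hsh
    obtain ⟨A', B', y', hy', hlt⟩ := shrink_step O c0 hc0 hc1 y hsh
    have hd' : A'.det * B'.det ≠ 0 := by intro h; rw [h] at hlt; simp at hlt
    have he : (A' * A).det * (B * B').det = (A'.det * B'.det) * (A.det * B.det) := by
      rw [det_mul, det_mul]; ring
    have hle := hmin _ ⟨A' * A, B * B', y', fun l => by rw [hy', hy]; simp only [Matrix.mul_assoc], by
      rw [he]; exact mul_ne_zero hd' hd, rfl⟩
    rw [he, ← hν _ _ (mul_ne_zero hd' hd) hd, map_mul] at hle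
    have hp : 0 < O.valuation (A.det * B.det) := zero_lt_iff.mpr (by simpa only [ne_eq, map_eq_zero] using hd)
    exact absurd hle (not_le.mpr (lt_mul_of_one_lt_left hp hlt))
  let ρ : K →+* O := (algebraMap K L).codRestrict O.toSubring hK
  obtain ⟨T, hTd⟩ := exists_T ((IsLocalRing.residue O).comp ρ) hn _ hns
  have hu : O.valuation ((blow y fun l => (T l).map ρ).det : L) = 1 := by
    rw [← O.valuation_eq_one_iff, ← IsLocalRing.residue_ne_zero_iff_isUnit, RingHom.map_det]
    rw [RingHom.mapMatrix_apply, blow_map]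
    simpa [Matrix.map_map] using hTd
  have hAxB : ∀ l i j, (A * x l * B) i j ∈ O := by
    intro l i j
    rw [← hy]
    exact (y l i j).2
  have hu2 : ((blow y fun l => (T l).map ρ).det : L) = ev (fun l => A * x l * B) (fT n T) := by
    rw [ev_fT]
    have : ((blow y fun l => (T l).map ρ).det : L) = O.subtype (blow y fun l => (T l).map ρ).det := rfl
    rw [this, RingHom.map_det, RingHom.mapMatrix_apply, blow_map]
    simp only [hy, Matrix.map_map]
    rfl
  rw [hu2, law (fT_mem T) (fT_hom T) (by omega), map_mul, map_pow] at hu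
  have hTv := (O.valuation_le_one_iff _).mpr (hT T)
  have hδ : 1 ≤ O.valuation (A.det * B.det) := by
    by_contra hlt
    push Not at hlt
    have h1 : O.valuation (A.det * B.det) ^ (n-1) < 1 := pow_lt_one₀ zero_le hlt (by omega)
    have h2 := mul_le_of_le_one_right (a := O.valuation (A.det * B.det) ^ (n-1)) zero_le hTv
    rw [hu] at h2
    exact absurd h1 (not_lt.mpr h2)
  have hfin := (O.valuation_le_one_iff _).mpr (ev_memO O hK _ hAxB g)
  rw [law hg hgD (by omega), map_mul, map_pow] at hfin
  have h3 : O.valuation (ev x g) ≤ O.valuation (A.det * B.det) ^ k * O.valuation (ev x g) :=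
    le_mul_of_one_le_left zero_le (one_le_pow₀ hδ)
  exact absurd (h3.trans hfin) (not_le.mpr hgv)

theorem integ [IsAlgClosed K] (hn : 2 ≤ n) (hm : 1 ≤ m) (A0 : Finset (MvPolynomial (Fin m × Fin n × Fin n) K))
    (hT : ∀ T : Fin m → Matrix (Fin (n-1)) (Fin (n-1)) K, fT n T ∈ Algebra.adjoin K (A0 : Set (MvPolynomial (Fin m × Fin n × Fin n) K)))
    (g : MvPolynomial (Fin m × Fin n × Fin n) K)
    (hg : g ∈ matrixSemiInvariants K n m) (D : ℕ) (hgD : g.IsHomogeneous D) :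
    IsIntegral (Algebra.adjoin K (A0 : Set (MvPolynomial (Fin m × Fin n × Fin n) K))) g := by
  classical
  rcases dvd_or_zero hg hgD (by omega) with ⟨k, rfl⟩ | rfl
  swap
  · exact isIntegral_zero
  by_contra hcon
  let S := MvPolynomial (Fin m × Fin n × Fin n) K
  let L := FractionRing S
  have hinj : Function.Injective (algebraMap S L) := IsFractionRing.injective S L
  have h1 : ¬ IsIntegral (Algebra.adjoin K ((A0.image (algebraMap S L) : Finset L) : Set L)) (algebraMap S L g) := by
    intro h
    rw [Finset.coe_image] at h
    exact hcon (int_transfer hinj _ _ h)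
  obtain ⟨O, ν, hK, hA, hgO, hν⟩ := dv _ (frac_gen (K := K) (Fin m × Fin n × Fin n)) _ _ h1
  let φ : S →ₐ[K] L := IsScalarTower.toAlgHom K S L
  let x : Fin m → Matrix (Fin n) (Fin n) L := fun l => (gX K n m l).map φ
  have hev : ∀ f : S, ev x f = algebraMap S L f := fun f => by
    have := ev_comp φ (gX K n m) f
    rw [ev_gX] at this
    exact this.symm
  apply hgO
  rw [← hev]
  refine integ_val hn ⟨0, hm⟩ O ν hK hν x ?_ ?_ g hg k hgD
  · have h2 : (x ⟨0, hm⟩).det = φ (gX K n m ⟨0, hm⟩).det := (AlgHom.map_det φ _).symm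
    rw [h2]
    intro h3
    have h4 : (gX K n m ⟨0, hm⟩).det = 0 := hinj (h3.trans (map_zero _).symm)
    have h5 := congrArg (ev (K := K) (fun _ : Fin m => (1 : Matrix (Fin n) (Fin n) K))) h4
    rw [AlgHom.map_det, map_zero, AlgHom.mapMatrix_apply, ev_gX_map, det_one] at h5
    exact one_ne_zero h5
  · intro T
    rw [hev]
    have : ∀ f ∈ Algebra.adjoin K (A0 : Set S), algebraMap S L f ∈ O := by
      intro f hf
      induction hf using Algebra.adjoin_induction with
      | mem a ha => exact hA _ (Finset.mem_image_of_mem _ ha)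
      | algebraMap r => rw [← IsScalarTower.algebraMap_apply]; exact hK r
      | add a b _ _ ha hb => rw [map_add]; exact O.add_mem _ _ ha hb
      | mul a b _ _ ha hb => rw [map_mul]; exact O.mul_mem _ _ ha hb
    exact this _ (hT T)

end
end SI

open MvPolynomial Matrix
namespace SI
section N
variable {K σ ι : Type} [Field K]

lemma comp_aeval_mul {d : ℕ} (hd : 0 < d) (f : ι → MvPolynomial σ K) (hf : ∀ i, (f i).IsHomogeneous d)
    (F : MvPolynomial ι K) (w : ℕ) : homogeneousComponent w (aeval f F) =
      if d ∣ w then aeval f (homogeneousComponent (w / d) F) else 0 := by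
  have hh : ∀ j (G : MvPolynomial ι K), G.IsHomogeneous j → (aeval f G).IsHomogeneous (d * j) := by
    intro j G hG
    exact hG.aeval f hf
  conv_lhs => rw [← sum_homogeneousComponent F]
  rw [map_sum, map_sum]
  have : ∀ i, homogeneousComponent w (aeval f (homogeneousComponent i F)) =
      if w = d * i then aeval f (homogeneousComponent i F) else 0 := by
    intro i
    exact homogeneousComponent_of_mem (hh i _ (homogeneousComponent_isHomogeneous i F))
  simp only [this]
  split_ifs with h
  · obtain ⟨e, rfl⟩ := h
    rw [Nat.mul_div_cancel_left _ hd]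
    have : ∀ i, (d * e = d * i) = (e = i) := fun i => by
      apply propext; exact ⟨fun h => Nat.eq_of_mul_eq_mul_left hd h, fun h => by rw [h]⟩
    simp only [this]
    rw [Finset.sum_ite_eq]
    split_ifs with h
    · rfl
    · rw [homogeneousComponent_eq_zero, map_zero]
      simpa [Nat.lt_succ_iff] using h
  · refine Finset.sum_eq_zero fun i _ => if_neg ?_
    rintro rfl; exact h ⟨_, rfl⟩

lemma hompoly {B : Type} [CommRing B] [Algebra K B] [Fintype ι] {F : MvPolynomial ι K} {e : ℕ} (hF : F.IsHomogeneous e)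
    (a : ι → B) (b : ι → K) :
    (aeval (fun i => Polynomial.C (a i) + Polynomial.C (algebraMap K B (b i)) * Polynomial.X) F).natDegree ≤ e ∧
    (aeval (fun i => Polynomial.C (a i) + Polynomial.C (algebraMap K B (b i)) * Polynomial.X) F).coeff e =
      algebraMap K B (eval b F) := by
  classical
  set q : ι → Polynomial B := fun i => Polynomial.C (a i) + Polynomial.C (algebraMap K B (b i)) * Polynomial.X with hq
  have hq1 : ∀ i, (q i).natDegree ≤ 1 := fun i => by
    rw [hq]; simp only; compute_degree
  have hq2 : ∀ i, (q i).coeff 1 = algebraMap K B (b i) := fun i => by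
    rw [hq]; simp [Polynomial.coeff_C]
  have hp : ∀ (D : ι → ℕ) (s : Finset ι), (∏ i ∈ s, q i ^ D i).natDegree ≤ ∑ i ∈ s, D i ∧
      (∏ i ∈ s, q i ^ D i).coeff (∑ i ∈ s, D i) = ∏ i ∈ s, (algebraMap K B (b i)) ^ D i := by
    intro D s
    induction s using Finset.induction_on with
    | empty => simp
    | insert i s hi ih =>
      rw [Finset.prod_insert hi, Finset.sum_insert hi, Finset.prod_insert hi]
      have h1 : (q i ^ D i).natDegree ≤ D i := by
        refine Polynomial.natDegree_pow_le.trans ?_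
        exact (Nat.mul_le_mul_left _ (hq1 i)).trans (by simp)
      refine ⟨Polynomial.natDegree_mul_le_of_le h1 ih.1, ?_⟩
      rw [Polynomial.coeff_mul_add_eq_of_natDegree_le h1 ih.1, ih.2]
      have := Polynomial.coeff_pow_of_natDegree_le (m := D i) (hq1 i)
      rw [mul_one] at this
      rw [this, hq2]
  have hd : ∀ D ∈ F.support, ∑ i, D i = e := by
    intro D hD
    have := hF (mem_support_iff.mp hD)
    rw [← this, Finsupp.weight_apply, Finsupp.sum_fintype] <;> simp
  have hexp : aeval q F = ∑ D ∈ F.support, Polynomial.C (algebraMap K B (F.coeff D)) * ∏ i, q i ^ D i := by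
    rw [aeval_def, eval₂_eq']; rfl
  have hexp2 : algebraMap K B (eval b F) = ∑ D ∈ F.support, algebraMap K B (F.coeff D) * ∏ i, (algebraMap K B (b i)) ^ D i := by
    rw [eval_eq']; simp
  rw [hexp, hexp2]
  constructor
  · refine Polynomial.natDegree_sum_le_of_forall_le _ _ fun D hD => ?_
    refine (Polynomial.natDegree_C_mul_le _ _).trans ?_
    have := (hp D Finset.univ).1
    rwa [hd D hD] at this
  · rw [Polynomial.finset_sum_coeff]
    refine Finset.sum_congr rfl fun D hD => ?_
    have := (hp D Finset.univ).2
    rw [hd D hD] at this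
    rw [Polynomial.coeff_C_mul, this]

lemma nn_step [Infinite K] [Fintype σ] {d : ℕ} (hd : 0 < d) (V : Submodule K (MvPolynomial σ K))
    (hV : ∀ f ∈ V, f.IsHomogeneous d) {r : ℕ} (hr : Fintype.card σ < r + 1) (f : Fin (r+1) → MvPolynomial σ K)
    (hf : ∀ i, f i ∈ V) : ∃ f' : Fin r → MvPolynomial σ K, (∀ i, f' i ∈ V) ∧
      ∀ i, IsIntegral (Algebra.adjoin K (Set.range f')) (f i) := by
  have hdep : ¬ AlgebraicIndependent K f := by
    intro h
    have h1 := h.cardinalMk_le_trdeg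
    rw [MvPolynomial.trdeg_of_isDomain] at h1
    simp only [Cardinal.mk_fintype, Fintype.card_fin, Cardinal.lift_natCast] at h1
    have : r + 1 ≤ Fintype.card σ := by exact_mod_cast h1
    omega
  rw [algebraicIndependent_iff] at hdep
  push Not at hdep
  obtain ⟨F0, hF0, hF0ne⟩ := hdep
  obtain ⟨e, hne⟩ : ∃ e, homogeneousComponent e F0 ≠ 0 := by
    by_contra hcon
    push Not at hcon
    exact hF0ne (by rw [← sum_homogeneousComponent F0]; exact Finset.sum_eq_zero fun i _ => hcon i)
  set F := homogeneousComponent e F0 with hFdef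
  have hFh : F.IsHomogeneous e := homogeneousComponent_isHomogeneous e F0
  have hF : aeval f F = 0 := by
    have := comp_aeval_mul hd f (fun i => hV _ (hf i)) F0 (d * e)
    rw [if_pos (dvd_mul_right _ _), Nat.mul_div_cancel_left _ hd, hF0, map_zero] at this
    exact this.symm
  obtain ⟨c, hc⟩ : ∃ c : Fin (r+1) → K, eval c (F * X (Fin.last r)) ≠ 0 := by
    by_contra hcon
    push Not at hcon
    have : F * X (Fin.last r) = 0 := funext fun c => by rw [hcon c, map_zero]
    rcases mul_eq_zero.mp this with h | h
    · exact hne h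
    · exact X_ne_zero _ h
  rw [map_mul, eval_X] at hc
  have hcF := left_ne_zero_of_mul hc
  have hcl := right_ne_zero_of_mul hc
  let b : Fin (r+1) → K := fun i => (c (Fin.last r))⁻¹ * c i
  have hbF : eval b F ≠ 0 := by
    have : eval b F = (c (Fin.last r))⁻¹ ^ e * eval c F := by
      rw [eval_eq', eval_eq', Finset.mul_sum]
      refine Finset.sum_congr rfl fun D hD => ?_
      have h1 : ∑ i, D i = e := by
        have := hFh (mem_support_iff.mp hD)
        rw [← this, Finsupp.weight_apply, Finsupp.sum_fintype] <;> simp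
      simp only [b, mul_pow, Finset.prod_mul_distrib, Finset.prod_pow_eq_pow_sum, h1]
      ring
    rw [this]; exact mul_ne_zero (pow_ne_zero _ (inv_ne_zero hcl)) hcF
  have hbl : b (Fin.last r) = 1 := inv_mul_cancel₀ hcl
  let f' : Fin r → MvPolynomial σ K := fun i => f i.castSucc - b i.castSucc • f (Fin.last r)
  let t := f (Fin.last r)
  have ht : IsIntegral (Algebra.adjoin K (Set.range f')) t := by
    let a : Fin (r+1) → Algebra.adjoin K (Set.range f') :=
      Fin.lastCases 0 fun i => ⟨f' i, Algebra.subset_adjoin ⟨i, rfl⟩⟩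
    have ha : ∀ i, f i = (a i : MvPolynomial σ K) + b i • t := by
      intro i
      induction i using Fin.lastCases with
      | last => simp [a, hbl, t]
      | cast i => simp [a, f', t]
    obtain ⟨h1, h2⟩ := hompoly hFh a b
    set G := (aeval (fun i => Polynomial.C (a i) + Polynomial.C (algebraMap K _ (b i)) * Polynomial.X) F) with hG
    have hGt : Polynomial.aeval t G = 0 := by
      have h3 := comp_aeval (R := K) (fun i => Polynomial.C (a i) + Polynomial.C (algebraMap K _ (b i)) * Polynomial.X) 
        ((Polynomial.aeval (R := Algebra.adjoin K (Set.range f')) t).restrictScalars K)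
      have h4 := DFunLike.congr_fun h3 F
      refine Eq.trans h4 ?_
      rw [← hF]
      congr 2
      funext i
      rw [ha i]
      simp only [AlgHom.restrictScalars_apply, map_add, map_mul, Polynomial.aeval_C, Polynomial.aeval_X]
      rw [Algebra.smul_def]
      rfl
    refine ⟨Polynomial.C (algebraMap K _ (eval b F)⁻¹) * G, ?_, ?_⟩
    · refine Polynomial.monic_of_natDegree_le_of_coeff_eq_one e ((Polynomial.natDegree_C_mul_le _ _).trans h1) ?_
      rw [Polynomial.coeff_C_mul, h2, ← map_mul, inv_mul_cancel₀ hbF, map_one]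
    · rw [← Polynomial.aeval_def, map_mul, hGt, mul_zero]
  refine ⟨f', fun i => V.sub_mem (hf _) (V.smul_mem _ (hf _)), fun i => ?_⟩
  induction i using Fin.lastCases with
  | last => exact ht
  | cast i =>
    have h1 : f i.castSucc = f' i + b i.castSucc • t := by simp [f', t]
    rw [h1, Algebra.smul_def]
    refine IsIntegral.add ?_ (IsIntegral.mul ?_ ht)
    · exact isIntegral_algebraMap (x := (⟨f' i, Algebra.subset_adjoin ⟨i, rfl⟩⟩ : Algebra.adjoin K (Set.range f')))
    · exact isIntegral_algebraMap (x := algebraMap K (Algebra.adjoin K (Set.range f')) (b i.castSucc))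

lemma int_trans' {R S : Type} [CommRing R] [CommRing S] [Algebra R S] (g : S)
    (h : IsIntegral (integralClosure R S) g) : IsIntegral R g := isIntegral_trans g h

lemma nn [Infinite K] [Fintype σ] {d : ℕ} (hd : 0 < d) (V : Submodule K (MvPolynomial σ K))
    (hV : ∀ f ∈ V, f.IsHomogeneous d) (r : ℕ) : ∀ (f : Fin r → MvPolynomial σ K)
    (hf : ∀ i, f i ∈ V), ∃ r' ≤ Fintype.card σ, ∃ f' : Fin r' → MvPolynomial σ K, (∀ i, f' i ∈ V) ∧
      ∀ g : MvPolynomial σ K, IsIntegral (Algebra.adjoin K (Set.range f)) g → IsIntegral (Algebra.adjoin K (Set.range f')) g := by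
  induction r with
  | zero => exact fun f hf => ⟨0, Nat.zero_le _, f, hf, fun g h => h⟩
  | succ r ih =>
    intro f hf
    by_cases hr : Fintype.card σ < r + 1
    · obtain ⟨f1, hf1, hi⟩ := nn_step hd V hV hr f hf
      obtain ⟨r', hr', f', hf', h'⟩ := ih f1 hf1
      refine ⟨r', hr', f', hf', fun g hg => h' g ?_⟩
      let C1 := integralClosure (Algebra.adjoin K (Set.range f1)) (MvPolynomial σ K)
      have hsub : ∀ y ∈ Algebra.adjoin K (Set.range f), y ∈ C1 := by
        intro y hy
        induction hy using Algebra.adjoin_induction with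
        | mem a ha => obtain ⟨i, rfl⟩ := ha; exact hi i
        | algebraMap r => exact isIntegral_algebraMap (x := algebraMap K (Algebra.adjoin K (Set.range f1)) r)
        | add a b _ _ ha hb => exact C1.add_mem ha hb
        | mul a b _ _ ha hb => exact C1.mul_mem ha hb
      have h2 : IsIntegral C1 g := by
        obtain ⟨q, hq, he⟩ := hg
        let φ : Algebra.adjoin K (Set.range f) →+* C1 :=
          RingHom.codRestrict ((Algebra.adjoin K (Set.range f)).val : _ →+* MvPolynomial σ K) C1 fun y => hsub y y.2
        refine ⟨q.map φ, hq.map _, ?_⟩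
        rw [Polynomial.eval₂_map]; exact he
      exact int_trans' g h2
    · exact ⟨r+1, by omega, f, hf, fun g h => h⟩

end N
end SI

open MvPolynomial Matrix
namespace SI
section N
variable {K : Type} [Field K] {n m : ℕ}

/-- homogeneous semi-invariants of degree `d` -/
noncomputable def Rd (K : Type) [Field K] (n m d : ℕ) : Submodule K (MvPolynomial (Fin m × Fin n × Fin n) K) :=
  Subalgebra.toSubmodule (matrixSemiInvariants K n m) ⊓ homogeneousSubmodule _ K d

lemma mem_Rd {d : ℕ} {f : MvPolynomial (Fin m × Fin n × Fin n) K} :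
    f ∈ Rd K n m d ↔ f ∈ matrixSemiInvariants K n m ∧ f.IsHomogeneous d := Iff.rfl

lemma Rd_fin (d : ℕ) : ∃ (r : ℕ) (f : Fin r → MvPolynomial (Fin m × Fin n × Fin n) K),
    Submodule.span K (Set.range f) = Rd K n m d := by
  rw [← Submodule.fg_iff_exists_fin_generating_family]
  haveI : Module.Finite K (homogeneousSubmodule (Fin m × Fin n × Fin n) K d) :=
    Module.Finite.iff_fg.mpr (homogeneousSubmodule_fg _ _ d)
  haveI : FiniteDimensional K (Rd K n m d) := Submodule.finiteDimensional_of_le inf_le_right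
  exact Module.Finite.iff_fg.mp this

lemma pow_red {B S : Type} [CommRing B] [CommRing S] [Algebra B S] (g : S) (h : IsIntegral B g) :
    ∃ s : ℕ, ∀ q : ℕ, ∃ b : ℕ → B, g ^ q = ∑ i ∈ Finset.range s, algebraMap B S (b i) * g ^ i := by
  obtain ⟨p, hp, he⟩ := h
  refine ⟨p.natDegree + 1, fun q => ⟨(Polynomial.X ^ q %ₘ p).coeff, ?_⟩⟩
  have h1 : Polynomial.aeval g (Polynomial.X ^ q %ₘ p) = g ^ q := by
    have := Polynomial.aeval_modByMonic_eq_self_of_root (p := Polynomial.X ^ q) (q := p) (x := g) he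
    rw [this]; simp
  rw [← h1, Polynomial.aeval_eq_sum_range' (n := p.natDegree + 1)]
  · simp only [Algebra.smul_def]
  · exact Nat.lt_succ_of_le (Polynomial.natDegree_modByMonic_le _ hp)

lemma pigeon {r q : ℕ} (D : Fin r → ℕ) (h : r * q < ∑ i, D i) : ∃ i, q ≤ D i := by
  by_contra hcon
  push Not at hcon
  have : ∑ i, D i ≤ ∑ i : Fin r, q := Finset.sum_le_sum fun i _ => (hcon i).le
  simp at this
  omega

lemma aeval_mem_pow {S : Type} [CommRing S] [Algebra K S] (R : Subalgebra K S) {r q e : ℕ} (he : r * q < e) (f : Fin r → S)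
    (hf : ∀ i, f i ∈ R) (F : MvPolynomial (Fin r) K) (hF : F.IsHomogeneous e) :
    aeval f F ∈ Submodule.span R (Set.range fun j => f j ^ q) := by
  rw [aeval_def, eval₂_eq']
  refine Submodule.sum_mem _ fun D hD => ?_
  have h1 : ∑ i, D i = e := by
    have := hF (mem_support_iff.mp hD)
    rw [← this, Finsupp.weight_apply, Finsupp.sum_fintype] <;> simp
  obtain ⟨i, hi⟩ := pigeon D (by rw [h1]; exact he)
  have h2 : algebraMap K S (F.coeff D) * ∏ j, f j ^ D j =
      (⟨algebraMap K S (F.coeff D) * (f i ^ (D i - q) * ∏ j ∈ Finset.univ.erase i, f j ^ D j),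
        R.mul_mem (R.algebraMap_mem _) (R.mul_mem (R.pow_mem (hf i) _) (R.prod_mem fun j _ => R.pow_mem (hf j) _))⟩ : R) • f i ^ q := by
    rw [← Finset.mul_prod_erase _ _ (Finset.mem_univ i)]
    simp only [Subalgebra.smul_def, smul_eq_mul]
    nth_rewrite 1 [← Nat.sub_add_cancel hi]
    rw [pow_add]; ring
  rw [h2]
  exact Submodule.smul_mem _ _ (Submodule.subset_span ⟨i, rfl⟩)

lemma homComp_mul_right {σ : Type} {D : ℕ} {g : MvPolynomial σ K} (hg : g.IsHomogeneous D) (a : MvPolynomial σ K) (w : ℕ) :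
    homogeneousComponent (w + D) (a * g) = homogeneousComponent w a * g := by
  conv_lhs => rw [← sum_homogeneousComponent a]
  rw [Finset.sum_mul, map_sum]
  have : ∀ i, homogeneousComponent (w + D) (homogeneousComponent i a * g) =
      if w = i then homogeneousComponent i a * g else 0 := by
    intro i
    have := homogeneousComponent_of_mem (m := w + D) ((homogeneousComponent_isHomogeneous i a).mul hg)
    rw [this]
    simp
  simp only [this]
  rw [Finset.sum_ite_eq]
  split_ifs with h
  · rfl
  · rw [homogeneousComponent_eq_zero, zero_mul]
    simpa [Nat.lt_succ_iff] using h

theorem key_p (p : ℕ) [hp : Fact p.Prime] [CharP K p] [IsAlgClosed K] (hn : 2 ≤ n) (hm : 1 ≤ m) (D : ℕ)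
    (hD : m * n ^ 3 * (n - 1) < D) (g : MvPolynomial (Fin m × Fin n × Fin n) K) (hg : g ∈ Rd K n m D) :
    g ∈ Submodule.span K {z | ∃ f ∈ Rd K n m (n * (n-1)), ∃ r ∈ Rd K n m (D - n * (n-1)), z = f * r} := by
  classical
  haveI : Infinite K := IsAlgClosed.instInfinite
  set d := n * (n-1) with hd
  have hd0 : 0 < d := Nat.mul_pos (by omega) (by omega)
  obtain ⟨r0, f0, hf0⟩ := Rd_fin (K := K) (n := n) (m := m) d
  have hf0m : ∀ i, f0 i ∈ Rd K n m d := fun i => hf0 ▸ Submodule.subset_span ⟨i, rfl⟩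
  have hint0 : IsIntegral (Algebra.adjoin K (Set.range f0)) g := by
    have := integ hn hm (Finset.univ.image f0) (fun T => ?_) g hg.1 D hg.2
    · rwa [Finset.coe_image, Finset.coe_univ, Set.image_univ] at this
    · have h1 : fT n T ∈ Submodule.span K (Set.range f0) := by rw [hf0]; exact ⟨fT_mem T, fT_hom T⟩
      have h2 := Algebra.span_le_adjoin K _ h1
      simpa using h2
  obtain ⟨r, hr, f, hf, hfi⟩ := nn hd0 (Rd K n m d) (fun f hf => hf.2) r0 f0 hf0m
  obtain ⟨s, hs⟩ := pow_red g (hfi g hint0)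
  have hrD : r * d < D := by
    refine lt_of_le_of_lt ?_ hD
    simp only [Fintype.card_prod, Fintype.card_fin] at hr
    calc r * d ≤ (m * (n * n)) * (n * (n-1)) := Nat.mul_le_mul_right _ hr
      _ = _ := by ring
  obtain ⟨e, he⟩ : ∃ e, s * (r * d + 1) ≤ p ^ e := ⟨_, (Nat.lt_pow_self hp.1.one_lt).le⟩
  set q := p ^ e with hq
  obtain ⟨b, hb⟩ := hs q
  choose F hF using fun i => (show ∃ F : MvPolynomial (Fin r) K, aeval f F = (b i : MvPolynomial (Fin m × Fin n × Fin n) K) by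
    have : (b i : MvPolynomial (Fin m × Fin n × Fin n) K) ∈ (aeval (R := K) f).range :=
      Algebra.adjoin_range_eq_range_aeval K f ▸ (b i).2
    exact this)
  have hgq : g ^ q ∈ Submodule.span (matrixSemiInvariants K n m) (Set.range fun j => f j ^ q) := by
    have h1 : homogeneousComponent (D * q) (g ^ q) = g ^ q := by
      have := homogeneousComponent_of_mem (m := D * q) (hg.2.pow q)
      rw [this, if_pos rfl]
    rw [← h1, hb, map_sum]
    refine Submodule.sum_mem _ fun i hi => ?_
    have hi : i < s := Finset.mem_range.mp hi
    have hsq : s ≤ q := le_trans (Nat.le_mul_of_pos_right _ (Nat.succ_pos _)) he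
    have h2 : D * q = D * (q - i) + D * i := by rw [← mul_add, Nat.sub_add_cancel (by omega)]
    have h3 : algebraMap (Algebra.adjoin K (Set.range f)) (MvPolynomial (Fin m × Fin n × Fin n) K) (b i) = aeval f (F i) := (hF i).symm
    rw [h2, homComp_mul_right (hg.2.pow i), h3, comp_aeval_mul hd0 f (fun i => (hf i).2)]
    split_ifs with hdv
    · have h4 : r * q < D * (q - i) / d := by
        obtain ⟨t, ht⟩ := hdv
        rw [ht, Nat.mul_div_cancel_left _ hd0]
        by_contra hcon
        push Not at hcon
        have h5 : D * (q - i) ≤ d * (r * q) := by rw [ht]; exact Nat.mul_le_mul_left _ hcon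
        have h6 : (r * d + 1) * (q - i) ≤ D * (q - i) := Nat.mul_le_mul_right _ hrD
        obtain ⟨u, hu⟩ : ∃ u, q = i + 1 + u := ⟨q - (i+1), by omega⟩
        have h7 : (i + 1) * (r * d + 1) ≤ q := le_trans (Nat.mul_le_mul_right _ hi) he
        have h8 : q - i = u + 1 := by omega
        rw [h8] at h5 h6
        rw [hu] at h5 h7
        nlinarith
      have h5 := aeval_mem_pow (matrixSemiInvariants K n m) h4 f (fun i => (hf i).1) _ (homogeneousComponent_isHomogeneous _ (F i))
      have h6 := Submodule.smul_mem _ (⟨g ^ i, (matrixSemiInvariants K n m).pow_mem hg.1 i⟩ : matrixSemiInvariants K n m) h5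
      rw [mul_comm]; exact h6
    · rw [zero_mul]; exact Submodule.zero_mem _
  rw [Submodule.mem_span_range_iff_exists_fun] at hgq
  obtain ⟨c, hc⟩ := hgq
  obtain ⟨r', hr', hgr⟩ := fpure_pow p hm Finset.univ g f e (fun i => (c i : MvPolynomial (Fin m × Fin n × Fin n) K)) (fun i => (c i).2) (by
    rw [← hq, ← hc]
    exact Finset.sum_congr rfl fun i _ => mul_comm _ _)
  have hdD : d ≤ D := by
    refine le_trans ?_ hD.le
    have : n * (n-1) * 1 ≤ n * (n-1) * (m * n ^ 2) := Nat.mul_le_mul_left _ (Nat.mul_pos hm (by positivity))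
    calc d ≤ n * (n-1) * (m * n ^ 2) := by rw [hd]; omega
      _ = _ := by ring
  have hfin : g = ∑ i, f i * homogeneousComponent (D - d) (r' i) := by
    have h1 : homogeneousComponent D g = g := by
      have := homogeneousComponent_of_mem (m := D) hg.2
      rw [this, if_pos rfl]
    rw [← h1]
    conv_lhs => rw [hgr]
    rw [map_sum]
    refine Finset.sum_congr rfl fun i _ => ?_
    have := homComp_mul_right (hf i).2 (r' i) (D - d)
    rw [Nat.sub_add_cancel hdD] at this
    rw [mul_comm, this, mul_comm]
  rw [hfin]
  refine Submodule.sum_mem _ fun i _ => Submodule.subset_span ⟨f i, hf i, _, ⟨homComp_mem (hr' i) _, homogeneousComponent_isHomogeneous _ _⟩, rfl⟩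

end N
end SI

open MvPolynomial Matrix
namespace SI
section Z

lemma pinv {ρ ι : Type} [Fintype ρ] [Fintype ι] [DecidableEq ρ] [DecidableEq ι] (Φ : Matrix ρ ι ℤ) :
    ∃ (c : ℤ) (H : Matrix ι ρ ℤ), c ≠ 0 ∧ Φ * H * Φ = c • Φ := by
  let A : Matrix ρ ι ℚ := Φ.map (Int.castRingHom ℚ)
  obtain ⟨G, hG⟩ : ∃ G : Matrix ι ρ ℚ, A * G * A = A := by
    let f := Matrix.toLin' A
    obtain ⟨s, hs⟩ := LinearMap.exists_rightInverse_of_surjective f.rangeRestrict f.range_rangeRestrict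
    obtain ⟨g, hg⟩ := LinearMap.exists_extend s
    refine ⟨LinearMap.toMatrix' g, ?_⟩
    apply Matrix.toLin'.injective
    rw [Matrix.toLin'_mul, Matrix.toLin'_mul, Matrix.toLin'_toMatrix']
    ext1 v
    apply LinearMap.ext
    intro t
    have h1 : ∀ u, g (f u) = s (f.rangeRestrict u) := fun u => DFunLike.congr_fun hg (f.rangeRestrict u)
    have h2 : ∀ u, f (s u) = u := fun u => congrArg Subtype.val (DFunLike.congr_fun hs u)
    show f (g (f _)) = f _
    rw [h1, h2]; rfl
  obtain ⟨b, hb⟩ := IsLocalization.exist_integer_multiples_of_finite (nonZeroDivisors ℤ) (fun q : ι × ρ => G q.1 q.2)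
  choose H hH using hb
  refine ⟨b, Matrix.of fun i j => H (i, j), nonZeroDivisors.ne_zero b.2, ?_⟩
  have hH' : (Matrix.of fun i j => H (i, j)).map (Int.castRingHom ℚ) = ((b : ℤ) : ℚ) • G := by
    ext i j
    have := hH (i, j)
    simp only [algebraMap_int_eq, zsmul_eq_mul] at this
    simpa [Submonoid.smul_def] using this
  have hinj : Function.Injective (fun M : Matrix ρ ι ℤ => M.map (Int.castRingHom ℚ)) :=
    Matrix.map_injective Int.cast_injective
  apply hinj
  show (Φ * (Matrix.of fun i j => H (i, j)) * Φ).map (Int.castRingHom ℚ) = ((b : ℤ) • Φ).map (Int.castRingHom ℚ)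
  rw [Matrix.map_mul, Matrix.map_mul, hH', Matrix.mul_smul, Matrix.smul_mul]
  show ((b : ℤ) : ℚ) • (A * G * A) = _
  rw [hG]
  ext i j
  simp [A]

lemma span_descent {σ J : Type} [Fintype J] (a : J → MvPolynomial σ ℤ) (w : MvPolynomial σ ℤ) (c0 : ℤ) (hc0 : c0 ≠ 0)
    (h : ∀ p : ℕ, ∀ hp : Fact p.Prime, ((c0 : AlgebraicClosure (ZMod p)) ≠ 0) →
      map (Int.castRingHom (AlgebraicClosure (ZMod p))) w ∈
        Submodule.span (AlgebraicClosure (ZMod p)) (Set.range fun j => map (Int.castRingHom (AlgebraicClosure (ZMod p))) (a j))) :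
    ∃ (c : ℤ) (u : J → ℤ), c ≠ 0 ∧ c • w = ∑ j, u j • a j := by
  classical
  let ρ := (w.support ∪ Finset.univ.biUnion fun j => (a j).support : Finset (σ →₀ ℕ))
  let Ψ : Matrix ρ J ℤ := Matrix.of fun β j => coeff β.1 (a j)
  let wv : ρ → ℤ := fun β => coeff β.1 w
  obtain ⟨c, H, hc, hH⟩ := pinv Ψ
  have key : Ψ *ᵥ (H *ᵥ wv) = c • wv := by
    funext β
    by_contra hne
    set x := (Ψ *ᵥ (H *ᵥ wv)) β - (c • wv) β with hx
    have hx0 : x ≠ 0 := sub_ne_zero.mpr hne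
    obtain ⟨p, hpl, hp⟩ := Nat.exists_infinite_primes (x.natAbs + c0.natAbs + 1)
    haveI : Fact p.Prime := ⟨hp⟩
    let F := AlgebraicClosure (ZMod p)
    haveI : CharP F p := charP_of_injective_algebraMap (algebraMap (ZMod p) F).injective p
    have hnz : ∀ z : ℤ, z ≠ 0 → z.natAbs < p → (z : F) ≠ 0 := by
      intro z hz hlt h0
      rw [CharP.intCast_eq_zero_iff F p] at h0
      exact absurd (Nat.le_of_dvd (Int.natAbs_pos.mpr hz) (Int.natCast_dvd.mp h0)) (by omega)
    apply hnz x hx0 (by omega)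
    obtain ⟨u, hu⟩ := (Submodule.mem_span_range_iff_exists_fun _).mp (h p ⟨hp⟩ (hnz c0 hc0 (by omega)))
    have hwv : (fun β => ((wv β : ℤ) : F)) = (Ψ.map (Int.castRingHom F)) *ᵥ u := by
      funext β
      have := congrArg (coeff β.1) hu
      rw [coeff_sum, coeff_map] at this
      simp only [coeff_smul, coeff_map, smul_eq_mul] at this
      simp only [Matrix.mulVec, dotProduct, Matrix.map_apply]
      refine Eq.trans this.symm (Finset.sum_congr rfl fun j _ => mul_comm _ _)
    have hcast : ∀ {α γ : Type} [Fintype γ] (M : Matrix α γ ℤ) (v : γ → ℤ),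
        (fun i => (((M *ᵥ v) i : ℤ) : F)) = (M.map (Int.castRingHom F)) *ᵥ (fun i => ((v i : ℤ) : F)) := by
      intro α γ _ M v
      funext i
      simp only [Matrix.mulVec, dotProduct, Matrix.map_apply]
      rw [Int.cast_sum]
      exact Finset.sum_congr rfl fun _ _ => Int.cast_mul _ _
    have hHF : Ψ.map (Int.castRingHom F) * H.map (Int.castRingHom F) * Ψ.map (Int.castRingHom F) = (c : F) • Ψ.map (Int.castRingHom F) := by
      rw [← Matrix.map_mul, ← Matrix.map_mul, hH]
      ext i j; simp
    have h1 : (fun i => (((Ψ *ᵥ (H *ᵥ wv)) i : ℤ) : F)) = (c : F) • (fun β => ((wv β : ℤ) : F)) := by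
      rw [hcast, hcast, hwv, Matrix.mulVec_mulVec, Matrix.mulVec_mulVec, hHF, Matrix.smul_mulVec]
    have h2 := congrFun h1 β
    simp only [Pi.smul_apply, smul_eq_mul] at h2
    rw [hx]
    push_cast
    rw [h2]
    simp only [Pi.smul_apply, smul_eq_mul]
    rw [Int.cast_mul, sub_self]
  refine ⟨c, H *ᵥ wv, hc, ?_⟩
  ext β
  rw [coeff_smul, coeff_sum]
  simp only [coeff_smul, smul_eq_mul]
  by_cases hβ : β ∈ ρ
  · have := congrFun key ⟨β, hβ⟩
    simp only [Pi.smul_apply, smul_eq_mul] at this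
    rw [← this]
    simp only [Matrix.mulVec, dotProduct, Ψ, Matrix.of_apply]
    exact Finset.sum_congr rfl fun j _ => mul_comm _ _
  · simp only [ρ, Finset.mem_union, Finset.mem_biUnion, Finset.mem_univ, true_and, not_or, not_exists, mem_support_iff, not_not] at hβ
    rw [hβ.1, mul_zero]
    exact (Finset.sum_eq_zero fun j _ => by rw [hβ.2 j, mul_zero]).symm

end Z
end SI

open MvPolynomial Matrix
namespace SI
section Z1

lemma kerspan {τ ι : Type} [Fintype ι] (q : ι → MvPolynomial τ ℤ) :
    ∃ (c : ℤ) (E : ι → ι → ℤ), c ≠ 0 ∧ (∀ α, ∑ γ, E γ α • q γ = 0) ∧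
      ∀ (F : Type) [Field F] (v : ι → F), ∑ α, v α • map (Int.castRingHom F) (q α) = 0 →
        ∀ γ, (c : F) * v γ = ∑ α, (E γ α : F) * v α := by
  classical
  let ρ := (Finset.univ.biUnion fun j => (q j).support : Finset (τ →₀ ℕ))
  let Φ : Matrix ρ ι ℤ := Matrix.of fun β j => coeff β.1 (q j)
  obtain ⟨c, H, hc, hH⟩ := pinv Φ
  let E : Matrix ι ι ℤ := c • (1 : Matrix ι ι ℤ) - H * Φ
  refine ⟨c, E, hc, ?_, ?_⟩
  · intro α
    have hE : Φ * E = 0 := by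
      simp only [E]
      rw [Matrix.mul_sub, ← Matrix.mul_assoc, hH, Matrix.mul_smul, Matrix.mul_one, sub_self]
    ext β
    rw [coeff_sum]
    simp only [coeff_smul, smul_eq_mul, coeff_zero]
    by_cases hβ : β ∈ ρ
    · have := congrFun (congrFun hE ⟨β, hβ⟩) α
      rw [Matrix.mul_apply] at this
      simp only [Φ, Matrix.of_apply, Matrix.zero_apply] at this
      rw [← this]
      exact Finset.sum_congr rfl fun j _ => mul_comm _ _
    · simp only [ρ, Finset.mem_biUnion, Finset.mem_univ, true_and, not_exists, mem_support_iff, not_not] at hβ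
      exact Finset.sum_eq_zero fun j _ => by rw [hβ j, mul_zero]
  · intro F _ v hv γ
    have h1 : (Φ.map (Int.castRingHom F)) *ᵥ v = 0 := by
      funext β
      have := congrArg (coeff β.1) hv
      rw [coeff_sum] at this
      simp only [coeff_smul, coeff_map, smul_eq_mul, coeff_zero] at this
      simp only [Matrix.mulVec, dotProduct, Matrix.map_apply, Pi.zero_apply]
      rw [← this]
      exact Finset.sum_congr rfl fun j _ => mul_comm _ _
    have h2 : E.map (Int.castRingHom F) = (c : F) • (1 : Matrix ι ι F) - H.map (Int.castRingHom F) * Φ.map (Int.castRingHom F) := by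
      rw [← Matrix.map_mul]
      ext i j
      simp only [E, Matrix.map_apply, Matrix.sub_apply, Matrix.smul_apply, Matrix.one_apply]
      split_ifs <;> simp
    have h3 : E.map (Int.castRingHom F) *ᵥ v = (c : F) • v := by
      rw [h2, Matrix.sub_mulVec, ← Matrix.mulVec_mulVec, h1, Matrix.mulVec_zero, sub_zero, Matrix.smul_mulVec, Matrix.one_mulVec]
    have h4 := congrFun h3 γ
    simp only [Pi.smul_apply, smul_eq_mul] at h4
    rw [← h4]
    rfl

/-- variables: entries of a, b and x -/
abbrev TV (n m : ℕ) := (Fin n × Fin n) ⊕ (Fin n × Fin n) ⊕ (Fin m × Fin n × Fin n)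

/-- generic a -/
noncomputable def ga (R : Type) [CommRing R] (n m : ℕ) : Matrix (Fin n) (Fin n) (MvPolynomial (TV n m) R) :=
  Matrix.of fun i j => X (Sum.inl (i, j))
/-- generic b -/
noncomputable def gb (R : Type) [CommRing R] (n m : ℕ) : Matrix (Fin n) (Fin n) (MvPolynomial (TV n m) R) :=
  Matrix.of fun i j => X (Sum.inr (Sum.inl (i, j)))
/-- generic x -/
noncomputable def gx (R : Type) [CommRing R] (n m : ℕ) (l : Fin m) : Matrix (Fin n) (Fin n) (MvPolynomial (TV n m) R) :=
  Matrix.of fun i j => X (Sum.inr (Sum.inr (l, i, j)))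

/-- the defining linear map -/
noncomputable def phi (R : Type) [CommRing R] (n m k : ℕ) :
    MvPolynomial (Fin m × Fin n × Fin n) R →ₗ[R] MvPolynomial (TV n m) R :=
  (aeval (fun q : Fin m × Fin n × Fin n => (ga R n m * gx R n m q.1 * gb R n m) q.2.1 q.2.2)).toLinearMap -
    LinearMap.mulLeft R (((ga R n m).det * (gb R n m).det) ^ k) ∘ₗ
      (aeval (fun q : Fin m × Fin n × Fin n => gx R n m q.1 q.2.1 q.2.2)).toLinearMap

lemma phi_apply (R : Type) [CommRing R] (n m k : ℕ) (z) : phi R n m k z =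
    aeval (fun q : Fin m × Fin n × Fin n => (ga R n m * gx R n m q.1 * gb R n m) q.2.1 q.2.2) z -
    ((ga R n m).det * (gb R n m).det) ^ k * aeval (fun q : Fin m × Fin n × Fin n => gx R n m q.1 q.2.1 q.2.2) z := rfl

lemma map_aeval' {R F σ τ : Type} [CommRing R] [CommRing F] (f : R →+* F) (g : σ → MvPolynomial τ R) (z : MvPolynomial σ R) :
    map f (aeval g z) = aeval (fun i => map f (g i)) (map f z) := by
  induction z using MvPolynomial.induction_on with
  | C a => simp [algebraMap_eq]
  | add p q hp hq => simp only [map_add, hp, hq]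
  | mul_X p i hp => simp only [map_mul, hp, aeval_X, map_X]

lemma map_phi (F : Type) [CommRing F] (n m k : ℕ) (z) :
    map (Int.castRingHom F) (phi ℤ n m k z) = phi F n m k (map (Int.castRingHom F) z) := by
  have ha : (ga ℤ n m).map (map (Int.castRingHom F)) = ga F n m := by ext i j : 2; simp [ga]
  have hb : (gb ℤ n m).map (map (Int.castRingHom F)) = gb F n m := by ext i j : 2; simp [gb]
  have hx : ∀ l, (gx ℤ n m l).map (map (Int.castRingHom F)) = gx F n m l := by intro l; ext i j : 2; simp [gx]
  rw [phi_apply, phi_apply, map_sub, map_mul, map_pow, map_mul, map_aeval', map_aeval']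
  rw [RingHom.map_det, RingHom.map_det, RingHom.mapMatrix_apply, RingHom.mapMatrix_apply, ha, hb]
  congr 2
  · congr 2
    funext q
    rw [← ha, ← hb, ← hx, ← Matrix.map_mul, ← Matrix.map_mul]; rfl
  · congr 2
    funext q
    rw [← hx]; rfl

lemma phi_zero_of_mem {F : Type} [Field F] [IsAlgClosed F] {n m k : ℕ} (hn : 0 < n) {f}
    (hf : f ∈ Rd F n m (n*k)) : phi F n m k f = 0 := by
  have := law hf.1 hf.2 hn (ga F n m) (gb F n m) (gx F n m)
  rw [phi_apply, sub_eq_zero]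
  exact this

lemma mem_of_phi_zero {F : Type} [Field F] {n m k : ℕ} {f}
    (hf : phi F n m k f = 0) : f ∈ matrixSemiInvariants F n m := by
  rw [mem_iff]
  intro A B hA hB x
  rw [phi_apply, sub_eq_zero] at hf
  let θ : MvPolynomial (TV n m) F →ₐ[F] F := aeval (Sum.elim (fun q => A q.1 q.2) (Sum.elim (fun q => B q.1 q.2) (fun q => x q.1 q.2.1 q.2.2)))
  have ha : (ga F n m).map θ = A := by ext i j; simp [ga, θ]
  have hb : (gb F n m).map θ = B := by ext i j; simp [gb, θ]
  have hx : ∀ l, (gx F n m l).map θ = x l := by intro l; ext i j; simp [gx, θ]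
  have h := congrArg θ hf
  rw [map_mul, map_pow, map_mul, AlgHom.map_det, AlgHom.map_det, AlgHom.mapMatrix_apply, AlgHom.mapMatrix_apply, ha, hb, hA, hB, mul_one, one_pow, one_mul] at h
  have e1 := ev_comp θ (fun l => ga F n m * gx F n m l * gb F n m) f
  have e2 := ev_comp θ (gx F n m) f
  simp only [Matrix.map_mul, ha, hb, hx] at e1 e2
  rw [← e1]
  exact h.trans e2

lemma spanning (n m k : ℕ) (hn : 0 < n) : ∃ (c : ℤ) (ι : Type) (_ : Fintype ι) (w : ι → MvPolynomial (Fin m × Fin n × Fin n) ℤ),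
    c ≠ 0 ∧ (∀ (F : Type) [Field F] (i : ι), map (Int.castRingHom F) (w i) ∈ Rd F n m (n*k)) ∧
    ∀ (F : Type) [Field F] [IsAlgClosed F], (c : F) ≠ 0 → ∀ f ∈ Rd F n m (n*k),
      f ∈ Submodule.span F (Set.range fun i => map (Int.castRingHom F) (w i)) := by
  classical
  let ι := {α : (Fin m × Fin n × Fin n) →₀ ℕ // α.degree = n*k}
  haveI : Finite ι := (Finsupp.finite_of_degree_le (n*k)).subset (fun α (h : α.degree = n*k) => h.le)
  letI : Fintype ι := Fintype.ofFinite ι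
  obtain ⟨c, E, hc, h1, h2⟩ := kerspan (fun α : ι => phi ℤ n m k (monomial α.1 1))
  refine ⟨c, ι, inferInstance, fun α => ∑ γ : ι, E γ α • monomial γ.1 1, hc, ?_, ?_⟩
  · intro F _ α
    refine mem_Rd.mpr ⟨?_, ?_⟩
    · apply mem_of_phi_zero (k := k)
      rw [← map_phi, map_sum]
      simp only [map_zsmul] 
      rw [← map_zero (map (Int.castRingHom F)), ← h1 α, map_sum]
    · rw [map_sum]
      refine IsHomogeneous.sum _ _ _ fun γ _ => ?_
      rw [map_zsmul, map_monomial, ← Int.cast_smul_eq_zsmul F]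
      rw [smul_monomial]
      exact isHomogeneous_monomial _ γ.2
  · intro F _ _ hcF f hf
    have hfs : f = ∑ α : ι, coeff α.1 f • monomial α.1 (1:F) := by
      ext β
      rw [coeff_sum]
      simp only [coeff_smul, coeff_monomial, smul_eq_mul, mul_ite, mul_one, mul_zero]
      by_cases hβ : β.degree = n*k
      · rw [Finset.sum_eq_single (⟨β, hβ⟩ : ι)]
        · simp
        · intro b _ hb
          rw [if_neg]
          rintro rfl
          exact hb rfl
        · simp
      · rw [Finset.sum_eq_zero]
        · exact hf.2.coeff_eq_zero hβ
        · intro b _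
          rw [if_neg]
          rintro rfl
          exact hβ b.2
    have h3 := phi_zero_of_mem hn hf
    have h4 : ∑ α : ι, coeff α.1 f • map (Int.castRingHom F) (phi ℤ n m k (monomial α.1 1)) = 0 := by
      rw [← h3]
      conv_rhs => rw [hfs]
      rw [map_sum]
      refine Finset.sum_congr rfl fun α _ => ?_
      rw [map_phi, LinearMap.map_smul, map_monomial, map_one]
    have h5 := h2 F (fun α => coeff α.1 f) h4
    have h6 : (c : F) • f = ∑ α : ι, coeff α.1 f • map (Int.castRingHom F) (∑ γ : ι, E γ α • monomial γ.1 1) := by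
      conv_lhs => rw [hfs]
      simp only [map_sum, Finset.smul_sum]
      rw [Finset.sum_comm]
      refine Finset.sum_congr rfl fun γ _ => ?_
      rw [smul_smul, h5 γ, Finset.sum_smul]
      refine Finset.sum_congr rfl fun α _ => ?_
      rw [map_zsmul, map_monomial, map_one (Int.castRingHom F), ← Int.cast_smul_eq_zsmul F, smul_smul, mul_comm]
    have h7 : f = (c : F)⁻¹ • ((c : F) • f) := by rw [smul_smul, inv_mul_cancel₀ hcF, one_smul]
    rw [h7, h6]
    exact Submodule.smul_mem _ _ (Submodule.sum_mem _ fun α _ => Submodule.smul_mem _ _ (Submodule.subset_span ⟨α, rfl⟩))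

end Z1
end SI

open MvPolynomial Matrix
namespace SI
section Z2

lemma span_mul_mem {F σ ι κ : Type} [Field F] (z : ι → MvPolynomial σ F) (y : κ → MvPolynomial σ F) {f r}
    (hf : f ∈ Submodule.span F (Set.range z)) (hr : r ∈ Submodule.span F (Set.range y)) :
    f * r ∈ Submodule.span F (Set.range fun q : ι × κ => z q.1 * y q.2) := by
  have := Submodule.mul_mem_mul hf hr
  rw [Submodule.span_mul_span] at this
  refine Submodule.span_mono ?_ this
  rintro _ ⟨_, ⟨i, rfl⟩, _, ⟨j, rfl⟩, rfl⟩
  exact ⟨(i, j), rfl⟩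

lemma key_0 {K : Type} [Field K] [CharZero K] [IsAlgClosed K] {n m : ℕ} (hn : 2 ≤ n) (hm : 1 ≤ m)
    (D : ℕ) (hD : m*n^3*(n-1) < D) (g) (hg : g ∈ Rd K n m D) :
    g ∈ Submodule.span K {z | ∃ f ∈ Rd K n m (n*(n-1)), ∃ r ∈ Rd K n m (D - n*(n-1)), z = f * r} := by
  rcases dvd_or_zero hg.1 hg.2 (by omega) with hdv | h0
  swap
  · rw [h0]; exact Submodule.zero_mem _
  obtain ⟨k, rfl⟩ := hdv
  have hsub : n*k - n*(n-1) = n*(k-(n-1)) := (Nat.mul_sub n k (n-1)).symm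
  rw [hsub]
  obtain ⟨c1, ι1, _, w, hc1, w1, w2⟩ := spanning n m k (by omega)
  obtain ⟨c2, ι2, _, z, hc2, z1, z2⟩ := spanning n m (n-1) (by omega)
  obtain ⟨c3, ι3, _, y, hc3, y1, y2⟩ := spanning n m (k-(n-1)) (by omega)
  refine Submodule.span_le.mpr ?_ (w2 K (Int.cast_ne_zero.mpr hc1) g hg)
  rintro _ ⟨l, rfl⟩
  obtain ⟨c, u, hc, hu⟩ := span_descent (fun q : ι2 × ι3 => z q.1 * y q.2) (w l) (c2*c3)
    (mul_ne_zero hc2 hc3) (by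
      intro p hp hne
      haveI : CharP (AlgebraicClosure (ZMod p)) p :=
        charP_of_injective_algebraMap (algebraMap (ZMod p) (AlgebraicClosure (ZMod p))).injective p
      have h := key_p p hn hm (n*k) hD _ (w1 (AlgebraicClosure (ZMod p)) l)
      rw [hsub] at h
      rw [Int.cast_mul] at hne
      refine Submodule.span_le.mpr ?_ h
      rintro _ ⟨f, hf, r, hr, rfl⟩
      have := span_mul_mem _ _ (z2 _ (left_ne_zero_of_mul hne) f hf) (y2 _ (right_ne_zero_of_mul hne) r hr)
      simpa only [map_mul, SetLike.mem_coe] using this)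
  have hu' := congrArg (map (Int.castRingHom K)) hu
  rw [map_zsmul, map_sum] at hu'
  have hcK : (c : K) ≠ 0 := Int.cast_ne_zero.mpr hc
  show map (Int.castRingHom K) (w l) ∈ _
  have h7 : map (Int.castRingHom K) (w l) = (c : K)⁻¹ • (c • map (Int.castRingHom K) (w l)) := by
    rw [← Int.cast_smul_eq_zsmul K, smul_smul, inv_mul_cancel₀ hcK, one_smul]
  rw [h7, hu']
  refine Submodule.smul_mem _ _ (Submodule.sum_mem _ fun q _ => ?_)
  rw [map_zsmul, ← Int.cast_smul_eq_zsmul K, map_mul]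
  exact Submodule.smul_mem _ _ (Submodule.subset_span ⟨_, z1 K q.1, _, y1 K q.2, rfl⟩)

lemma key_all {K : Type} [Field K] [IsAlgClosed K] {n m : ℕ} (hn : 2 ≤ n) (hm : 1 ≤ m)
    (D : ℕ) (hD : m*n^3*(n-1) < D) (g) (hg : g ∈ Rd K n m D) :
    g ∈ Submodule.span K {z | ∃ f ∈ Rd K n m (n*(n-1)), ∃ r ∈ Rd K n m (D - n*(n-1)), z = f * r} := by
  obtain ⟨p, hp⟩ := CharP.exists K
  rcases CharP.char_is_prime_or_zero K p with h | rfl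
  · haveI : Fact p.Prime := ⟨h⟩
    exact key_p p hn hm D hD g hg
  · haveI : CharZero K := CharP.charP_to_charZero K
    exact key_0 hn hm D hD g hg

lemma gen_all {K : Type} [Field K] [IsAlgClosed K] {n m : ℕ} (hn : 2 ≤ n) (hm : 1 ≤ m)
    (D : ℕ) : ∀ g ∈ Rd K n m D, g ∈ Algebra.adjoin K
        {f | f ∈ matrixSemiInvariants K n m ∧ ∃ d ≤ m * n ^ 3 * (n - 1), f.IsHomogeneous d} := by
  induction D using Nat.strong_induction_on with
  | _ D ih =>
    intro g hg
    by_cases hD : D ≤ m*n^3*(n-1)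
    · exact Algebra.subset_adjoin ⟨hg.1, D, hD, hg.2⟩
    · have h := key_all hn hm D (by omega) g hg
      have hle : n*(n-1) ≤ m*n^3*(n-1) := by
        refine Nat.mul_le_mul_right _ ?_
        calc n = 1 * n^1 := by ring
          _ ≤ m * n^3 := Nat.mul_le_mul hm (Nat.pow_le_pow_right (by omega) (by omega))
      have hpos : 0 < n*(n-1) := Nat.mul_pos (by omega) (by omega)
      refine (Submodule.span_le (p := Subalgebra.toSubmodule (Algebra.adjoin K
        {f | f ∈ matrixSemiInvariants K n m ∧ ∃ d ≤ m * n ^ 3 * (n - 1), f.IsHomogeneous d}))).mpr ?_ h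
      rintro _ ⟨f, hf, r, hr, rfl⟩
      exact Subalgebra.mul_mem _ (Algebra.subset_adjoin ⟨hf.1, _, hle, hf.2⟩) (ih _ (by omega) r hr)

end Z2
end SI

/-- For `n ≥ 2`, the ring of matrix semi-invariants `R(n,m)` is generated by
its homogeneous elements of degree `≤ m * n^3 * (n - 1)`. -/
theorem stmt_1 (K : Type) [Field K] [IsAlgClosed K] (n m : ℕ) (hn : 2 ≤ n) (hm : 1 ≤ m) :
    Algebra.adjoin K
        {f | f ∈ matrixSemiInvariants K n m ∧ ∃ d ≤ m * n ^ 3 * (n - 1), f.IsHomogeneous d}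
      = matrixSemiInvariants K n m := by
  apply le_antisymm
  · exact Algebra.adjoin_le fun f hf => hf.1
  · intro f hf
    haveI : Infinite K := IsAlgClosed.instInfinite
    rw [← sum_homogeneousComponent f]
    exact Subalgebra.sum_mem _ fun D _ => SI.gen_all hn hm D _
      (SI.mem_Rd.mpr ⟨SI.homComp_mem hf D, homogeneousComponent_isHomogeneous D f⟩)
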